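/- Let k ∈ ℕ ∪ {0}, let Ω ⊂ ℝ^d be a bounded domain with C^{k+2} boundary, and let p ∈ (1, ∞). If u ∈ W^{2,p}(Ω) and f ∈ W^{k,p}(Ω) satisfy Δu = f in Ω and u = 0 on ∂Ω, then u ∈ W^{k+2,p}(Ω) and there exists C = C(d, k, p, Ω) such that ‖D^{k+2} u‖_{L^p(Ω)} ≤ C ( ‖u‖_{L^p(Ω)} + ‖f‖_{W^{k,p}(Ω)} ). -/

import Mathlib

open MeasureTheory Filter Topology
open scoped ENNReal NNReal

noncomputable section

/-- Euclidean space `ℝ^d`. -/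
abbrev Euc (d : ℕ) := EuclideanSpace ℝ (Fin d)

variable {d : ℕ}

/-- `φ` is a test function on `Ω`, i.e. `φ ∈ C_c^∞(Ω)`. -/
def IsTestFun (Ω : Set (Euc d)) (φ : Euc d → ℝ) : Prop :=
  ContDiff ℝ (⊤ : ℕ∞) φ ∧ HasCompactSupport φ ∧ tsupport φ ⊆ Ω

/-- Classical partial derivative in the `i`-th coordinate direction. -/
def pd (i : Fin d) (f : Euc d → ℝ) (x : Euc d) : ℝ :=
  fderiv ℝ f x (EuclideanSpace.single i 1)

/-- Classical Laplacian. -/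
def lap (f : Euc d → ℝ) (x : Euc d) : ℝ := ∑ i, pd i (pd i f) x

/-- Iterated classical partial derivatives along a multi-index. -/
def iterPD : {m : ℕ} → (Fin m → Fin d) → (Euc d → ℝ) → Euc d → ℝ
  | 0, _, f => f
  | _ + 1, a, f => iterPD (fun i => a i.succ) (pd (a 0) f)

/-- `v` is the family of `m`-th order weak partial derivatives of `u` on `Ω`. -/
def HasWeakDerivs (Ω : Set (Euc d)) (m : ℕ) (u : Euc d → ℝ)
    (v : (Fin m → Fin d) → Euc d → ℝ) : Prop :=
  ∀ a : Fin m → Fin d, ∀ φ : Euc d → ℝ, IsTestFun Ω φ →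
    ∫ x in Ω, u x * iterPD a φ x = (-1 : ℝ) ^ m * ∫ x in Ω, v a x * φ x

/-- Membership in the Sobolev space `W^{k,p}(Ω)`. -/
def MemW (Ω : Set (Euc d)) (p : ℝ≥0∞) (k : ℕ) (u : Euc d → ℝ) : Prop :=
  ∀ m : ℕ, m ≤ k → ∃ v, HasWeakDerivs Ω m u v ∧
    ∀ a, MemLp (v a) p (volume.restrict Ω)

/-- Pointwise magnitude of a family of `m`-th order derivatives. -/
def Dmag {m : ℕ} (v : (Fin m → Fin d) → Euc d → ℝ) (x : Euc d) : ℝ :=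
  ∑ a : Fin m → Fin d, |v a x|

/-- `L^p(Ω)` norm of a family of `m`-th order derivatives. -/
def DkNorm (Ω : Set (Euc d)) (p : ℝ≥0∞) {m : ℕ}
    (v : (Fin m → Fin d) → Euc d → ℝ) : ℝ≥0∞ :=
  eLpNorm (Dmag v) p (volume.restrict Ω)

/-- Membership in `W^{1,p}_0(Ω)`: there is a weak gradient, and `u` is approximated
together with its gradient by test functions in the `L^p` norm. -/
def MemW10 (Ω : Set (Euc d)) (p : ℝ≥0∞) (u : Euc d → ℝ) : Prop :=
  ∃ v : Fin d → Euc d → ℝ,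
    HasWeakDerivs Ω 1 u (fun a => v (a 0)) ∧
    (∀ i, MemLp (v i) p (volume.restrict Ω)) ∧
    ∃ φ : ℕ → Euc d → ℝ, (∀ n, IsTestFun Ω (φ n)) ∧
      Tendsto (fun n =>
        eLpNorm (fun x => u x - φ n x) p (volume.restrict Ω) +
        ∑ i : Fin d, eLpNorm (fun x => v i x - pd i (φ n) x) p (volume.restrict Ω))
        atTop (𝓝 0)

/-- `Δu = f` holds weakly (in the distributional sense) in `Ω`. -/
def IsWeakLap (Ω : Set (Euc d)) (u f : Euc d → ℝ) : Prop :=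
  ∀ φ : Euc d → ℝ, IsTestFun Ω φ →
    ∫ x in Ω, u x * lap φ x = ∫ x in Ω, f x * φ x

/-- `Ω` is a bounded domain. -/
def IsBoundedDomain (Ω : Set (Euc d)) : Prop :=
  IsOpen Ω ∧ IsConnected Ω ∧ Bornology.IsBounded Ω

/-- `Ω` has a `C^k` boundary, described by local level sets of `C^k` defining
functions with nonvanishing gradient. -/
def HasCkBoundary (Ω : Set (Euc d)) (k : ℕ∞) : Prop :=
  ∀ x ∈ frontier Ω, ∃ (U : Set (Euc d)) (ρ : Euc d → ℝ),
    IsOpen U ∧ x ∈ U ∧ ContDiffOn ℝ k ρ U ∧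
    (∀ y ∈ U, fderiv ℝ ρ y ≠ 0) ∧
    Ω ∩ U = {y ∈ U | ρ y < 0} ∧ frontier Ω ∩ U = {y ∈ U | ρ y = 0}

/-- `L^p(Ω)` norm of the (classical) `m`-th order derivatives of `f`. -/
def cDNorm (Ω : Set (Euc d)) (p : ℝ≥0∞) (m : ℕ) (f : Euc d → ℝ) : ℝ≥0∞ :=
  eLpNorm (fun x => ‖iteratedFDeriv ℝ m f x‖) p (volume.restrict Ω)

/-- `u` is the solution of the heat equation on `Ω` with Dirichlet boundary
condition and initial data `u₀`: it is continuous up to the parabolic boundary,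
smooth in space for positive times, satisfies `∂ₜ u = Δu` in `Ω`, vanishes on
`∂Ω`, and starts from `u₀`. -/
def IsHeatSol (Ω : Set (Euc d)) (u₀ : Euc d → ℝ) (u : ℝ → Euc d → ℝ) : Prop :=
  ContinuousOn (fun q : ℝ × Euc d => u q.1 q.2) (Set.Ici 0 ×ˢ closure Ω) ∧
  (∀ t, 0 < t → ContDiffOn ℝ (⊤ : ℕ∞) (u t) Ω) ∧
  (∀ t, 0 < t → ∀ x ∈ Ω, HasDerivAt (fun s => u s x) (lap (u t) x) t) ∧
  (∀ t, 0 < t → ∀ x ∈ frontier Ω, u t x = 0) ∧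
  (∀ x, u 0 x = u₀ x)

/-- The quantity `N[u](t,x) = |u| + t^{1/2}|∇u| + t|∇²u| + t|∂ₜ u|`. -/
def Nfun (u : ℝ → Euc d → ℝ) (t : ℝ) (x : Euc d) : ℝ :=
  |u t x| + Real.sqrt t * ‖fderiv ℝ (u t) x‖ + t * ‖iteratedFDeriv ℝ 2 (u t) x‖ +
    t * |deriv (fun s => u s x) t|

/-- The upper half space `ℝ^{d+1}_+`. -/
def halfSpace (d : ℕ) : Set (Euc (d+1)) := {x | 0 < x (Fin.last d)}

/-- The cube of side length `t^{1/2}` centered at `t^{1/2} n`, `n ∈ ℤ^d`. -/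
def cube (t : ℝ) (n : Fin d → ℤ) : Set (Euc d) :=
  {x | ∀ i, |x i - Real.sqrt t * (n i : ℝ)| ≤ Real.sqrt t / 2}

end

namespace Bell

/-- The regularised Bellman function. -/
noncomputable def B (α β δ ε : ℝ) (z : ℝ × ℝ) : ℝ :=
  (z.1 ^ 2 + ε ^ 2) ^ α + (1 + δ) * (z.2 ^ 2 + ε ^ 2) ^ β
    - δ * ((z.2 ^ 2 + ε ^ 2) ^ (-β) + (z.1 ^ 2 + ε ^ 2) * (z.2 ^ 2 + ε ^ 2) ^ (1 - 3 * β))⁻¹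

lemma den_pos {β ε : ℝ} (hε : 0 < ε) (x y : ℝ) :
    0 < (y ^ 2 + ε ^ 2) ^ (-β) + (x ^ 2 + ε ^ 2) * (y ^ 2 + ε ^ 2) ^ (1 - 3 * β) := by
  positivity

lemma contDiff_B {α β δ ε : ℝ} (hε : 0 < ε) : ContDiff ℝ 2 (B α β δ ε) := by
  have h1 : ∀ z : ℝ × ℝ, z.1 ^ 2 + ε ^ 2 ≠ 0 := fun z => by positivity
  have h2 : ∀ z : ℝ × ℝ, z.2 ^ 2 + ε ^ 2 ≠ 0 := fun z => by positivity
  have c1 : ContDiff ℝ 2 (fun z : ℝ × ℝ => z.1 ^ 2 + ε ^ 2) := by fun_prop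
  have c2 : ContDiff ℝ 2 (fun z : ℝ × ℝ => z.2 ^ 2 + ε ^ 2) := by fun_prop
  unfold B
  refine ((c1.rpow_const_of_ne h1).add (contDiff_const.mul (c2.rpow_const_of_ne h2))).sub
    (contDiff_const.mul (ContDiff.inv ((c2.rpow_const_of_ne h2).add
      (c1.mul (c2.rpow_const_of_ne h2))) ?_))
  intro z
  exact (den_pos hε z.1 z.2).ne'

lemma sub_inv_eq {β ξ η : ℝ} (hξ : 0 < ξ) (hη : 0 < η) :
    η ^ β - (η ^ (-β) + ξ * η ^ (1 - 3 * β))⁻¹ = (η ^ (-β) + η ^ (β - 1) * ξ⁻¹)⁻¹ := by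
  have e1 : η ^ (-β) = (η ^ β)⁻¹ := Real.rpow_neg hη.le _
  have e2 : η ^ (1 - 3 * β) = η / (η ^ β) ^ 3 := by
    rw [Real.rpow_sub hη, Real.rpow_one, mul_comm, Real.rpow_mul hη.le]
    norm_cast
  have e3 : η ^ (β - 1) = η ^ β / η := by rw [Real.rpow_sub hη, Real.rpow_one]
  rw [e1, e2, e3]
  have : 0 < η ^ β := by positivity
  generalize η ^ β = P at *
  field_simp
  ring

lemma psi_nonneg {β ξ η : ℝ} (hξ : 0 < ξ) (hη : 0 < η) :
    0 ≤ η ^ β - (η ^ (-β) + ξ * η ^ (1 - 3 * β))⁻¹ := by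
  rw [sub_inv_eq hξ hη]; positivity

lemma B_le {α β δ ε : ℝ} (hε : 0 < ε) (hδ : 0 < δ) (hδ1 : δ ≤ 1) (z : ℝ × ℝ) :
    B α β δ ε z ≤ 2 * ((z.1 ^ 2 + ε ^ 2) ^ α + (z.2 ^ 2 + ε ^ 2) ^ β) := by
  have h := den_pos (β := β) hε z.1 z.2
  have h1 : 0 < (z.1 ^ 2 + ε ^ 2) ^ α := by positivity
  have h2 : 0 < (z.2 ^ 2 + ε ^ 2) ^ β := by positivity
  have h3 := mul_nonneg hδ.le (inv_nonneg.2 h.le)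
  unfold B
  nlinarith

lemma B_zero_le {α β δ ε : ℝ} (hε : 0 < ε) (hδ : 0 < δ) (hα : 0 ≤ α) (hβ : 0 ≤ β) (hβ1 : β ≤ 1)
    (z : ℝ × ℝ) : B α β δ ε 0 ≤ B α β δ ε z := by
  have hB : ∀ z, B α β δ ε z = (z.1 ^ 2 + ε ^ 2) ^ α + (z.2 ^ 2 + ε ^ 2) ^ β
      + δ * ((z.2 ^ 2 + ε ^ 2) ^ (-β) + (z.2 ^ 2 + ε ^ 2) ^ (β - 1) * (z.1 ^ 2 + ε ^ 2)⁻¹)⁻¹ := by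
    intro z
    rw [← sub_inv_eq (by positivity) (by positivity)]
    unfold B; ring
  rw [hB, hB]
  have he : 0 < ε ^ 2 := by positivity
  have i1 : ε ^ 2 ≤ z.1 ^ 2 + ε ^ 2 := by nlinarith [sq_nonneg z.1]
  have i2 : ε ^ 2 ≤ z.2 ^ 2 + ε ^ 2 := by nlinarith [sq_nonneg z.2]
  simp only [Prod.fst_zero, Prod.snd_zero, ne_eq, OfNat.ofNat_ne_zero, not_false_eq_true,
    zero_pow, zero_add]
  have j1 : (ε ^ 2) ^ α ≤ (z.1 ^ 2 + ε ^ 2) ^ α := Real.rpow_le_rpow he.le i1 hα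
  have j2 : (ε ^ 2) ^ β ≤ (z.2 ^ 2 + ε ^ 2) ^ β := Real.rpow_le_rpow he.le i2 hβ
  have j3 : (z.2 ^ 2 + ε ^ 2) ^ (-β) ≤ (ε ^ 2) ^ (-β) :=
    Real.rpow_le_rpow_of_nonpos he i2 (by linarith)
  have j4 : (z.2 ^ 2 + ε ^ 2) ^ (β - 1) ≤ (ε ^ 2) ^ (β - 1) :=
    Real.rpow_le_rpow_of_nonpos he i2 (by linarith)
  gcongr

/-- Pure algebraic inequality for the second derivative along a line. -/
lemma alg {β τ n n2 e1 a b : ℝ} (hβ : 0 ≤ β) (hβ1 : β ≤ 1) (hτ : 0 ≤ τ)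
    (hn : n ^ 2 ≤ 4 * b ^ 2) (hn2 : n2 = 2 * b ^ 2) (he1 : e1 ^ 2 ≤ 4 * τ * a ^ 2) :
    (2 - 24 * τ) * a ^ 2 / (1 + τ) ^ 2 - 110 * b ^ 2 ≤
      (-β * n2 + β * (β + 1) * n ^ 2 + 2 * a ^ 2 + 2 * (1 - 3 * β) * e1 * n
        + τ * ((1 - 3 * β) * n2 + (1 - 3 * β) * (-3 * β) * n ^ 2)) / (1 + τ) ^ 2
      - 2 * (-β * n + e1 + (1 - 3 * β) * τ * n) ^ 2 / (1 + τ) ^ 3 := by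
  have h1 : 0 < 1 + τ := by linarith
  set m := n * (-β + (1 - 3 * β) * τ) with hm
  have hm2 : m ^ 2 ≤ 16 * b ^ 2 * (1 + τ) ^ 2 := by
    have : (-β + (1 - 3 * β) * τ) ^ 2 ≤ (2 * (1 + τ)) ^ 2 := by
      apply sq_le_sq'
      · nlinarith
      · nlinarith
    calc m ^ 2 = n ^ 2 * (-β + (1 - 3 * β) * τ) ^ 2 := by rw [hm]; ring
      _ ≤ (4 * b ^ 2) * (2 * (1 + τ)) ^ 2 := by gcongr
      _ = _ := by ring
  have hs : (-β * n + e1 + (1 - 3 * β) * τ * n) ^ 2 ≤ 2 * (4 * τ * a ^ 2) + 2 * (16 * b ^ 2 * (1 + τ) ^ 2) := by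
    have : -β * n + e1 + (1 - 3 * β) * τ * n = e1 + m := by rw [hm]; ring
    rw [this]
    nlinarith [sq_nonneg (e1 - m)]
  have hc : -(8 * τ * a ^ 2 + 8 * b ^ 2) ≤ 2 * (1 - 3 * β) * e1 * n := by
    have hk : (1 - 3 * β) ^ 2 ≤ 4 := by nlinarith
    have : (2 * (1 - 3 * β) * e1 * n) = e1 * (2 * (1 - 3 * β) * n) := by ring
    have q2 : (2 * (1 - 3 * β) * n) ^ 2 ≤ 64 * b ^ 2 := by
      calc (2 * (1 - 3 * β) * n) ^ 2 = 4 * (1 - 3 * β) ^ 2 * n ^ 2 := by ring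
        _ ≤ 4 * 4 * (4 * b ^ 2) := by gcongr
        _ = _ := by ring
    nlinarith [sq_nonneg (2 * e1 + (1/2) * (2 * (1 - 3 * β) * n)), sq_nonneg b, mul_nonneg hτ (sq_nonneg a)]
  have hd : -(2 * b ^ 2) ≤ -β * n2 + β * (β + 1) * n ^ 2 := by
    rw [hn2]
    nlinarith [mul_nonneg (mul_nonneg hβ (by linarith : 0 ≤ β + 1)) (sq_nonneg n),
      mul_nonneg (sub_nonneg.2 hβ1) (sq_nonneg b)]
  have hf : -(28 * b ^ 2) ≤ (1 - 3 * β) * n2 + (1 - 3 * β) * (-3 * β) * n ^ 2 := by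
    rw [hn2]
    have u1 : -4 * b ^ 2 ≤ (1 - 3 * β) * (2 * b ^ 2) := by nlinarith [sq_nonneg b]
    have u2 : -6 ≤ (1 - 3 * β) * (-3 * β) := by nlinarith
    have u3 : -6 * n ^ 2 ≤ (1 - 3 * β) * (-3 * β) * n ^ 2 := by nlinarith [sq_nonneg n]
    nlinarith
  have hb := sq_nonneg b
  have ha := sq_nonneg a
  have s1 : (2 * a ^ 2 - 8 * τ * a ^ 2 - 10 * b ^ 2 - τ * (28 * b ^ 2)) / (1 + τ) ^ 2 ≤
      (-β * n2 + β * (β + 1) * n ^ 2 + 2 * a ^ 2 + 2 * (1 - 3 * β) * e1 * n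
        + τ * ((1 - 3 * β) * n2 + (1 - 3 * β) * (-3 * β) * n ^ 2)) / (1 + τ) ^ 2 := by
    gcongr
    nlinarith [mul_le_mul_of_nonneg_left hf hτ]
  have s2 : 2 * (-β * n + e1 + (1 - 3 * β) * τ * n) ^ 2 / (1 + τ) ^ 3 ≤
      2 * (2 * (4 * τ * a ^ 2) + 2 * (16 * b ^ 2 * (1 + τ) ^ 2)) / (1 + τ) ^ 3 := by gcongr
  have s3 : (2 - 24 * τ) * a ^ 2 / (1 + τ) ^ 2 - 110 * b ^ 2 ≤
     (2 * a ^ 2 - 8 * τ * a ^ 2 - 10 * b ^ 2 - τ * (28 * b ^ 2)) / (1 + τ) ^ 2 -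
      2 * (2 * (4 * τ * a ^ 2) + 2 * (16 * b ^ 2 * (1 + τ) ^ 2)) / (1 + τ) ^ 3 := by
    have : (2 * a ^ 2 - 8 * τ * a ^ 2 - 10 * b ^ 2 - τ * (28 * b ^ 2)) / (1 + τ) ^ 2 -
      2 * (2 * (4 * τ * a ^ 2) + 2 * (16 * b ^ 2 * (1 + τ) ^ 2)) / (1 + τ) ^ 3
      - ((2 - 24 * τ) * a ^ 2 / (1 + τ) ^ 2 - 110 * b ^ 2) =
      (16 * τ ^ 2 * a ^ 2 + b ^ 2 * (110 * (1 + τ) ^ 3 - (10 + 28 * τ) * (1 + τ) - 64 * (1 + τ) ^ 2)) / (1 + τ) ^ 3 := by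
      field_simp
      ring
    have h2 : 0 ≤ (16 * τ ^ 2 * a ^ 2 + b ^ 2 * (110 * (1 + τ) ^ 3 - (10 + 28 * τ) * (1 + τ) - 64 * (1 + τ) ^ 2)) / (1 + τ) ^ 3 := by
      have : 0 ≤ (110 * (1 + τ) ^ 3 - (10 + 28 * τ) * (1 + τ) - 64 * (1 + τ) ^ 2) := by
        nlinarith [pow_nonneg hτ 2, pow_nonneg hτ 3]
      positivity
    linarith
  linarith


lemma hasDerivAt_q (x a ε t : ℝ) :
    HasDerivAt (fun t : ℝ => (x + t * a) ^ 2 + ε ^ 2) (2 * (x + t * a) * a) t := by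
  have h : HasDerivAt (fun t : ℝ => x + t * a) a t := by
    simpa using ((hasDerivAt_id t).mul_const a).const_add x
  simpa using (h.pow 2).add_const (ε ^ 2)

lemma hasDerivAt_l (x a t : ℝ) :
    HasDerivAt (fun t : ℝ => 2 * (x + t * a) * a) (2 * a ^ 2) t := by
  have h : HasDerivAt (fun t : ℝ => x + t * a) a t := by
    simpa using ((hasDerivAt_id t).mul_const a).const_add x
  have := (h.const_mul 2).mul_const a
  rwa [show 2 * a * a = 2 * a ^ 2 by ring] at this

lemma hasDerivAt_rp {ε : ℝ} (hε : 0 < ε) (x a r t : ℝ) :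
    HasDerivAt (fun t : ℝ => ((x + t * a) ^ 2 + ε ^ 2) ^ r)
      (2 * (x + t * a) * a * r * ((x + t * a) ^ 2 + ε ^ 2) ^ (r - 1)) t :=
  (hasDerivAt_q x a ε t).rpow_const (Or.inl (by positivity))

lemma k4_aux {α δ τ : ℝ} (hα : 1 ≤ α) (hδ : 0 < δ) (hτ0 : 0 < τ)
    (hd2 : 25 * δ ≤ 2 * (1 / 24) ^ (α - 1)) :
    δ / 2 ≤ 2 * τ ^ (α - 1) + δ * ((2 - 24 * τ) / (1 + τ) ^ 2) := by
  rcases le_or_gt τ (1 / 24) with h | h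
  · have : 1 / 2 ≤ (2 - 24 * τ) / (1 + τ) ^ 2 := by
      rw [le_div_iff₀ (by positivity)]; nlinarith
    have : 0 ≤ τ ^ (α - 1) := by positivity
    nlinarith
  · have i1 : (1 / 24 : ℝ) ^ (α - 1) ≤ τ ^ (α - 1) :=
      Real.rpow_le_rpow (by norm_num) h.le (by linarith)
    have i2 : -24 ≤ (2 - 24 * τ) / (1 + τ) ^ 2 := by
      rw [le_div_iff₀ (by positivity)]; nlinarith
    nlinarith

lemma k5_aux {a b δ η P : ℝ} (hδ : 0 < δ) (hη0 : 0 < η) (hP0 : 0 < P) :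
    δ * |a| * |b| ≤ δ / 2 * (a ^ 2 * (η / P) + b ^ 2 * (P / η)) := by
  have := sq_nonneg (|a| * Real.sqrt (η / P) - |b| * Real.sqrt (P / η))
  have s1 : Real.sqrt (η / P) * Real.sqrt (P / η) = 1 := by
    rw [← Real.sqrt_mul (by positivity)]
    have : η / P * (P / η) = 1 := by field_simp
    rw [this, Real.sqrt_one]
  have s2 : (|a| * Real.sqrt (η / P) - |b| * Real.sqrt (P / η)) ^ 2 = a ^ 2 * (η / P) + b ^ 2 * (P / η) - 2 * |a| * |b| := by
    rw [sub_sq, mul_pow, mul_pow, Real.sq_sqrt (by positivity), Real.sq_sqrt (by positivity), sq_abs, sq_abs]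
    linear_combination (-2 * |a| * |b|) * s1
  nlinarith

lemma k6_aux {a2 b2 X Y β δ K L M T S : ℝ} (q1 : 0 ≤ a2 * X) (q2 : 0 ≤ b2 * Y) (hδ : 0 < δ)
    (hβ : 1 / 2 < β) (hd1 : 110 * δ ≤ β * (2 * β - 1))
    (k1 : 2 * a2 * T * X ≤ K) (k2 : 2 * β * (2 * β - 1) * Y * b2 ≤ L)
    (k3 : S * a2 * X - 110 * b2 * Y ≤ M) (k4 : δ / 2 ≤ 2 * T + δ * S) :
    δ / 2 * (a2 * X + b2 * Y) ≤ K + (1 + δ) * L + δ * M := by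
  have q3 := mul_le_mul_of_nonneg_left k3 hδ.le
  have q4 := mul_le_mul_of_nonneg_right k4 q1
  have q5 := mul_le_mul_of_nonneg_left k2 (by linarith : (0:ℝ) ≤ 1 + δ)
  have q6 := mul_le_mul_of_nonneg_right hd1 q2
  have q7 : 0 ≤ β * (2 * β - 1) * (b2 * Y) := by
    have : 0 < 2 * β - 1 := by linarith
    positivity
  have q8 := mul_nonneg hδ.le q7
  have q9 := mul_nonneg hδ.le q2
  nlinarith

set_option maxHeartbeats 1000000 in
/-- Second derivative in algebraic form. -/
lemma second_alg {α β δ ε : ℝ} (hα : 1 ≤ α) (hβ : 1 / 2 < β) (hβ1 : β ≤ 1)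
    (hab : (2 * β - 1) * (α - 1) = 1 - β) (hδ : 0 < δ) (hδ1 : δ ≤ 1)
    (hd1 : 110 * δ ≤ β * (2 * β - 1)) (hd2 : 25 * δ ≤ 2 * (1 / 24) ^ (α - 1))
    (hε : 0 < ε) (x y a b : ℝ) {ξ η : ℝ} (hξ : ξ = x ^ 2 + ε ^ 2) (hη : η = y ^ 2 + ε ^ 2) :
    δ * |a| * |b| ≤
      (2 * a ^ 2 * α * ξ ^ (α - 1) + 2 * x * a * α * (2 * x * a * (α - 1) * ξ ^ (α - 1 - 1)))
      + (1 + δ) * (2 * b ^ 2 * β * η ^ (β - 1)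
          + 2 * y * b * β * (2 * y * b * (β - 1) * η ^ (β - 1 - 1)))
      + δ * ((2 * b ^ 2 * (-β) * η ^ (-β - 1)
              + 2 * y * b * (-β) * (2 * y * b * (-β - 1) * η ^ (-β - 1 - 1))
            + (2 * a ^ 2 * η ^ (1 - 3 * β)
              + 2 * x * a * (2 * y * b * (1 - 3 * β) * η ^ (1 - 3 * β - 1))
              + (2 * x * a * (2 * y * b * (1 - 3 * β) * η ^ (1 - 3 * β - 1))
              + ξ * (2 * b ^ 2 * (1 - 3 * β) * η ^ (1 - 3 * β - 1)
                + 2 * y * b * (1 - 3 * β) * (2 * y * b * (1 - 3 * β - 1) * η ^ (1 - 3 * β - 1 - 1))))))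
              / (η ^ (-β) + ξ * η ^ (1 - 3 * β)) ^ 2
            - 2 * (2 * y * b * (-β) * η ^ (-β - 1) + (2 * x * a * η ^ (1 - 3 * β)
              + ξ * (2 * y * b * (1 - 3 * β) * η ^ (1 - 3 * β - 1)))) ^ 2
              / (η ^ (-β) + ξ * η ^ (1 - 3 * β)) ^ 3) := by
  have hη0 : 0 < η := by rw [hη]; positivity
  have hξ0 : 0 < ξ := by rw [hξ]; positivity
  have hxξ : x ^ 2 ≤ ξ := by rw [hξ]; nlinarith [sq_nonneg ε]
  have hyη : y ^ 2 ≤ η := by rw [hη]; nlinarith [sq_nonneg ε]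
  clear hξ hη
  obtain ⟨P, hP⟩ : ∃ P, P = η ^ β := ⟨_, rfl⟩
  have hP0 : 0 < P := by rw [hP]; positivity
  set τ := ξ * η / P ^ 2 with hτ
  have hτ0 : 0 < τ := by positivity
  have hX : (ξ ^ (α - 1)) = τ ^ (α - 1) * (η / P) := by
    have e : ξ = τ * (P ^ 2 / η) := by rw [hτ]; field_simp
    have e2 : P ^ 2 / η = η ^ (2 * β - 1) := by
      rw [Real.rpow_sub hη0, Real.rpow_one, mul_comm, Real.rpow_mul hη0.le, ← hP]; norm_cast
    conv_lhs => rw [e]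
    rw [Real.mul_rpow hτ0.le (by positivity), e2, ← Real.rpow_mul hη0.le, hab, Real.rpow_sub hη0,
      Real.rpow_one, ← hP]
  have e1 : η ^ (-β) = P⁻¹ := by rw [hP]; exact Real.rpow_neg hη0.le _
  have e2 : η ^ (1 - 3 * β) = η / P ^ 3 := by
    rw [Real.rpow_sub hη0, Real.rpow_one, mul_comm, Real.rpow_mul hη0.le, hP]
    norm_cast
  have e3 : η ^ (β - 1) = P / η := by rw [Real.rpow_sub hη0, Real.rpow_one, hP]
  have e4 : η ^ (β - 1 - 1) = P / η / η := by rw [Real.rpow_sub hη0, Real.rpow_one, e3]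
  have e5 : η ^ (-β - 1) = P⁻¹ / η := by rw [Real.rpow_sub hη0, Real.rpow_one, e1]
  have e6 : η ^ (-β - 1 - 1) = P⁻¹ / η / η := by rw [Real.rpow_sub hη0, Real.rpow_one, e5]
  have e7 : η ^ (1 - 3 * β - 1) = η / P ^ 3 / η := by rw [Real.rpow_sub hη0, Real.rpow_one, e2]
  have e8 : η ^ (1 - 3 * β - 1 - 1) = η / P ^ 3 / η / η := by
    rw [Real.rpow_sub hη0, Real.rpow_one, e7]
  have hal := alg (β := β) (τ := τ) (n := 2 * y * b / η) (n2 := 2 * b ^ 2 / η)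
    (e1 := 2 * x * a * η / P ^ 2) (a := a * (Real.sqrt η / P)) (b := b / Real.sqrt η)
    (by linarith) hβ1 hτ0.le
    (by
      rw [div_pow, div_pow, Real.sq_sqrt hη0.le, ← mul_div_assoc, div_le_div_iff₀ (by positivity) hη0]
      have : y ^ 2 * (4 * b ^ 2 * η) ≤ η * (4 * b ^ 2 * η) := by gcongr
      nlinarith)
    (by rw [div_pow, Real.sq_sqrt hη0.le]; ring)
    (by
      rw [mul_pow a, div_pow (Real.sqrt η), Real.sq_sqrt hη0.le, hτ]
      have : 4 * (ξ * η / P ^ 2) * (a ^ 2 * (η / P ^ 2)) = ξ * (2 * a * η / P ^ 2) ^ 2 := by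
        field_simp; ring
      rw [this]
      have : (2 * x * a * η / P ^ 2) ^ 2 = x ^ 2 * (2 * a * η / P ^ 2) ^ 2 := by ring
      rw [this]; gcongr)
  set R := (-β * (2 * b ^ 2 / η) + β * (β + 1) * (2 * y * b / η) ^ 2 + 2 * (a * (Real.sqrt η / P)) ^ 2
     + 2 * (1 - 3 * β) * (2 * x * a * η / P ^ 2) * (2 * y * b / η)
        + τ * ((1 - 3 * β) * (2 * b ^ 2 / η) + (1 - 3 * β) * (-3 * β) * (2 * y * b / η) ^ 2)) / (1 + τ) ^ 2
      - 2 * (-β * (2 * y * b / η) + (2 * x * a * η / P ^ 2) + (1 - 3 * β) * τ * (2 * y * b / η)) ^ 2 / (1 + τ) ^ 3 with hR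
  have hD : P⁻¹ + ξ * (η / P ^ 3) = (1 + τ) / P := by rw [hτ]; field_simp
  have h1τ : 0 < 1 + τ := by linarith
  have key : ((2 * b ^ 2 * (-β) * η ^ (-β - 1)
              + 2 * y * b * (-β) * (2 * y * b * (-β - 1) * η ^ (-β - 1 - 1))
            + (2 * a ^ 2 * η ^ (1 - 3 * β)
              + 2 * x * a * (2 * y * b * (1 - 3 * β) * η ^ (1 - 3 * β - 1))
              + (2 * x * a * (2 * y * b * (1 - 3 * β) * η ^ (1 - 3 * β - 1))
              + ξ * (2 * b ^ 2 * (1 - 3 * β) * η ^ (1 - 3 * β - 1)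
                + 2 * y * b * (1 - 3 * β) * (2 * y * b * (1 - 3 * β - 1) * η ^ (1 - 3 * β - 1 - 1))))))
              / (η ^ (-β) + ξ * η ^ (1 - 3 * β)) ^ 2
            - 2 * (2 * y * b * (-β) * η ^ (-β - 1) + (2 * x * a * η ^ (1 - 3 * β)
              + ξ * (2 * y * b * (1 - 3 * β) * η ^ (1 - 3 * β - 1)))) ^ 2
              / (η ^ (-β) + ξ * η ^ (1 - 3 * β)) ^ 3) = P * R := by
    rw [e1, e2, e5, e6, e7, e8, hD, hR, mul_pow, div_pow (Real.sqrt η), Real.sq_sqrt hη0.le]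
    have eτ : ξ = τ * P ^ 2 / η := by rw [hτ]; field_simp
    rw [eτ]
    clear_value τ
    field_simp
    ring
  rw [key, e3, e4]
  have k1 : 2 * a ^ 2 * τ ^ (α - 1) * (η / P) ≤ (2 * a ^ 2 * α * ξ ^ (α - 1) + 2 * x * a * α * (2 * x * a * (α - 1) * ξ ^ (α - 1 - 1))) := by
    rw [hX]
    have p1 : 0 ≤ 2 * x * a * α * (2 * x * a * (α - 1) * ξ ^ (α - 1 - 1)) := by
      have : 2 * x * a * α * (2 * x * a * (α - 1) * ξ ^ (α - 1 - 1)) = (2 * x * a) ^ 2 * (α * (α - 1) * ξ ^ (α - 1 - 1)) := by ring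
      rw [this]
      have : 0 ≤ α - 1 := by linarith
      positivity
    have p2 : 0 ≤ 2 * a ^ 2 * τ ^ (α - 1) * (η / P) := by positivity
    have p3 := mul_le_mul_of_nonneg_right hα p2
    have p4 : 2 * a ^ 2 * α * (τ ^ (α - 1) * (η / P)) = α * (2 * a ^ 2 * τ ^ (α - 1) * (η / P)) := by ring
    rw [p4]
    linarith
  have k2 : 2 * β * (2 * β - 1) * (P / η) * b ^ 2 ≤ (2 * b ^ 2 * β * (P / η)
          + 2 * y * b * β * (2 * y * b * (β - 1) * (P / η / η))) := by
    have : 2 * y * b * β * (2 * y * b * (β - 1) * (P / η / η)) = - (y ^ 2 * (4 * β * (1 - β) * b ^ 2 * (P / η / η))) := by ring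
    rw [this]
    have p1 : y ^ 2 * (4 * β * (1 - β) * b ^ 2 * (P / η / η)) ≤ η * (4 * β * (1 - β) * b ^ 2 * (P / η / η)) := by
      have : 0 ≤ 1 - β := by linarith
      have : 0 ≤ β := by linarith
      gcongr
    have p2 : η * (4 * β * (1 - β) * b ^ 2 * (P / η / η)) = 4 * β * (1 - β) * b ^ 2 * (P / η) := by field_simp
    linarith
  have k3 : (2 - 24 * τ) / (1 + τ) ^ 2 * a ^ 2 * (η / P) - 110 * b ^ 2 * (P / η) ≤ P * R := by
    calc _ = P * ((2 - 24 * τ) * (a * (Real.sqrt η / P)) ^ 2 / (1 + τ) ^ 2 - 110 * (b / Real.sqrt η) ^ 2) := by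
          rw [mul_pow, div_pow, div_pow, Real.sq_sqrt hη0.le]
          field_simp
      _ ≤ _ := by gcongr
  have k4 := k4_aux hα hδ hτ0 hd2
  refine (k5_aux hδ hη0 hP0).trans ?_
  exact k6_aux (by positivity) (by positivity) hδ hβ hd1 k1 k2 k3 k4

/-- second derivative along lines from the Fréchet derivative -/
lemma second_of_line {f : ℝ × ℝ → ℝ} (hf : ContDiff ℝ 2 f) (z h : ℝ × ℝ) {f1 : ℝ → ℝ} {f2 : ℝ}
    (h1 : ∀ t, HasDerivAt (fun t : ℝ => f (z + t • h)) (f1 t) t) (h2 : HasDerivAt f1 f2 0) :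
    fderiv ℝ (fderiv ℝ f) z h h = f2 := by
  have hl : ∀ t : ℝ, HasDerivAt (fun t : ℝ => z + t • h) h t := fun t => by
    simpa using ((hasDerivAt_id t).smul_const h).const_add z
  have e : f1 = fun t => fderiv ℝ f (z + t • h) h := by
    funext t
    refine (h1 t).unique ?_
    exact ((hf.differentiable (by norm_num) _).hasFDerivAt).comp_hasDerivAt t (hl t)
  have hd : ContDiff ℝ 1 (fderiv ℝ f) := hf.fderiv_right (by norm_num)
  have : HasDerivAt f1 (fderiv ℝ (fderiv ℝ f) (z + (0:ℝ) • h) h h) 0 := by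
    rw [e]
    have := ((hd.differentiable (by norm_num) (z + (0:ℝ) • h)).hasFDerivAt).comp_hasDerivAt (0:ℝ) (hl 0)
    exact ((ContinuousLinearMap.apply ℝ ℝ h).hasFDerivAt.comp_hasDerivAt (0:ℝ) this)
  have := this.unique h2
  simpa using this

lemma hess_B {α β δ ε : ℝ} (hα : 1 ≤ α) (hβ : 1 / 2 < β) (hβ1 : β ≤ 1)
    (hab : (2 * β - 1) * (α - 1) = 1 - β) (hδ : 0 < δ) (hδ1 : δ ≤ 1)
    (hd1 : 110 * δ ≤ β * (2 * β - 1)) (hd2 : 25 * δ ≤ 2 * (1 / 24) ^ (α - 1))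
    (hε : 0 < ε) (z h : ℝ × ℝ) :
    δ * |h.1| * |h.2| ≤ fderiv ℝ (fderiv ℝ (B α β δ ε)) z h h := by
  obtain ⟨x, y⟩ := z
  obtain ⟨a, b⟩ := h
  have hr := second_alg hα hβ hβ1 hab hδ hδ1 hd1 hd2 hε x y a b rfl rfl
  refine hr.trans (le_of_eq ?_)
  symm
  have D1 : ∀ t : ℝ, HasDerivAt (fun t : ℝ => ((y + t * b) ^ 2 + ε ^ 2) ^ (-β) +
      ((x + t * a) ^ 2 + ε ^ 2) * ((y + t * b) ^ 2 + ε ^ 2) ^ (1 - 3 * β)) _ t := fun t =>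
    (hasDerivAt_rp hε y b (-β) t).add ((hasDerivAt_q x a ε t).mul (hasDerivAt_rp hε y b (1 - 3 * β) t))
  have R2 : ∀ (y b r : ℝ) (t : ℝ), HasDerivAt
     (fun t : ℝ => 2 * (y + t * b) * b * r * ((y + t * b) ^ 2 + ε ^ 2) ^ (r - 1)) _ t := fun y b r t =>
    ((hasDerivAt_l y b t).mul_const r).mul (hasDerivAt_rp hε y b (r - 1) t)
  have D2 := (R2 y b (-β) 0).add (((hasDerivAt_l x a 0).mul (hasDerivAt_rp hε y b (1 - 3 * β) 0)).add
    ((hasDerivAt_q x a ε 0).mul (R2 y b (1 - 3 * β) 0)))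
  have F1 : ∀ t : ℝ, HasDerivAt (fun t : ℝ => B α β δ ε ((x, y) + t • (a, b))) _ t := fun t =>
    ((hasDerivAt_rp hε x a α t).add ((hasDerivAt_rp hε y b β t).const_mul (1 + δ))).sub
      (((D1 t).inv (den_pos hε _ _).ne').const_mul δ)
  have F2 := ((R2 x a α 0).add ((R2 y b β 0).const_mul (1 + δ))).sub
      (((D2.neg.div ((D1 0).pow 2) (pow_ne_zero 2 (den_pos hε _ _).ne'))).const_mul δ)
  refine (second_of_line (contDiff_B hε) (x, y) (a, b) F1 F2).trans ?_
  have hD := den_pos (β := β) hε x y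
  simp only [zero_mul, add_zero, Pi.add_apply, Pi.mul_apply, Pi.neg_apply, Pi.pow_apply]
  generalize (y ^ 2 + ε ^ 2) ^ (-β) + (x ^ 2 + ε ^ 2) * (y ^ 2 + ε ^ 2) ^ (1 - 3 * β) = D at hD ⊢
  field_simp
  ring

theorem bellman_aux (p q : ℝ) (hp : 2 ≤ p) (hpq : p.HolderConjugate q) :
    ∃ c > 0, ∀ ε > 0, ∃ B : ℝ × ℝ → ℝ, ContDiff ℝ 2 B ∧
      (∀ z h, c * |h.1| * |h.2| ≤ fderiv ℝ (fderiv ℝ B) z h h) ∧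
      (∀ z, B 0 ≤ B z) ∧ (0 ≤ B 0) ∧
      (∀ z, B z ≤ 2 * ((z.1 ^ 2 + ε ^ 2) ^ (p / 2) + (z.2 ^ 2 + ε ^ 2) ^ (q / 2))) := by
  have hq : q = p / (p - 1) := hpq.conjugate_eq
  have hp1 : 0 < p - 1 := by linarith
  have hq1 : 1 < q := hpq.symm.lt
  have hq2 : q ≤ 2 := by rw [hq, div_le_iff₀ hp1]; linarith
  set α := p / 2
  set β := q / 2
  have hβ0 : 0 < β * (2 * β - 1) := by
    have : 1 / 2 < β := by simp only [β]; linarith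
    have : 0 < 2 * β - 1 := by linarith
    positivity
  have hα0 : 0 < 2 * (1 / 24 : ℝ) ^ (α - 1) := by positivity
  refine ⟨min 1 (min (β * (2 * β - 1) / 110) (2 * (1 / 24) ^ (α - 1) / 25)), by positivity, ?_⟩
  set δ := min 1 (min (β * (2 * β - 1) / 110) (2 * (1 / 24) ^ (α - 1) / 25)) with hδ
  have d0 : 0 < δ := by positivity
  have d1 : δ ≤ 1 := min_le_left _ _
  have d2 : δ ≤ β * (2 * β - 1) / 110 := (min_le_right _ _).trans (min_le_left _ _)
  have d3 : δ ≤ 2 * (1 / 24) ^ (α - 1) / 25 := (min_le_right _ _).trans (min_le_right _ _)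
  intro ε hε
  refine ⟨B α β δ ε, contDiff_B hε, fun z h => hess_B ?_ ?_ ?_ ?_ d0 d1 (by linarith) (by linarith)
    hε z h, B_zero_le hε d0 ?_ ?_ ?_, ?_, B_le hε d0 d1⟩
  · simp only [α]; linarith
  · simp only [β]; linarith
  · simp only [β]; linarith
  · simp only [α, β]; rw [hq]; field_simp; ring
  · simp only [α]; linarith
  · simp only [β]; linarith
  · simp only [β]; linarith
  · have h := psi_nonneg (β := β) (ξ := ε ^ 2) (η := ε ^ 2) (by positivity) (by positivity)
    have h2 := mul_nonneg d0.le h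
    have h3 : 0 < (ε ^ 2) ^ α := by positivity
    have h4 : 0 < (ε ^ 2) ^ β := by positivity
    simp only [B, Prod.fst_zero, Prod.snd_zero, ne_eq, OfNat.ofNat_ne_zero, not_false_eq_true,
      zero_pow, zero_add]
    nlinarith

theorem bellman (p q : ℝ) (hpq : p.HolderConjugate q) :
    ∃ c > 0, ∀ ε > 0, ∃ B : ℝ × ℝ → ℝ, ContDiff ℝ 2 B ∧
      (∀ z h, c * |h.1| * |h.2| ≤ fderiv ℝ (fderiv ℝ B) z h h) ∧
      (∀ z, B 0 ≤ B z) ∧ (0 ≤ B 0) ∧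
      (∀ z, B z ≤ 2 * ((z.1 ^ 2 + ε ^ 2) ^ (p / 2) + (z.2 ^ 2 + ε ^ 2) ^ (q / 2))) := by
  rcases le_total 2 p with h | h
  · exact bellman_aux p q h hpq
  · have hp1 : 1 < p := hpq.lt
    have hq : q = p / (p - 1) := hpq.conjugate_eq
    have : 2 ≤ q := by rw [hq, le_div_iff₀ (by linarith)]; linarith
    obtain ⟨c, hc, H⟩ := bellman_aux q p this hpq.symm
    refine ⟨c, hc, fun ε hε => ?_⟩
    obtain ⟨B, h1, h2, h3, h4, h5⟩ := H ε hε
    let L : ℝ × ℝ →L[ℝ] ℝ × ℝ := (ContinuousLinearMap.snd ℝ ℝ ℝ).prod (ContinuousLinearMap.fst ℝ ℝ ℝ)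
    have hc : ContDiff ℝ 2 (fun z => B (L z)) := h1.comp L.contDiff
    refine ⟨fun z => B (L z), hc, fun z h => ?_, fun z => ?_, ?_, fun z => ?_⟩
    · have hl : ∀ t : ℝ, HasDerivAt (fun t : ℝ => L z + t • L h) (L h) t := fun t => by
        simpa using ((hasDerivAt_id t).smul_const (L h)).const_add (L z)
      have hd : ContDiff ℝ 1 (fderiv ℝ B) := h1.fderiv_right (by norm_num)
      have e : fderiv ℝ (fderiv ℝ (fun z => B (L z))) z h h
          = fderiv ℝ (fderiv ℝ B) (L z) (L h) (L h) := by
        refine second_of_line hc z h (f1 := fun t => fderiv ℝ B (L z + t • L h) (L h)) (fun t => ?_) ?_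
        · simp only [map_add, map_smul]
          exact ((h1.differentiable (by norm_num) _).hasFDerivAt).comp_hasDerivAt t (hl t)
        · have := ((hd.differentiable (by norm_num) (L z + (0:ℝ) • L h)).hasFDerivAt).comp_hasDerivAt (0:ℝ) (hl 0)
          have h0 := ((ContinuousLinearMap.apply ℝ ℝ (L h)).hasFDerivAt.comp_hasDerivAt (0:ℝ) this)
          rw [zero_smul, add_zero] at h0
          exact h0
      rw [e]
      refine le_trans (le_of_eq ?_) (h2 (L z) (L h))
      simp only [L, ContinuousLinearMap.prod_apply, ContinuousLinearMap.coe_fst', ContinuousLinearMap.coe_snd']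
      ring
    · simpa using h3 (L z)
    · simpa using h4
    · refine (h5 (L z)).trans (le_of_eq ?_)
      simp only [L, ContinuousLinearMap.prod_apply, ContinuousLinearMap.coe_fst', ContinuousLinearMap.coe_snd']
      ring

end Bell

namespace Heat
variable {d : ℕ}

/-- smooth compactly supported -/
def Tst (h : Euc d → ℝ) : Prop := ContDiff ℝ (⊤ : ℕ∞) h ∧ HasCompactSupport h

noncomputable abbrev ee (i : Fin d) : Euc d := EuclideanSpace.single i 1

lemma norm_ee (i : Fin d) : ‖ee i‖ = 1 := by simp [ee]

lemma Tst.cont {h : Euc d → ℝ} (H : Tst h) : Continuous h := H.1.continuous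
lemma Tst.diff {h : Euc d → ℝ} (H : Tst h) : Differentiable ℝ h := H.1.differentiable (by simp)
lemma Tst.integrable {h : Euc d → ℝ} (H : Tst h) : Integrable h :=
  H.cont.integrable_of_hasCompactSupport H.2

lemma Tst.pd {h : Euc d → ℝ} (H : Tst h) (i : Fin d) : Tst (pd i h) := by
  refine ⟨?_, ?_⟩
  · exact (H.1.fderiv_right (m := (⊤ : ℕ∞)) (by simp)).clm_apply contDiff_const
  · exact (H.2.fderiv (𝕜 := ℝ)).comp_left (g := fun L : Euc d →L[ℝ] ℝ => L (ee i)) (by simp)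

lemma Tst.add {h g : Euc d → ℝ} (H : Tst h) (H' : Tst g) : Tst (fun x => h x + g x) :=
  ⟨H.1.add H'.1, H.2.add H'.2⟩

lemma Tst.zero : Tst (fun _ : Euc d => (0:ℝ)) := ⟨contDiff_const, HasCompactSupport.zero⟩

lemma Tst.sum {ι : Type*} (s : Finset ι) {h : ι → Euc d → ℝ} (H : ∀ i, Tst (h i)) :
    Tst (fun x => ∑ i ∈ s, h i x) := by
  classical
  induction s using Finset.induction_on with
  | empty => simpa using Tst.zero
  | insert a s ha ih => simp only [Finset.sum_insert ha]; exact (H a).add ih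

lemma Tst.lap {h : Euc d → ℝ} (H : Tst h) : Tst (lap h) := Tst.sum _ fun i => (H.pd i).pd i

lemma Tst.bdd {h : Euc d → ℝ} (H : Tst h) : ∃ C, 0 ≤ C ∧ ∀ x, |h x| ≤ C := by
  obtain ⟨C, hC⟩ := H.cont.bounded_above_of_compact_support H.2
  exact ⟨C, (norm_nonneg _).trans (hC 0), hC⟩

lemma Tst.fbdd {h : Euc d → ℝ} (H : Tst h) : ∃ C, 0 ≤ C ∧ ∀ x, ‖fderiv ℝ h x‖ ≤ C := by
  obtain ⟨C, hC⟩ := (H.1.continuous_fderiv (by simp)).bounded_above_of_compact_support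
    (H.2.fderiv (𝕜 := ℝ))
  exact ⟨C, (norm_nonneg _).trans (hC 0), hC⟩

lemma fderiv_apply_eq_sum (L : Euc d →L[ℝ] ℝ) (z : Euc d) : L z = ∑ i, z i * L (ee i) := by
  conv_lhs => rw [← (EuclideanSpace.basisFun (Fin d) ℝ).sum_repr z]
  simp [ee]

lemma pd_comm {h : Euc d → ℝ} (H : ContDiff ℝ 2 h) (i j : Fin d) :
    _root_.pd i (_root_.pd j h) = _root_.pd j (_root_.pd i h) := by
  funext x
  have hs : IsSymmSndFDerivAt ℝ h x := H.contDiffAt.isSymmSndFDerivAt (by simp)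
  have hd : DifferentiableAt ℝ (fderiv ℝ h) x :=
    (H.fderiv_right (m := 1) (by norm_num)).differentiable (by norm_num) x
  have e : ∀ i j : Fin d, _root_.pd i (_root_.pd j h) x = fderiv ℝ (fderiv ℝ h) x (ee i) (ee j) := by
    intro i j
    have := (hd.hasFDerivAt.clm_apply (hasFDerivAt_const (ee j) x)).fderiv
    unfold _root_.pd
    rw [this]; simp
  rw [e, e]; exact hs _ _

/-- unnormalised Gaussian -/
noncomputable def G0 (z : Euc d) : ℝ := Real.exp (-‖z‖ ^ 2 / 4)

lemma G0_le (M : ℕ) (z : Euc d) :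
    G0 z ≤ (Real.exp 2 * M.factorial) * ((1 + ‖z‖) ^ M)⁻¹ := by
  have h1 : (1 + ‖z‖) ^ M / M.factorial ≤ Real.exp (1 + ‖z‖) :=
    Real.pow_div_factorial_le_exp _ (by positivity) M
  have h2 : Real.exp (1 + ‖z‖) * G0 z ≤ Real.exp 2 := by
    rw [G0, ← Real.exp_add]
    apply Real.exp_le_exp.2
    nlinarith [sq_nonneg (‖z‖ - 2)]
  have h3 : 0 < (1 + ‖z‖) ^ M := by positivity
  have h4 : (0:ℝ) < M.factorial := by positivity
  have h5 : 0 < G0 z := Real.exp_pos _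
  rw [← div_eq_mul_inv, le_div_iff₀ h3]
  rw [div_le_iff₀ h4] at h1
  calc G0 z * (1 + ‖z‖) ^ M ≤ G0 z * (Real.exp (1 + ‖z‖) * M.factorial) := by gcongr
    _ = (Real.exp (1 + ‖z‖) * G0 z) * M.factorial := by ring
    _ ≤ _ := by gcongr

lemma cont_G0 : Continuous (G0 : Euc d → ℝ) := by unfold G0; fun_prop

lemma int_inv : Integrable (fun z : Euc d => ((1 + ‖z‖) ^ (d + 1))⁻¹) := by
  have := integrable_one_add_norm (E := Euc d) (μ := volume) (r := (d + 1 : ℕ)) (by simp)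
  refine this.congr (Eventually.of_forall fun z => ?_)
  simp only
  rw [Real.rpow_neg (by positivity), Real.rpow_natCast]

lemma int_G0 (M : ℕ) : Integrable (fun z : Euc d => (1 + ‖z‖) ^ M * G0 z) := by
  refine ((int_inv (d := d)).const_mul (Real.exp 2 * (M + (d + 1)).factorial)).mono'
    (by have := cont_G0 (d := d); exact (by fun_prop : Continuous _).aestronglyMeasurable)
    (Eventually.of_forall fun z => ?_)
  have h5 : 0 < G0 z := Real.exp_pos _
  rw [Real.norm_of_nonneg (by positivity)]
  calc (1 + ‖z‖) ^ M * G0 z ≤ (1 + ‖z‖) ^ M * ((Real.exp 2 * (M + (d + 1)).factorial) * ((1 + ‖z‖) ^ (M + (d + 1)))⁻¹) := by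
        gcongr; exact G0_le _ z
    _ = _ := by rw [pow_add]; field_simp

lemma int_G0_pos : 0 < ∫ z : Euc d, G0 z := by
  rw [integral_pos_iff_support_of_nonneg (f := G0) (fun z => (Real.exp_pos _).le) (by simpa using int_G0 0)]
  have : Function.support (G0 : Euc d → ℝ) = Set.univ := by
    ext z; simp [G0, (Real.exp_pos _).ne']
  rw [this]; exact isOpen_univ.measure_pos volume Set.univ_nonempty

/-- normalised Gaussian -/
noncomputable def G (z : Euc d) : ℝ := (∫ z : Euc d, G0 z)⁻¹ * G0 z

lemma G_pos (z : Euc d) : 0 < G z := mul_pos (inv_pos.2 int_G0_pos) (Real.exp_pos _)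
lemma int_G (M : ℕ) : Integrable (fun z : Euc d => (1 + ‖z‖) ^ M * G z) := by
  refine ((int_G0 (d := d) M).const_mul (∫ z : Euc d, G0 z)⁻¹).congr (Eventually.of_forall fun z => ?_)
  simp only [G]; ring
lemma int_G' : Integrable (G : Euc d → ℝ) := by simpa using int_G 0
lemma integral_G : ∫ z : Euc d, G z = 1 := by
  simp only [G]; rw [integral_const_mul]; exact inv_mul_cancel₀ int_G0_pos.ne'
lemma cont_G : Continuous (G : Euc d → ℝ) := by
  have := cont_G0 (d := d); unfold G; fun_prop

lemma hasFDerivAt_G (z : Euc d) : HasFDerivAt G (-(G z / 2) • (innerSL ℝ z)) z := by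
  have h1 := (hasStrictFDerivAt_norm_sq z).hasFDerivAt
  have h2 := ((h1.const_mul (-1/4 : ℝ)).exp).const_mul (∫ z : Euc d, G0 z)⁻¹
  have e : (fun y : Euc d => (∫ z : Euc d, G0 z)⁻¹ * Real.exp (-1 / 4 * ‖y‖ ^ 2)) = G := by
    funext z; simp only [G, G0]; congr 2; ring
  rw [e] at h2
  refine h2.congr_fderiv ?_
  ext y
  have : -‖z‖ ^ 2 / 4 = -1 / 4 * ‖z‖ ^ 2 := by ring
  simp [G, G0, this]
  ring

lemma diff_G : Differentiable ℝ (G : Euc d → ℝ) := fun z => (hasFDerivAt_G z).differentiableAt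
lemma pd_G (i : Fin d) (z : Euc d) : fderiv ℝ G z (ee i) = -(z i / 2) * G z := by
  rw [(hasFDerivAt_G z).fderiv]
  simp [ee, EuclideanSpace.inner_single_right]
  ring

/-- heat evolution with time `s ^ 2`. -/
noncomputable def U (h : Euc d → ℝ) (s : ℝ) (x : Euc d) : ℝ := ∫ z, G z * h (x - s • z)

lemma int_U {h : Euc d → ℝ} (H : Tst h) (s : ℝ) (x : Euc d) :
    Integrable (fun z => G z * h (x - s • z)) := by
  obtain ⟨C, _, hC⟩ := H.bdd
  have := H.cont
  exact int_G'.mul_bdd (c := C)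
    (by exact (by fun_prop : Continuous _).aestronglyMeasurable) (Eventually.of_forall fun z => hC _)

lemma U_zero (h : Euc d → ℝ) (x : Euc d) : U h 0 x = h x := by
  simp only [U, zero_smul, sub_zero]; rw [integral_mul_const, integral_G, one_mul]

lemma U_add {h g : Euc d → ℝ} (H : Tst h) (H' : Tst g) (s : ℝ) (x : Euc d) :
    U (fun x => h x + g x) s x = U h s x + U g s x := by
  simp only [U, mul_add]; exact integral_add (int_U H s x) (int_U H' s x)

lemma U_sum {ι : Type*} (t : Finset ι) {h : ι → Euc d → ℝ} (H : ∀ i, Tst (h i)) (s : ℝ) (x : Euc d) :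
    U (fun x => ∑ i ∈ t, h i x) s x = ∑ i ∈ t, U (h i) s x := by
  simp only [U, Finset.mul_sum]; exact integral_finsetSum _ fun i _ => int_U (H i) s x

lemma U_decay {h : Euc d → ℝ} (H : Tst h) (S : ℝ) :
    ∃ C, 0 ≤ C ∧ ∀ s, |s| ≤ S → ∀ x, |U h s x| ≤ C * ((1 + ‖x‖) ^ (d + 1))⁻¹ := by
  rcases lt_or_ge S 0 with hS | hS
  · exact ⟨0, le_rfl, fun s hs => absurd ((abs_nonneg s).trans hs) (not_le.2 hS)⟩
  have hc : Continuous (fun y => (1 + ‖y‖) ^ (d + 1) * h y) := by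
    have := H.cont; fun_prop
  obtain ⟨C, hC⟩ := hc.bounded_above_of_compact_support (H.2.mul_left)
  have hC0 : 0 ≤ C := (norm_nonneg _).trans (hC 0)
  have hh : ∀ y, |h y| ≤ C * ((1 + ‖y‖) ^ (d + 1))⁻¹ := fun y => by
    have := hC y
    rw [norm_mul, Real.norm_of_nonneg (by positivity : 0 ≤ (1 + ‖y‖) ^ (d + 1)), Real.norm_eq_abs] at this
    rw [← div_eq_mul_inv, le_div_iff₀ (by positivity)]; linarith
  set I := ∫ z : Euc d, (1 + ‖z‖) ^ (d + 1) * G z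
  have hI : 0 ≤ I := integral_nonneg fun z => by have := G_pos z; simp only [Pi.zero_apply]; positivity
  refine ⟨C * (1 + S) ^ (d + 1) * I, by positivity, fun s hs x => ?_⟩
  have key : ∀ z : Euc d, ‖G z * h (x - s • z)‖ ≤
      (C * (1 + S) ^ (d + 1) * ((1 + ‖x‖) ^ (d + 1))⁻¹) * ((1 + ‖z‖) ^ (d + 1) * G z) := by
    intro z
    have hG := G_pos z
    rw [norm_mul, Real.norm_of_nonneg hG.le, Real.norm_eq_abs]
    have e1 : 1 + ‖x‖ ≤ (1 + ‖x - s • z‖) * ((1 + S) * (1 + ‖z‖)) := by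
      have n1 : ‖x‖ ≤ ‖x - s • z‖ + S * ‖z‖ := by
        calc ‖x‖ = ‖(x - s • z) + s • z‖ := by congr 1; abel
          _ ≤ ‖x - s • z‖ + ‖s • z‖ := norm_add_le _ _
          _ ≤ _ := by rw [norm_smul, Real.norm_eq_abs]; gcongr
      have := norm_nonneg (x - s • z)
      have := norm_nonneg z
      have i1 : 0 ≤ ‖x - s • z‖ * S := by positivity
      have i2 : 0 ≤ ‖x - s • z‖ * ‖z‖ := by positivity
      have i3 : 0 ≤ ‖x - s • z‖ * (S * ‖z‖) := by positivity
      nlinarith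
    have e2 : (1 + ‖x‖) ^ (d + 1) ≤ (1 + ‖x - s • z‖) ^ (d + 1) * ((1 + S) ^ (d + 1) * (1 + ‖z‖) ^ (d + 1)) := by
      rw [← mul_pow, ← mul_pow]; gcongr
    have e3 : ((1 + ‖x - s • z‖) ^ (d + 1))⁻¹ ≤ ((1 + ‖x‖) ^ (d + 1))⁻¹ * ((1 + S) ^ (d + 1) * (1 + ‖z‖) ^ (d + 1)) := by
      rw [inv_mul_eq_div, le_div_iff₀ (by positivity), inv_mul_le_iff₀ (by positivity)]; exact e2
    calc G z * |h (x - s • z)| ≤ G z * (C * (((1 + ‖x‖) ^ (d + 1))⁻¹ * ((1 + S) ^ (d + 1) * (1 + ‖z‖) ^ (d + 1)))) := by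
          gcongr; exact (hh _).trans (by gcongr)
      _ = _ := by ring
  calc |U h s x| ≤ ∫ z, (C * (1 + S) ^ (d + 1) * ((1 + ‖x‖) ^ (d + 1))⁻¹) * ((1 + ‖z‖) ^ (d + 1) * G z) :=
        norm_integral_le_of_norm_le ((int_G _).const_mul _) (Eventually.of_forall key)
    _ = _ := by rw [integral_const_mul]; ring

lemma U_hasFDerivAt {h : Euc d → ℝ} (H : Tst h) (s : ℝ) (x : Euc d) :
    HasFDerivAt (U h s) (∫ z, G z • fderiv ℝ h (x - s • z)) x := by
  obtain ⟨C, hC0, hC⟩ := H.fbdd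
  have hcf := H.1.continuous_fderiv (by simp)
  have hG := cont_G (d := d)
  have hh := H.cont
  refine hasFDerivAt_integral_of_dominated_of_fderiv_le (F := fun x z => G z * h (x - s • z))
    (F' := fun x z => G z • fderiv ℝ h (x - s • z)) (bound := fun z => C * G z) (s := Set.univ)
    univ_mem (Eventually.of_forall fun x => ?_) (int_U H s x) ?_ ?_ (int_G'.const_mul C) ?_
  · exact (by fun_prop : Continuous _).aestronglyMeasurable
  · exact (by fun_prop : Continuous _).aestronglyMeasurable
  · refine Eventually.of_forall fun z x _ => ?_
    rw [norm_smul, Real.norm_of_nonneg (G_pos z).le, mul_comm]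
    have := (G_pos z).le
    gcongr; exact hC _
  · refine Eventually.of_forall fun z x _ => ?_
    have h1 : HasFDerivAt (fun x : Euc d => x - s • z) (ContinuousLinearMap.id ℝ (Euc d)) x :=
      (hasFDerivAt_id x).sub_const _
    have := ((H.diff (x - s • z)).hasFDerivAt.comp x h1).const_mul (G z)
    simpa using this

lemma U_diff {h : Euc d → ℝ} (H : Tst h) (s : ℝ) : Differentiable ℝ (U h s) :=
  fun x => (U_hasFDerivAt H s x).differentiableAt

lemma U_cont {h : Euc d → ℝ} (H : Tst h) (s : ℝ) : Continuous (U h s) := (U_diff H s).continuous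

lemma pd_U {h : Euc d → ℝ} (H : Tst h) (s : ℝ) (i : Fin d) (x : Euc d) :
    pd i (U h s) x = U (pd i h) s x := by
  obtain ⟨C, hC0, hC⟩ := H.fbdd
  have hcf := H.1.continuous_fderiv (by simp)
  unfold pd
  rw [(U_hasFDerivAt H s x).fderiv, ContinuousLinearMap.integral_apply]
  · rfl
  · have := hcf
    have hG := cont_G (d := d)
    refine (int_G'.const_mul C).mono' (by exact (by fun_prop : Continuous _).aestronglyMeasurable)
      (Eventually.of_forall fun z => ?_)
    rw [norm_smul, Real.norm_of_nonneg (G_pos z).le, mul_comm]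
    have := (G_pos z).le
    gcongr; exact hC _

/-- Gaussian integration by parts -/
lemma gauss_ibp {h : Euc d → ℝ} (H : Tst h) (s : ℝ) (i : Fin d) (x : Euc d) :
    ∫ z, (z i * G z) * h (x - s • z) = -(2 * s) * U (pd i h) s x := by
  obtain ⟨C, hC0, hC⟩ := H.bdd
  have hG := cont_G (d := d)
  have hh := H.cont
  have hzi : Integrable (fun z : Euc d => z i * G z) := by
    refine (int_G 1).mono' (by exact (by fun_prop : Continuous _).aestronglyMeasurable)
      (Eventually.of_forall fun z => ?_)
    rw [norm_mul, Real.norm_of_nonneg (G_pos z).le, pow_one]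
    have := (G_pos z).le
    gcongr
    exact (PiLp.norm_apply_le z i).trans (by linarith)
  have hd : ∀ z, HasFDerivAt (fun z => h (x - s • z)) (-(s • fderiv ℝ h (x - s • z))) z := by
    intro z
    have h1 : HasFDerivAt (fun z : Euc d => x - s • z) (-(s • ContinuousLinearMap.id ℝ (Euc d))) z := by
      exact ((hasFDerivAt_id z).const_smul s).const_sub x
    have := ((H.diff (x - s • z)).hasFDerivAt.comp z h1)
    refine this.congr_fderiv ?_
    ext y; simp
  have hfd : ∀ z, fderiv ℝ (fun z => h (x - s • z)) z (ee i) = -(s * pd i h (x - s • z)) := by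
    intro z; rw [(hd z).fderiv]; simp [pd]
  have key := integral_mul_fderiv_eq_neg_fderiv_mul_of_integrable (𝕜 := ℝ) (μ := volume) (f := G)
    (g := fun z => h (x - s • z)) (v := ee i) ?_ ?_ (int_U H s x) (fun z _ => diff_G z)
    (fun z _ => (hd z).differentiableAt)
  · simp only [hfd, pd_G] at key
    have e1 : ∫ z, G z * -(s * pd i h (x - s • z)) = - s * U (pd i h) s x := by
      rw [U, ← integral_const_mul]; congr 1; funext z; ring
    have e2 : ∫ z : Euc d, -(z i / 2) * G z * h (x - s • z) = -(1/2) * ∫ z, (z i * G z) * h (x - s • z) := by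
      rw [← integral_const_mul]; congr 1; funext z; ring
    rw [e1, e2] at key
    linarith
  · simp only [pd_G]
    refine ((hzi.const_mul (-1/2)).mul_bdd (c := C)
      (by exact (by fun_prop : Continuous (fun z => h (x - s • z))).aestronglyMeasurable) (Eventually.of_forall fun z => hC _)).congr
      (Eventually.of_forall fun z => ?_)
    simp only; ring
  · simp only [hfd]
    refine ((int_U (H.pd i) s x).const_mul (-s)).congr (Eventually.of_forall fun z => ?_)
    simp only; ring

lemma U_hasDerivAt {h : Euc d → ℝ} (H : Tst h) (s : ℝ) (x : Euc d) :
    HasDerivAt (fun s => U h s x) (2 * s * ∑ i, U (pd i (pd i h)) s x) s := by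
  obtain ⟨C, hC0, hC⟩ := H.fbdd
  have hcf := H.1.continuous_fderiv (by simp)
  have hG := cont_G (d := d)
  have hh := H.cont
  have key := hasDerivAt_integral_of_dominated_loc_of_deriv_le (μ := volume) (F := fun s z => G z * h (x - s • z))
    (F' := fun s z => G z * -(fderiv ℝ h (x - s • z) z)) (bound := fun z => C * ((1 + ‖z‖) ^ 1 * G z))
    (x₀ := s) (s := Set.univ)
    univ_mem (Eventually.of_forall fun x => ?_) (int_U H s x) ?_ ?_ ((int_G 1).const_mul C) ?_
  · have e : (∫ z, G z * -(fderiv ℝ h (x - s • z) z)) = 2 * s * ∑ i, U (pd i (pd i h)) s x := by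
      have e1 : ∀ z, G z * -(fderiv ℝ h (x - s • z) z) = - ∑ i, (z i * G z) * pd i h (x - s • z) := by
        intro z
        rw [fderiv_apply_eq_sum, mul_neg, Finset.mul_sum]
        congr 1; refine Finset.sum_congr rfl fun i _ => ?_
        simp only [pd]; ring
      simp only [e1]
      rw [integral_neg, integral_finsetSum]
      · simp only [gauss_ibp (H.pd _)]
        rw [Finset.mul_sum, ← Finset.sum_neg_distrib]
        refine Finset.sum_congr rfl fun i _ => ?_
        ring
      · intro i _
        obtain ⟨C, hC0, hC⟩ := (H.pd i).bdd
        have := (H.pd i).cont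
        have hzi : Integrable (fun z : Euc d => z i * G z) := by
          refine (int_G 1).mono' (by exact (by fun_prop : Continuous _).aestronglyMeasurable)
            (Eventually.of_forall fun z => ?_)
          rw [norm_mul, Real.norm_of_nonneg (G_pos z).le, pow_one]
          have := (G_pos z).le
          gcongr
          exact (PiLp.norm_apply_le z i).trans (by linarith)
        exact hzi.mul_bdd (c := C) (by exact (by fun_prop : Continuous _).aestronglyMeasurable) (Eventually.of_forall fun z => hC _)
    rw [← e]; exact key.2
  · exact (by fun_prop : Continuous _).aestronglyMeasurable
  · exact (by fun_prop : Continuous _).aestronglyMeasurable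
  · refine Eventually.of_forall fun z s _ => ?_
    rw [norm_mul, Real.norm_of_nonneg (G_pos z).le, norm_neg, pow_one]
    have := (G_pos z).le
    have : ‖fderiv ℝ h (x - s • z) z‖ ≤ C * (1 + ‖z‖) :=
      ((fderiv ℝ h (x - s • z)).le_opNorm z).trans (by gcongr; exact hC _; linarith)
    calc _ ≤ G z * (C * (1 + ‖z‖)) := by gcongr
      _ = _ := by ring
  · refine Eventually.of_forall fun z s _ => ?_
    have h1 : HasDerivAt (fun s : ℝ => x - s • z) (-z) s := by
      simpa using ((hasDerivAt_id s).smul_const z).const_sub x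
    have := ((H.diff (x - s • z)).hasFDerivAt.comp_hasDerivAt s h1).const_mul (G z)
    simpa using this

end Heat

namespace Heat
variable {d : ℕ}

/-- continuous with integrable polynomial decay -/
def Dec (f : Euc d → ℝ) : Prop :=
  Continuous f ∧ ∃ C, ∀ x, |f x| ≤ C * ((1 + ‖x‖) ^ (d + 1))⁻¹

lemma wt_le_one (x : Euc d) : ((1 + ‖x‖) ^ (d + 1))⁻¹ ≤ 1 :=
  inv_le_one_of_one_le₀ (one_le_pow₀ (by linarith [norm_nonneg x]))

lemma wt_pos (x : Euc d) : 0 < ((1 + ‖x‖) ^ (d + 1))⁻¹ := by positivity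

lemma Dec.int {f : Euc d → ℝ} (h : Dec f) : Integrable f := by
  obtain ⟨hc, C, hC⟩ := h
  exact (int_inv.const_mul C).mono' hc.aestronglyMeasurable (Eventually.of_forall hC)

lemma Dec.bdd {f : Euc d → ℝ} (h : Dec f) : ∃ C, 0 ≤ C ∧ ∀ x, |f x| ≤ C := by
  obtain ⟨hc, C, hC⟩ := h
  have hC0 : 0 ≤ C := by
    have := (abs_nonneg _).trans (hC 0)
    exact nonneg_of_mul_nonneg_left this (wt_pos 0)
  exact ⟨C, hC0, fun x => (hC x).trans (mul_le_of_le_one_right hC0 (wt_le_one x))⟩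

lemma Dec.bdd_mul {f k : Euc d → ℝ} (h : Dec f) (hk : Continuous k) {C : ℝ} (hC : ∀ x, |k x| ≤ C) :
    Dec (fun x => k x * f x) := by
  obtain ⟨hc, C', hC'⟩ := h
  refine ⟨hk.mul hc, C * C', fun x => ?_⟩
  rw [abs_mul, mul_assoc]
  have := (abs_nonneg _).trans (hC x)
  exact mul_le_mul (hC x) (hC' x) (abs_nonneg _) this

lemma Dec.mul {f k : Euc d → ℝ} (h : Dec f) (hk : Dec k) : Dec (fun x => k x * f x) := by
  obtain ⟨C, _, hC⟩ := hk.bdd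
  exact h.bdd_mul hk.1 hC

lemma U_dec {h : Euc d → ℝ} (H : Tst h) (s : ℝ) : Dec (U h s) := by
  obtain ⟨C, _, hC⟩ := U_decay H |s|
  exact ⟨U_cont H s, C, hC s le_rfl⟩

lemma U_ibp {f g : Euc d → ℝ} (Hf : Tst f) (Hg : Tst g) (s : ℝ) (k : Fin d) :
    ∫ x, U f s x * U (pd k g) s x = - ∫ x, U (pd k f) s x * U g s x := by
  have e : ∀ {f : Euc d → ℝ}, Tst f → ∀ x, fderiv ℝ (U f s) x (ee k) = U (pd k f) s x :=
    fun H x => pd_U H s k x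
  have := integral_mul_fderiv_eq_neg_fderiv_mul_of_integrable (𝕜 := ℝ) (μ := volume) (f := U f s)
    (g := U g s) (v := ee k) ?_ ?_ ?_ (fun x _ => U_diff Hf s x) (fun x _ => U_diff Hg s x)
  · simpa only [e Hf, e Hg] using this
  · simp only [e Hf]; exact ((U_dec Hg s).mul (U_dec (Hf.pd k) s)).int
  · simp only [e Hg]; exact ((U_dec (Hg.pd k) s).mul (U_dec Hf s)).int
  · exact ((U_dec Hg s).mul (U_dec Hf s)).int

/-- pair of evolutions -/
noncomputable def W (h g : Euc d → ℝ) (s : ℝ) (x : Euc d) : ℝ × ℝ := (U h s x, U g s x)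

lemma W_cont {h g : Euc d → ℝ} (H : Tst h) (H' : Tst g) (s : ℝ) : Continuous (W h g s) :=
  (U_cont H s).prodMk (U_cont H' s)

lemma W_decay {h g : Euc d → ℝ} (H : Tst h) (H' : Tst g) (S : ℝ) :
    ∃ C, 0 ≤ C ∧ ∀ s, |s| ≤ S → ∀ x, ‖W h g s x‖ ≤ C * ((1 + ‖x‖) ^ (d + 1))⁻¹ := by
  obtain ⟨C1, h1, hC1⟩ := U_decay H S
  obtain ⟨C2, h2, hC2⟩ := U_decay H' S
  refine ⟨max C1 C2, le_max_of_le_left h1, fun s hs x => ?_⟩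
  have := wt_pos x
  refine max_le ((hC1 s hs x).trans ?_) ((hC2 s hs x).trans ?_)
  · gcongr; exact le_max_left _ _
  · gcongr; exact le_max_right _ _

lemma bdd_comp {F : Type*} [NormedAddCommGroup F] {K : ℝ × ℝ → F} (hK : Continuous K) (M : ℝ) :
    ∃ C, 0 ≤ C ∧ ∀ z, ‖z‖ ≤ M → ‖K z‖ ≤ C := by
  obtain ⟨C, hC⟩ := (isCompact_closedBall (0 : ℝ × ℝ) M).exists_bound_of_continuousOn hK.continuousOn
  refine ⟨max C 0, le_max_right _ _, fun z hz => (hC z ?_).trans (le_max_left _ _)⟩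
  simpa using hz

lemma W_hasFDerivAt {h g : Euc d → ℝ} (H : Tst h) (H' : Tst g) (s : ℝ) (x : Euc d) :
    HasFDerivAt (W h g s) ((fderiv ℝ (U h s) x).prod (fderiv ℝ (U g s) x)) x :=
  (U_diff H s x).hasFDerivAt.prodMk (U_diff H' s x).hasFDerivAt

lemma W_fd {h g : Euc d → ℝ} (H : Tst h) (H' : Tst g) (s : ℝ) (x : Euc d) (k : Fin d) :
    ((fderiv ℝ (U h s) x).prod (fderiv ℝ (U g s) x)) (ee k) = W (pd k h) (pd k g) s x := by
  exact Prod.ext (pd_U H s k x) (pd_U H' s k x)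

lemma int_of_wt {F : Type*} [NormedAddCommGroup F] {f : Euc d → F} (hc : Continuous f) {C : ℝ}
    (hC : ∀ x, ‖f x‖ ≤ C * ((1 + ‖x‖) ^ (d + 1))⁻¹) : Integrable f :=
  (int_inv.const_mul C).mono' hc.aestronglyMeasurable (Eventually.of_forall hC)

lemma B_int {B : ℝ × ℝ → ℝ} (hB : ContDiff ℝ 2 B) {h g : Euc d → ℝ} (H : Tst h) (H' : Tst g) (s : ℝ) :
    Integrable (fun x => B (W h g s x) - B 0) := by
  obtain ⟨C, hC0, hC⟩ := W_decay H H' |s|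
  obtain ⟨K, hK0, hK⟩ := bdd_comp (hB.continuous_fderiv (by norm_num)) C
  refine int_of_wt (C := K * C) ((hB.continuous.comp (W_cont H H' s)).sub continuous_const) fun x => ?_
  have hw := hC s le_rfl x
  have hwC : ‖W h g s x‖ ≤ C := hw.trans (mul_le_of_le_one_right hC0 (wt_le_one x))
  have := (convex_closedBall (0 : ℝ × ℝ) C).norm_image_sub_le_of_norm_fderiv_le (𝕜 := ℝ) (f := B)
    (fun z _ => hB.differentiable (by norm_num) z) (fun z hz => hK z (by simpa using hz))
    (x := 0) (y := W h g s x) (by simpa using hC0) (by simpa using hwC)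
  refine this.trans ?_
  rw [sub_zero, mul_assoc]
  gcongr

lemma B_ibp {B : ℝ × ℝ → ℝ} (hB : ContDiff ℝ 2 B) {h g : Euc d → ℝ} (H : Tst h) (H' : Tst g) (s : ℝ)
    (k : Fin d) :
    Integrable (fun x => fderiv ℝ (fderiv ℝ B) (W h g s x) (W (pd k h) (pd k g) s x)
      (W (pd k h) (pd k g) s x)) ∧
    Integrable (fun x => fderiv ℝ B (W h g s x) (W (pd k (pd k h)) (pd k (pd k g)) s x)) ∧
    ∫ x, fderiv ℝ B (W h g s x) (W (pd k (pd k h)) (pd k (pd k g)) s x) =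
    - ∫ x, fderiv ℝ (fderiv ℝ B) (W h g s x) (W (pd k h) (pd k g) s x)
      (W (pd k h) (pd k g) s x) := by
  have hdB : ContDiff ℝ 1 (fderiv ℝ B) := hB.fderiv_right (by norm_num)
  have cB := hdB.continuous
  have cB2 := hdB.continuous_fderiv (by norm_num)
  have cw := W_cont H H' s
  have cw1 := W_cont (H.pd k) (H'.pd k) s
  have cw2 := W_cont ((H.pd k).pd k) ((H'.pd k).pd k) s
  obtain ⟨C, hC0, hC⟩ := W_decay H H' |s|
  obtain ⟨C1, hC10, hC1⟩ := W_decay (H.pd k) (H'.pd k) |s|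
  obtain ⟨C2, hC20, hC2⟩ := W_decay ((H.pd k).pd k) ((H'.pd k).pd k) |s|
  obtain ⟨K, hK0, hK⟩ := bdd_comp cB C
  obtain ⟨K2, hK20, hK2⟩ := bdd_comp cB2 C
  have bd : ∀ x, ‖W h g s x‖ ≤ C := fun x =>
    (hC s le_rfl x).trans (mul_le_of_le_one_right hC0 (wt_le_one x))
  have bd1 : ∀ x, ‖W (pd k h) (pd k g) s x‖ ≤ C1 := fun x =>
    (hC1 s le_rfl x).trans (mul_le_of_le_one_right hC10 (wt_le_one x))
  have I1 : Integrable (fun x => fderiv ℝ (fderiv ℝ B) (W h g s x) (W (pd k h) (pd k g) s x)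
      (W (pd k h) (pd k g) s x)) := by
    refine int_of_wt (C := K2 * C1 * C1) (((cB2.comp cw).clm_apply cw1).clm_apply cw1) fun x => ?_
    calc _ ≤ ‖fderiv ℝ (fderiv ℝ B) (W h g s x)‖ * ‖W (pd k h) (pd k g) s x‖ * ‖W (pd k h) (pd k g) s x‖ :=
          ContinuousLinearMap.le_opNorm₂ _ _ _
      _ ≤ K2 * C1 * (C1 * ((1 + ‖x‖) ^ (d + 1))⁻¹) := by
          gcongr
          · exact hK2 _ (bd x)
          · exact bd1 x
          · exact hC1 s le_rfl x
      _ = _ := by ring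
  have I2 : Integrable (fun x => fderiv ℝ B (W h g s x) (W (pd k (pd k h)) (pd k (pd k g)) s x)) := by
    refine int_of_wt (C := K * C2) ((cB.comp cw).clm_apply cw2) fun x => ?_
    refine (ContinuousLinearMap.le_opNorm _ _).trans ?_
    rw [mul_assoc]
    gcongr
    · exact hK _ (bd x)
    · exact hC2 s le_rfl x
  have I3 : Integrable (fun x => fderiv ℝ B (W h g s x) (W (pd k h) (pd k g) s x)) := by
    refine int_of_wt (C := K * C1) ((cB.comp cw).clm_apply cw1) fun x => ?_
    refine (ContinuousLinearMap.le_opNorm _ _).trans ?_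
    rw [mul_assoc]
    gcongr
    · exact hK _ (bd x)
    · exact hC1 s le_rfl x
  refine ⟨I1, I2, ?_⟩
  have key := integral_bilinear_hasFDerivAt_right_eq_neg_left_of_integrable (μ := (volume : Measure (Euc d)))
    (f := fun x => fderiv ℝ B (W h g s x))
    (f' := fun x => (fderiv ℝ (fderiv ℝ B) (W h g s x)).comp ((fderiv ℝ (U h s) x).prod (fderiv ℝ (U g s) x)))
    (g := W (pd k h) (pd k g) s)
    (g' := fun x => (fderiv ℝ (U (pd k h) s) x).prod (fderiv ℝ (U (pd k g) s) x))
    (v := ee k) (B := ContinuousLinearMap.id ℝ (ℝ × ℝ →L[ℝ] ℝ)) ?_ ?_ ?_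
    (fun x _ => (hdB.differentiable (by norm_num) _).hasFDerivAt.comp x (W_hasFDerivAt H H' s x))
    (fun x _ => W_hasFDerivAt (H.pd k) (H'.pd k) s x)
  · simpa only [ContinuousLinearMap.coe_id', id_eq, W_fd (H.pd k) (H'.pd k), ContinuousLinearMap.comp_apply,
      W_fd H H'] using key
  · simpa only [ContinuousLinearMap.coe_id', id_eq, ContinuousLinearMap.comp_apply,
      W_fd H H'] using I1
  · simpa only [ContinuousLinearMap.coe_id', id_eq, W_fd (H.pd k) (H'.pd k)] using I2
  · simpa only [ContinuousLinearMap.coe_id', id_eq] using I3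

lemma B_deriv {B : ℝ × ℝ → ℝ} (hB : ContDiff ℝ 2 B) {h g : Euc d → ℝ} (H : Tst h) (H' : Tst g) (s : ℝ) :
    HasDerivAt (fun s => ∫ x, (B (W h g s x) - B 0))
      (-(2 * s) * ∑ k, ∫ x, fderiv ℝ (fderiv ℝ B) (W h g s x) (W (pd k h) (pd k g) s x)
        (W (pd k h) (pd k g) s x)) s := by
  have cB : Continuous (fderiv ℝ B) := hB.continuous_fderiv (by norm_num)
  have hW : ∀ s x, HasDerivAt (fun s => W h g s x)
      ((2 * s) • ∑ k, W (pd k (pd k h)) (pd k (pd k g)) s x) s := by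
    intro s x
    have := (U_hasDerivAt H s x).prodMk (U_hasDerivAt H' s x)
    refine this.congr_deriv ?_
    ext <;> simp [W, Prod.fst_sum, Prod.snd_sum]
  set S := |s| + 1
  obtain ⟨C, hC0, hC⟩ := W_decay H H' S
  choose C2 hC20 hC2 using fun k => W_decay ((H.pd k).pd k) ((H'.pd k).pd k) S
  obtain ⟨K, hK0, hK⟩ := bdd_comp cB C
  have key := hasDerivAt_integral_of_dominated_loc_of_deriv_le (μ := (volume : Measure (Euc d)))
    (F := fun s x => B (W h g s x) - B 0)
    (F' := fun s x => fderiv ℝ B (W h g s x) ((2 * s) • ∑ k, W (pd k (pd k h)) (pd k (pd k g)) s x))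
    (x₀ := s) (s := Metric.ball s 1)
    (bound := fun x => K * (2 * S * ∑ k, C2 k) * ((1 + ‖x‖) ^ (d + 1))⁻¹)
    (Metric.ball_mem_nhds s one_pos)
    (Eventually.of_forall fun s => ((hB.continuous.comp (W_cont H H' s)).sub continuous_const).aestronglyMeasurable)
    (B_int hB H H' s) ?_ (Eventually.of_forall fun x s' hs' => ?_) (int_inv.const_mul _)
    (Eventually.of_forall fun x s' hs' => ?_)
  · refine key.2.congr_deriv ?_
    simp only [map_smul, map_sum, smul_eq_mul]
    rw [integral_const_mul, integral_finsetSum _ fun k _ => (B_ibp hB H H' s k).2.1]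
    simp only [(B_ibp hB H H' s _).2.2, Finset.sum_neg_distrib]
    ring
  · refine Continuous.aestronglyMeasurable ?_
    have hsum : Continuous (fun x => ∑ k, W (pd k (pd k h)) (pd k (pd k g)) s x) :=
      continuous_finsetSum _ fun k _ => ?_
    · exact (cB.comp (W_cont H H' s)).clm_apply (hsum.const_smul (2 * s))
    exact W_cont ((H.pd k).pd k) ((H'.pd k).pd k) s
  · have hs2 : |s'| ≤ S := by
      rw [Metric.mem_ball, Real.dist_eq] at hs'
      have := abs_sub_abs_le_abs_sub s' s
      simp only [S]; linarith
    have hw : ‖W h g s' x‖ ≤ C := (hC s' hs2 x).trans (mul_le_of_le_one_right hC0 (wt_le_one x))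
    refine (ContinuousLinearMap.le_opNorm _ _).trans ?_
    have : ‖(2 * s') • ∑ k, W (pd k (pd k h)) (pd k (pd k g)) s' x‖ ≤ 2 * S * (∑ k, C2 k * ((1 + ‖x‖) ^ (d + 1))⁻¹) := by
      rw [norm_smul, norm_mul, Real.norm_eq_abs, Real.norm_eq_abs, abs_two]
      gcongr
      exact norm_sum_le_of_le _ fun k _ => hC2 k s' hs2 x
    calc _ ≤ K * (2 * S * (∑ k, C2 k * ((1 + ‖x‖) ^ (d + 1))⁻¹)) := by
          gcongr; exact hK _ hw
      _ = _ := by rw [← Finset.sum_mul]; ring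
  · exact ((hB.differentiable (by norm_num) _).hasFDerivAt.comp_hasDerivAt s' (hW s' x)).sub_const _

lemma vec_ineq {L : ℝ × ℝ →L[ℝ] ℝ × ℝ →L[ℝ] ℝ} {c : ℝ} (hc : 0 < c)
    (hL : ∀ h : ℝ × ℝ, c * |h.1| * |h.2| ≤ L h h) (a b : Fin d → ℝ) (i j : Fin d) :
    c * (|a i| * |b j|) ≤ ∑ k, L (a k, b k) (a k, b k) := by
  have e : ∀ x y : ℝ, L (x, y) (x, y) = L (1, 0) (1, 0) * x ^ 2 +
      (L (1, 0) (0, 1) + L (0, 1) (1, 0)) * (x * y) + L (0, 1) (0, 1) * y ^ 2 := by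
    intro x y
    have : ((x, y) : ℝ × ℝ) = x • (1, 0) + y • (0, 1) := by ext <;> simp
    rw [this]
    simp only [map_add, map_smul, add_apply, smul_apply, smul_eq_mul]
    ring
  set q11 := L (1, 0) (1, 0)
  set q22 := L (0, 1) (0, 1)
  set q12 := L (1, 0) (0, 1) + L (0, 1) (1, 0)
  simp only [e, Finset.sum_add_distrib, ← Finset.mul_sum]
  set A := Real.sqrt (∑ k, a k ^ 2)
  set D := Real.sqrt (∑ k, b k ^ 2)
  have hA : A ^ 2 = ∑ k, a k ^ 2 := Real.sq_sqrt (Finset.sum_nonneg fun k _ => sq_nonneg _)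
  have hD : D ^ 2 = ∑ k, b k ^ 2 := Real.sq_sqrt (Finset.sum_nonneg fun k _ => sq_nonneg _)
  have hA0 : 0 ≤ A := Real.sqrt_nonneg _
  have hD0 : 0 ≤ D := Real.sqrt_nonneg _
  have ai : |a i| ≤ A := Real.abs_le_sqrt (Finset.single_le_sum (f := fun k => a k ^ 2) (fun k _ => sq_nonneg _) (Finset.mem_univ i))
  have bj : |b j| ≤ D := Real.abs_le_sqrt (Finset.single_le_sum (f := fun k => b k ^ 2) (fun k _ => sq_nonneg _) (Finset.mem_univ j))
  have ht : |∑ k, a k * b k| ≤ A * D := by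
    refine abs_le_of_sq_le_sq ?_ (by positivity)
    rw [mul_pow, hA, hD]
    exact Finset.sum_mul_sq_le_sq_mul_sq _ _ _
  rw [← hA, ← hD]
  have p1 := hL (A, D)
  have p2 := hL (A, -D)
  rw [e] at p1 p2
  simp only [abs_neg, abs_of_nonneg hA0, abs_of_nonneg hD0] at p1 p2
  have i1 : c * (|a i| * |b j|) ≤ c * (A * D) := by gcongr
  have t1 := abs_le.1 ht
  rcases le_total 0 q12 with hq | hq
  · have := mul_le_mul_of_nonneg_left t1.1 hq
    nlinarith
  · have := mul_le_mul_of_nonpos_left t1.2 hq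
    nlinarith

end Heat

namespace Heat
variable {d : ℕ}

lemma pd_add {f g : Euc d → ℝ} (Hf : Tst f) (Hg : Tst g) (i : Fin d) :
    pd i (fun x => f x + g x) = fun x => pd i f x + pd i g x := by
  funext x; unfold pd; rw [fderiv_fun_add (Hf.diff x) (Hg.diff x)]; simp

lemma pd_sum {ι : Type*} (t : Finset ι) {h : ι → Euc d → ℝ} (H : ∀ i, Tst (h i)) (i : Fin d) :
    pd i (fun x => ∑ k ∈ t, h k x) = fun x => ∑ k ∈ t, pd i (h k) x := by
  funext x; unfold pd; rw [fderiv_fun_sum fun k _ => (H k).diff x]; simp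

lemma Tst.c2 {f : Euc d → ℝ} (H : Tst f) : ContDiff ℝ 2 f := H.1.of_le (by exact WithTop.coe_le_coe.2 (le_top : (2:ℕ∞) ≤ ⊤))

lemma lap_pd {f : Euc d → ℝ} (H : Tst f) (i : Fin d) : lap (pd i f) = pd i (lap f) := by
  have : lap f = fun x => ∑ k, pd k (pd k f) x := rfl
  rw [this, pd_sum _ fun k => (H.pd k).pd k]
  funext x
  refine Finset.sum_congr rfl fun k _ => ?_
  rw [pd_comm H.c2 k i, pd_comm (H.pd k).c2 k i]

lemma Q_deriv {φ g : Euc d → ℝ} (H : Tst φ) (Hg : Tst g) (i j : Fin d) (s : ℝ) :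
    HasDerivAt (fun s => ∫ x, U (pd i (pd j φ)) s x * U g s x)
      (-(4 * s) * ∫ x, U (pd j (lap φ)) s x * U (pd i g) s x) s := by
  set a := pd i (pd j φ) with ha
  have Ha : Tst a := (H.pd j).pd i
  set S := |s| + 1
  obtain ⟨C1, hC10, hC1⟩ := U_decay Ha S
  obtain ⟨C2, hC20, hC2⟩ := U_decay Hg S
  choose C3 hC30 hC3 using fun k => U_decay ((Ha.pd k).pd k) S
  choose C4 hC40 hC4 using fun k => U_decay ((Hg.pd k).pd k) S
  have key := hasDerivAt_integral_of_dominated_loc_of_deriv_le (μ := (volume : Measure (Euc d)))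
    (F := fun s x => U a s x * U g s x)
    (F' := fun s x => (2 * s * ∑ k, U (pd k (pd k a)) s x) * U g s x + U a s x * (2 * s * ∑ k, U (pd k (pd k g)) s x))
    (x₀ := s) (s := Metric.ball s 1)
    (bound := fun x => ((2 * S * ∑ k, C3 k) * C2 + C1 * (2 * S * ∑ k, C4 k)) * ((1 + ‖x‖) ^ (d + 1))⁻¹)
    (Metric.ball_mem_nhds s one_pos)
    (Eventually.of_forall fun s => ((U_cont Ha s).mul (U_cont Hg s)).aestronglyMeasurable)
    ((U_dec Hg s).mul (U_dec Ha s)).int ?_ (Eventually.of_forall fun x s' hs' => ?_) (int_inv.const_mul _)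
    (Eventually.of_forall fun x s' hs' => (U_hasDerivAt Ha s' x).mul (U_hasDerivAt Hg s' x))
  · refine key.2.congr_deriv ?_
    have I1 : ∀ k, Integrable (fun x => U (pd k (pd k a)) s x * U g s x) := fun k =>
      ((U_dec Hg s).mul (U_dec ((Ha.pd k).pd k) s)).int
    have I2 : ∀ k, Integrable (fun x => U a s x * U (pd k (pd k g)) s x) := fun k =>
      ((U_dec ((Hg.pd k).pd k) s).mul (U_dec Ha s)).int
    have e1 : ∀ k, ∫ x, U a s x * U (pd k (pd k g)) s x = ∫ x, U (pd k (pd k a)) s x * U g s x := fun k => by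
      rw [U_ibp Ha (Hg.pd k), U_ibp (Ha.pd k) Hg, neg_neg]
    have e2 : ∫ x, ((2 * s * ∑ k, U (pd k (pd k a)) s x) * U g s x + U a s x * (2 * s * ∑ k, U (pd k (pd k g)) s x))
        = 4 * s * ∑ k, ∫ x, U (pd k (pd k a)) s x * U g s x := by
      have : ∀ x, ((2 * s * ∑ k, U (pd k (pd k a)) s x) * U g s x + U a s x * (2 * s * ∑ k, U (pd k (pd k g)) s x))
        = 2 * s * ((∑ k, U (pd k (pd k a)) s x * U g s x) + ∑ k, U a s x * U (pd k (pd k g)) s x) := by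
        intro x; rw [← Finset.sum_mul, ← Finset.mul_sum]; ring
      simp only [this]
      rw [integral_const_mul, integral_add (integrable_finsetSum _ fun k _ => I1 k) (integrable_finsetSum _ fun k _ => I2 k),
        integral_finsetSum _ fun k _ => I1 k, integral_finsetSum _ fun k _ => I2 k]
      simp only [e1]; ring
    rw [e2]
    have e3 : ∑ k, ∫ x, U (pd k (pd k a)) s x * U g s x = ∫ x, U (lap a) s x * U g s x := by
      rw [← integral_finsetSum _ fun k _ => I1 k]
      congr 1; funext x
      rw [← Finset.sum_mul, ← U_sum _ fun k => (Ha.pd k).pd k]; rfl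
    have e4 : lap a = pd i (pd j (lap φ)) := by rw [ha, lap_pd (H.pd j), lap_pd H]
    have e5 := U_ibp (H.lap.pd j) Hg s i
    rw [e3, e4, ← neg_eq_iff_eq_neg.2 e5]; ring
  · refine Continuous.aestronglyMeasurable ?_
    have c1 := U_cont Ha s
    have c2 := U_cont Hg s
    have c3 := fun k => U_cont ((Ha.pd k).pd k) s
    have c4 := fun k => U_cont ((Hg.pd k).pd k) s
    fun_prop
  · have hs2 : |s'| ≤ S := by
      rw [Metric.mem_ball, Real.dist_eq] at hs'
      have := abs_sub_abs_le_abs_sub s' s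
      simp only [S]; linarith
    have hS0 : 0 ≤ S := (abs_nonneg _).trans hs2
    have w0 := wt_pos x
    have w1 := wt_le_one x
    have b : ∀ {f : Fin d → Euc d → ℝ} {C : Fin d → ℝ}, (∀ k, 0 ≤ C k) → (∀ k s, |s| ≤ S → ∀ x, |U (f k) s x| ≤ C k * ((1 + ‖x‖) ^ (d + 1))⁻¹) →
        |2 * s' * ∑ k, U (f k) s' x| ≤ (2 * S * ∑ k, C k) * ((1 + ‖x‖) ^ (d + 1))⁻¹ := by
      intro f C h0 h
      rw [abs_mul, abs_mul, abs_two, mul_assoc (2 * S), Finset.sum_mul]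
      gcongr
      exact (Finset.abs_sum_le_sum_abs _ _).trans (Finset.sum_le_sum fun k _ => h k s' hs2 x)
    have b1 := b hC30 hC3
    have b2 := b hC40 hC4
    have d1 : |U a s' x| ≤ C1 := (hC1 s' hs2 x).trans (mul_le_of_le_one_right hC10 w1)
    have d2 : |U g s' x| ≤ C2 := (hC2 s' hs2 x).trans (mul_le_of_le_one_right hC20 w1)
    have n3 : 0 ≤ ∑ k, C3 k := Finset.sum_nonneg fun k _ => hC30 k
    have n4 : 0 ≤ ∑ k, C4 k := Finset.sum_nonneg fun k _ => hC40 k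
    refine (norm_add_le _ _).trans ?_
    rw [add_mul]
    simp only [Real.norm_eq_abs]
    rw [abs_mul (2 * s' * ∑ k, U (pd k (pd k a)) s' x), abs_mul (U a s' x)]
    refine add_le_add ?_ ?_
    · calc _ ≤ ((2 * S * ∑ k, C3 k) * ((1 + ‖x‖) ^ (d + 1))⁻¹) * C2 :=
          mul_le_mul b1 d2 (abs_nonneg _) (by positivity)
        _ = _ := by ring
    · calc _ ≤ C1 * ((2 * S * ∑ k, C4 k) * ((1 + ‖x‖) ^ (d + 1))⁻¹) :=
          mul_le_mul d1 b2 (abs_nonneg _) hC10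
        _ = _ := by ring

lemma U_L1 {g : Euc d → ℝ} (H : Tst g) : ∃ C, 0 ≤ C ∧ ∀ s, ∫ x, |U g s x| ≤ C := by
  set A := ∫⁻ z : Euc d, ‖G z‖ₑ
  set D := ∫⁻ x : Euc d, ‖g x‖ₑ
  have hA : A ≠ ⊤ := int_G'.2.ne
  have hD : D ≠ ⊤ := H.integrable.2.ne
  have hc := H.cont
  have hG := cont_G (d := d)
  refine ⟨(A * D).toReal, ENNReal.toReal_nonneg, fun s => ?_⟩
  have h1 : ∫⁻ x, ‖U g s x‖ₑ ≤ A * D := by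
    calc ∫⁻ x, ‖U g s x‖ₑ ≤ ∫⁻ x, ∫⁻ z, ‖G z * g (x - s • z)‖ₑ :=
          lintegral_mono fun x => enorm_integral_le_lintegral_enorm _
      _ = ∫⁻ z, ∫⁻ x, ‖G z * g (x - s • z)‖ₑ := by
          apply lintegral_lintegral_swap
          exact (by fun_prop : Continuous (fun p : Euc d × Euc d => G p.2 * g (p.1 - s • p.2))).enorm.measurable.aemeasurable
      _ = ∫⁻ z, ‖G z‖ₑ * D := by
          refine lintegral_congr fun z => ?_
          simp only [enorm_mul]
          rw [lintegral_const_mul _ (by exact (by fun_prop : Continuous (fun x => g (x - s • z))).enorm.measurable)]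
          rw [lintegral_sub_right_eq_self (fun x => ‖g x‖ₑ)]
      _ = A * D := lintegral_mul_const _ hG.enorm.measurable
  have h2 : ∫ x, |U g s x| = (∫⁻ x, ‖U g s x‖ₑ).toReal := by
    rw [← integral_norm_eq_lintegral_enorm (U_cont H s).aestronglyMeasurable]; rfl
  rw [h2]
  exact ENNReal.toReal_mono (ENNReal.mul_ne_top hA hD) h1

lemma U_grad_sup {g : Euc d → ℝ} (H : Tst g) (i : Fin d) :
    ∃ C, 0 ≤ C ∧ ∀ s, 0 < s → ∀ x, |U (pd i g) s x| ≤ C / s := by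
  obtain ⟨C, hC0, hC⟩ := H.bdd
  set I := ∫ z : Euc d, (1 + ‖z‖) ^ 1 * G z
  have hI : 0 ≤ I := integral_nonneg fun z => by have := G_pos z; simp only [Pi.zero_apply]; positivity
  refine ⟨C * I, by positivity, fun s hs x => ?_⟩
  have h1 := gauss_ibp H s i x
  have h2 : |∫ z, (z i * G z) * g (x - s • z)| ≤ ∫ z : Euc d, C * ((1 + ‖z‖) ^ 1 * G z) := by
    rw [← Real.norm_eq_abs]; refine norm_integral_le_of_norm_le ((int_G 1).const_mul _) (Eventually.of_forall fun z => ?_)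
    have := (G_pos z).le
    rw [norm_mul, norm_mul, Real.norm_of_nonneg this, pow_one, mul_comm C]
    have : ‖z i‖ ≤ 1 + ‖z‖ := (PiLp.norm_apply_le z i).trans (by linarith)
    gcongr
    exact hC _
  rw [h1, abs_mul, integral_const_mul, abs_neg, abs_of_pos (by positivity : 0 < 2 * s)] at h2
  rw [le_div_iff₀ hs]
  have := mul_nonneg hs.le (abs_nonneg (U (pd i g) s x))
  linarith

lemma bell_est {c : ℝ} (hc : 0 < c) {B : ℝ × ℝ → ℝ} (hB : ContDiff ℝ 2 B)
    (hess : ∀ z h, c * |h.1| * |h.2| ≤ fderiv ℝ (fderiv ℝ B) z h h) (hmin : ∀ z, B 0 ≤ B z)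
    {φ g : Euc d → ℝ} (H : Tst φ) (Hg : Tst g) (i j : Fin d) :
    |∫ x, pd i (pd j φ) x * g x| ≤ (2 / c) * ∫ x, (B (lap φ x, g x) - B 0) := by
  have main : ∀ σ : ℝ, |σ| = 1 → -(σ * ∫ x, pd i (pd j φ) x * g x) ≤ (2 / c) * ∫ x, (B (lap φ x, g x) - B 0) := by
    intro σ hσ
    set Φ : ℝ → ℝ := fun s => (2 / c) * (∫ x, (B (W (lap φ) g s x) - B 0)) + σ * ∫ x, U (pd i (pd j φ)) s x * U g s x
    have hd : ∀ s, HasDerivAt Φ ((2 / c) * (-(2 * s) * ∑ k, ∫ x, fderiv ℝ (fderiv ℝ B) (W (lap φ) g s x) (W (pd k (lap φ)) (pd k g) s x)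
        (W (pd k (lap φ)) (pd k g) s x)) + σ * (-(4 * s) * ∫ x, U (pd j (lap φ)) s x * U (pd i g) s x)) s :=
      fun s => ((B_deriv hB H.lap Hg s).const_mul _).add ((Q_deriv H Hg i j s).const_mul _)
    have anti : AntitoneOn Φ (Set.Ici 0) := by
      refine antitoneOn_of_deriv_nonpos (convex_Ici 0) (fun s _ => (hd s).continuousAt.continuousWithinAt)
        (fun s _ => (hd s).differentiableAt.differentiableWithinAt) fun s hs => ?_
      rw [interior_Ici] at hs
      have hs0 : 0 < s := hs
      rw [(hd s).deriv]
      have I := fun k => (B_ibp hB H.lap Hg s k).1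
      have Iq : Integrable (fun x => U (pd j (lap φ)) s x * U (pd i g) s x) :=
        ((U_dec (Hg.pd i) s).mul (U_dec (H.lap.pd j) s)).int
      have hge : c * |∫ x, U (pd j (lap φ)) s x * U (pd i g) s x| ≤
          ∑ k, ∫ x, fderiv ℝ (fderiv ℝ B) (W (lap φ) g s x) (W (pd k (lap φ)) (pd k g) s x)
        (W (pd k (lap φ)) (pd k g) s x) := by
        calc _ ≤ c * ∫ x, |U (pd j (lap φ)) s x * U (pd i g) s x| := by
              gcongr; exact abs_integral_le_integral_abs
          _ = ∫ x, c * |U (pd j (lap φ)) s x * U (pd i g) s x| := by rw [integral_const_mul]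
          _ ≤ ∫ x, ∑ k, fderiv ℝ (fderiv ℝ B) (W (lap φ) g s x) (W (pd k (lap φ)) (pd k g) s x)
                (W (pd k (lap φ)) (pd k g) s x) := by
              refine integral_mono (Iq.abs.const_mul c) (integrable_finsetSum _ fun k _ => I k) fun x => ?_
              simp only [abs_mul]
              exact vec_ineq hc (hess _) (fun k => U (pd k (lap φ)) s x) (fun k => U (pd k g) s x) j i
          _ = _ := integral_finsetSum _ fun k _ => I k
      set q := ∫ x, U (pd j (lap φ)) s x * U (pd i g) s x
      set T := ∑ k, ∫ x, fderiv ℝ (fderiv ℝ B) (W (lap φ) g s x) (W (pd k (lap φ)) (pd k g) s x)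
        (W (pd k (lap φ)) (pd k g) s x)
      have h1 : |q| ≤ T / c := by rw [le_div_iff₀ hc]; linarith
      have h2 : -(σ * q) ≤ |q| := by
        have := neg_abs_le (σ * q); rw [abs_mul, hσ, one_mul] at this; linarith
      have e : (2 / c) * (-(2 * s) * T) + σ * (-(4 * s) * q) = (4 * s) * (-(σ * q) - T / c) := by ring
      rw [e]
      exact mul_nonpos_of_nonneg_of_nonpos (by positivity) (by linarith)
    obtain ⟨C1, hC10, hC1⟩ := U_L1 Hg
    obtain ⟨C2, hC20, hC2⟩ := U_grad_sup (H.pd j) i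
    have lim : ∀ s, 0 < s → -(C2 / s * C1) ≤ Φ 0 := by
      intro s hs
      refine le_trans ?_ (anti (Set.mem_Ici.2 le_rfl) (Set.mem_Ici.2 hs.le) hs.le)
      have p1 : 0 ≤ (2 / c) * (∫ x, (B (W (lap φ) g s x) - B 0)) :=
        mul_nonneg (by positivity) (integral_nonneg fun x => sub_nonneg.2 (hmin _))
      have p2 : |∫ x, U (pd i (pd j φ)) s x * U g s x| ≤ C2 / s * C1 := by
        calc _ ≤ ∫ x, C2 / s * |U g s x| := by
              rw [← Real.norm_eq_abs]; refine norm_integral_le_of_norm_le ((U_dec Hg s).int.abs.const_mul _) (Eventually.of_forall fun x => ?_)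
              rw [norm_mul]
              exact mul_le_mul_of_nonneg_right (hC2 s hs x) (abs_nonneg _)
          _ = C2 / s * ∫ x, |U g s x| := integral_const_mul _ _
          _ ≤ _ := by gcongr; exact hC1 s
      have p3 := neg_abs_le (σ * ∫ x, U (pd i (pd j φ)) s x * U g s x)
      rw [abs_mul, hσ, one_mul] at p3
      simp only [Φ]; linarith
    have lim2 : 0 ≤ Φ 0 := by
      have t : Tendsto (fun s : ℝ => -(C2 / s * C1)) atTop (𝓝 (-(0 * C1))) :=
        ((tendsto_const_nhds.div_atTop tendsto_id).mul_const _).neg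
      simp only [zero_mul, neg_zero] at t
      exact le_of_tendsto t ((eventually_gt_atTop 0).mono fun s hs => lim s hs)
    have e : Φ 0 = (2 / c) * (∫ x, (B (lap φ x, g x) - B 0)) + σ * ∫ x, pd i (pd j φ) x * g x := by
      simp only [Φ, W, U_zero]
    linarith
  rw [abs_le]
  have m1 := main 1 (by simp)
  have m2 := main (-1) (by simp)
  constructor <;> linarith

end Heat

namespace Heat
variable {d : ℕ}

lemma sq_rpow_half (x p : ℝ) : (x ^ 2) ^ (p / 2) = |x| ^ p := by
  rw [← sq_abs, ← Real.rpow_natCast, ← Real.rpow_mul (abs_nonneg x)]; congr 1; push_cast; ring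

/-- continuity in the parameter for a compact domain -/
lemma par_lim {K : Set (Euc d)} (hK : IsCompact K) {F : ℝ → Euc d → ℝ}
    (hF : Continuous fun q : ℝ × Euc d => F q.1 q.2) :
    Tendsto (fun ε => ∫ x in K, F ε x) (𝓝[>] 0) (𝓝 (∫ x in K, F 0 x)) :=
  ((continuous_parametric_integral_of_continuous (f := F) hF hK).tendsto 0).mono_left nhdsWithin_le_nhds

lemma est1 {p q : ℝ} (hpq : p.HolderConjugate q) : ∃ K, 0 < K ∧ ∀ (d : ℕ) (φ g : Euc d → ℝ), Tst φ → Tst g → ∀ i j,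
    |∫ x, pd i (pd j φ) x * g x| ≤ K * ((∫ x, |lap φ x| ^ p) + ∫ x, |g x| ^ q) := by
  obtain ⟨c, hc, H⟩ := Bell.bellman p q hpq
  have hp := hpq.pos
  have hq := hpq.symm.pos
  refine ⟨4 / c, by positivity, fun d φ g hφ hg i j => ?_⟩
  set K0 := tsupport (lap φ) ∪ tsupport g
  have hK : IsCompact K0 := hφ.lap.2.isCompact.union hg.2.isCompact
  have cl := hφ.lap.cont
  have cg := hg.cont
  have z1 : ∀ x, x ∉ K0 → lap φ x = 0 := fun x hx => image_eq_zero_of_notMem_tsupport fun h => hx (Or.inl h)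
  have z2 : ∀ x, x ∉ K0 → g x = 0 := fun x hx => image_eq_zero_of_notMem_tsupport fun h => hx (Or.inr h)
  set F : ℝ → Euc d → ℝ := fun ε x => 2 * (((lap φ x) ^ 2 + ε ^ 2) ^ (p / 2) + ((g x) ^ 2 + ε ^ 2) ^ (q / 2))
  have hF : Continuous fun r : ℝ × Euc d => F r.1 r.2 := by
    have a1 : Continuous fun r : ℝ × Euc d => ((lap φ r.2) ^ 2 + r.1 ^ 2) ^ (p / 2) :=
      Continuous.rpow_const (by fun_prop) fun _ => Or.inr (by positivity)
    have a2 : Continuous fun r : ℝ × Euc d => ((g r.2) ^ 2 + r.1 ^ 2) ^ (q / 2) :=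
      Continuous.rpow_const (by fun_prop) fun _ => Or.inr (by positivity)
    exact (a1.add a2).const_smul (2:ℝ)
  have key : ∀ ε > 0, |∫ x, pd i (pd j φ) x * g x| ≤ (2 / c) * ∫ x in K0, F ε x := by
    intro ε hε
    obtain ⟨B, hB, hess, hmin, h0, hup⟩ := H ε hε
    refine (bell_est hc hB hess hmin hφ hg i j).trans ?_
    gcongr
    have cB := hB.continuous
    have e : ∫ x, (B (lap φ x, g x) - B 0) = ∫ x in K0, (B (lap φ x, g x) - B 0) := by
      refine (setIntegral_eq_integral_of_forall_compl_eq_zero fun x hx => ?_).symm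
      rw [z1 x hx, z2 x hx]; exact sub_self _
    rw [e]
    refine setIntegral_mono_on ?_ ?_ hK.measurableSet fun x _ => ?_
    · exact (by fun_prop : Continuous fun x => (B (lap φ x, g x) - B 0)).continuousOn.integrableOn_compact hK
    · exact (hF.comp (continuous_const.prodMk continuous_id)).continuousOn.integrableOn_compact hK
    · have := hup (lap φ x, g x); simp only [F]; linarith
  have L := ge_of_tendsto ((par_lim hK hF).const_mul (2 / c)) (eventually_nhdsWithin_of_forall key)
  refine L.trans (le_of_eq ?_)
  have e0 : ∀ x, F 0 x = 2 * (|lap φ x| ^ p + |g x| ^ q) := fun x => by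
    simp only [F]; rw [← sq_rpow_half, ← sq_rpow_half]; simp
  simp only [e0]
  rw [integral_const_mul, integral_add]
  · rw [setIntegral_eq_integral_of_forall_compl_eq_zero fun x hx => ?_, setIntegral_eq_integral_of_forall_compl_eq_zero fun x hx => ?_]
    · ring
    · rw [z2 x hx, abs_zero, Real.zero_rpow hq.ne']
    · rw [z1 x hx, abs_zero, Real.zero_rpow hp.ne']
  · exact (cl.abs.rpow_const fun _ => Or.inr hp.le).continuousOn.integrableOn_compact hK
  · exact (cg.abs.rpow_const fun _ => Or.inr hq.le).continuousOn.integrableOn_compact hK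

lemma pt1 {w κ α β : ℝ} (hκ : 0 < κ) (hb1 : β ≤ 1) :
    (w ^ 2 + κ ^ 2) ^ α - (κ ^ 2) ^ β * (w ^ 2 + κ ^ 2) ^ (α - β) ≤ w * (w * (w ^ 2 + κ ^ 2) ^ (α - 1)) := by
  set t := w ^ 2 + κ ^ 2
  have ht : 0 < t := by positivity
  have e : t ^ α = t * t ^ (α - 1) := by
    rw [Real.rpow_sub_one ht.ne']; field_simp
  have h1 : κ ^ 2 ≤ (κ ^ 2) ^ β * t ^ (1 - β) := by
    calc κ ^ 2 = (κ ^ 2) ^ β * (κ ^ 2) ^ (1 - β) := by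
          rw [← Real.rpow_add (by positivity)]; simp
      _ ≤ _ := by
          have : κ ^ 2 ≤ t := by simp only [t]; nlinarith [sq_nonneg w]
          gcongr
  have h2 : κ ^ 2 * t ^ (α - 1) ≤ (κ ^ 2) ^ β * t ^ (α - β) := by
    calc _ ≤ ((κ ^ 2) ^ β * t ^ (1 - β)) * t ^ (α - 1) := by gcongr
      _ = _ := by rw [mul_assoc, ← Real.rpow_add ht]; congr 2; ring
  have : w * (w * t ^ (α - 1)) = t * t ^ (α - 1) - κ ^ 2 * t ^ (α - 1) := by simp only [t]; ring
  rw [this, e]; linarith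

lemma pt2 {p q : ℝ} (hpq : p.HolderConjugate q) {w κ μ : ℝ} (hκ : 0 < κ) (hμ : 0 < μ) :
    |μ * (w * (w ^ 2 + κ ^ 2) ^ (p / 2 - 1))| ^ q ≤ μ ^ q * (w ^ 2 + κ ^ 2) ^ (p / 2) := by
  set t := w ^ 2 + κ ^ 2
  have ht : 0 < t := by positivity
  have hq := hpq.symm.pos
  have h1 : |w| ≤ t ^ ((1:ℝ) / 2) := by
    rw [← Real.sqrt_eq_rpow]; apply Real.abs_le_sqrt; simp only [t]; nlinarith [sq_nonneg κ]
  rw [abs_mul, abs_mul, abs_of_pos hμ, abs_of_pos (Real.rpow_pos_of_pos ht _)]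
  calc _ ≤ (μ * (t ^ ((1:ℝ)/2) * t ^ (p / 2 - 1))) ^ q := by gcongr
    _ = _ := by
      rw [Real.mul_rpow hμ.le (by positivity), ← Real.rpow_add ht, ← Real.rpow_mul ht.le]
      congr 2
      have := hpq.sub_one_mul_conj
      nlinarith

theorem cz0 {p : ℝ} (hp : 1 < p) : ∃ C, 0 < C ∧ ∀ (d : ℕ) (φ : Euc d → ℝ), Tst φ → ∀ i j,
    ∫ x, |pd i (pd j φ) x| ^ p ≤ C * ∫ x, |lap φ x| ^ p := by
  have hpq := Real.HolderConjugate.conjExponent hp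
  set q := p.conjExponent
  have hp0 := hpq.pos
  have hq := hpq.symm.pos
  obtain ⟨K, hK0, H⟩ := est1 hpq
  have hq1 : 0 < q - 1 := by have := hpq.symm.lt; linarith
  set μ := (1 / (2 * K)) ^ (1 / (q - 1))
  have hμ : 0 < μ := by positivity
  have hμ2 : K * μ ^ q = μ / 2 := by
    have : μ ^ q = μ ^ (q - 1) * μ := by
      rw [Real.rpow_sub_one hμ.ne']; field_simp
    have e : μ ^ (q - 1) = 1 / (2 * K) := by
      rw [← Real.rpow_mul (by positivity)]; rw [one_div_mul_cancel hq1.ne', Real.rpow_one]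
    rw [this, e]; field_simp
  refine ⟨2 * K / μ, by positivity, fun d φ hφ i j => ?_⟩
  set w := pd i (pd j φ) with hw
  have Hw : Tst w := (hφ.pd j).pd i
  have cw := Hw.cont
  set K0 := tsupport w
  have hK : IsCompact K0 := Hw.2.isCompact
  have z : ∀ x, x ∉ K0 → w x = 0 := fun x hx => image_eq_zero_of_notMem_tsupport hx
  set A := ∫ x, |lap φ x| ^ p
  set β := min (p / 2) 1
  have hβ : 0 < β := lt_min (by positivity) one_pos
  have hβα : β ≤ p / 2 := min_le_left _ _
  have hb1 : β ≤ 1 := min_le_right _ _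
  set F1 : ℝ → Euc d → ℝ := fun κ x => (w x ^ 2 + κ ^ 2) ^ (p / 2) - (κ ^ 2) ^ β * (w x ^ 2 + κ ^ 2) ^ (p / 2 - β)
  set F2 : ℝ → Euc d → ℝ := fun κ x => (w x ^ 2 + κ ^ 2) ^ (p / 2)
  have c2 : Continuous fun r : ℝ × Euc d => F2 r.1 r.2 :=
      Continuous.rpow_const (by fun_prop) fun _ => Or.inr (by positivity)
  have c1 : Continuous fun r : ℝ × Euc d => F1 r.1 r.2 := by
    have a : Continuous fun r : ℝ × Euc d => (w r.2 ^ 2 + r.1 ^ 2) ^ (p / 2 - β) :=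
      Continuous.rpow_const (by fun_prop) fun _ => Or.inr (by linarith)
    have b : Continuous fun r : ℝ × Euc d => (r.1 ^ 2) ^ β :=
      Continuous.rpow_const (by fun_prop) fun _ => Or.inr hβ.le
    exact c2.sub (b.mul a)
  have key : ∀ κ > 0, μ * ∫ x in K0, F1 κ x ≤ K * (A + μ ^ q * ∫ x in K0, F2 κ x) := by
    intro κ hκ
    set g : Euc d → ℝ := fun x => μ * (w x * (w x ^ 2 + κ ^ 2) ^ (p / 2 - 1))
    have Hg : Tst g := by
      refine ⟨contDiff_const.mul (Hw.1.mul (ContDiff.rpow_const_of_ne ((Hw.1.pow 2).add contDiff_const) fun x => ?_)), ?_⟩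
      · positivity
      · exact Hw.2.mono' (by
          intro x hx
          refine subset_tsupport _ ?_
          intro h; apply hx; simp only [g]; rw [h]; simp)
    have zg : ∀ x, x ∉ K0 → g x = 0 := fun x hx => by simp only [g]; rw [z x hx]; simp
    have h := (le_abs_self _).trans (H d φ g hφ Hg i j)
    have cg := Hg.cont
    have s1 : ∫ x, w x * g x = ∫ x in K0, w x * g x :=
      (setIntegral_eq_integral_of_forall_compl_eq_zero fun x hx => by rw [z x hx, zero_mul]).symm
    have s2 : ∫ x, |g x| ^ q = ∫ x in K0, |g x| ^ q :=
      (setIntegral_eq_integral_of_forall_compl_eq_zero fun x hx => by rw [zg x hx, abs_zero, Real.zero_rpow hq.ne']).symm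
    have i1 : IntegrableOn (F1 κ) K0 := (c1.comp (continuous_const.prodMk continuous_id)).continuousOn.integrableOn_compact hK
    have i2 : IntegrableOn (F2 κ) K0 := (c2.comp (continuous_const.prodMk continuous_id)).continuousOn.integrableOn_compact hK
    have t1 : μ * ∫ x in K0, F1 κ x ≤ ∫ x in K0, w x * g x := by
      rw [← integral_const_mul]
      refine setIntegral_mono_on (i1.const_mul _) ((cw.mul cg).continuousOn.integrableOn_compact hK) hK.measurableSet fun x _ => ?_
      have := mul_le_mul_of_nonneg_left (pt1 (w := w x) (α := p / 2) hκ hb1) hμ.le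
      simp only [F1, g]; linarith
    have t2 : ∫ x in K0, |g x| ^ q ≤ μ ^ q * ∫ x in K0, F2 κ x := by
      rw [← integral_const_mul]
      refine setIntegral_mono_on ((cg.abs.rpow_const fun _ => Or.inr hq.le).continuousOn.integrableOn_compact hK) (i2.const_mul _)
         hK.measurableSet fun x _ => pt2 hpq hκ hμ
    rw [s1, s2] at h
    refine t1.trans (h.trans ?_)
    gcongr
  have L := le_of_tendsto_of_tendsto ((par_lim hK c1).const_mul μ) (((par_lim hK c2).const_mul (μ ^ q)).const_add A |>.const_mul K)
    (eventually_nhdsWithin_of_forall key)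
  have e1 : ∀ x, F1 0 x = |w x| ^ p := fun x => by
    simp only [F1]; rw [← sq_rpow_half]; simp [Real.zero_rpow hβ.ne']
  have e2 : ∀ x, F2 0 x = |w x| ^ p := fun x => by
    simp only [F2]; rw [← sq_rpow_half]; simp
  simp only [e1, e2] at L
  rw [setIntegral_eq_integral_of_forall_compl_eq_zero fun x hx => ?_] at L
  · set I := ∫ x, |w x| ^ p
    have : μ / 2 * I ≤ K * A := by
      have : K * (A + μ ^ q * I) = K * A + (K * μ ^ q) * I := by ring
      rw [this, hμ2] at L; linarith
    rw [div_mul_eq_mul_div, le_div_iff₀ hμ]; linarith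
  · rw [z x hx, abs_zero, Real.zero_rpow hp0.ne']

end Heat

namespace Ell
open Heat
variable {d : ℕ} {p : ℝ≥0∞} [hp1 : Fact (1 ≤ p)] [hp2 : Fact (p ≠ ⊤)]

lemma p_ne_zero (p : ℝ≥0∞) [hp1 : Fact (1 ≤ p)] : p ≠ 0 := (one_pos.trans_le hp1.out).ne'

lemma eLpNorm_rpow {X : Type*} [MeasurableSpace X] {μ : Measure X} (p : ℝ≥0∞) [hp1 : Fact (1 ≤ p)] [hp2 : Fact (p ≠ ⊤)]
    (f : X → ℝ) : eLpNorm f p μ ^ p.toReal = ∫⁻ x, ‖f x‖ₑ ^ p.toReal ∂μ := by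
  have h := p_ne_zero p
  rw [eLpNorm_eq_lintegral_rpow_enorm_toReal h hp2.out, ← ENNReal.rpow_mul, one_div,
    inv_mul_cancel₀ (ENNReal.toReal_pos h hp2.out).ne', ENNReal.rpow_one]

lemma avg {Z : Type*} [MeasurableSpace Z] {P : Measure Z} [IsProbabilityMeasure P] {G : Euc d → Z → ℝ}
    (hG : AEStronglyMeasurable (Function.uncurry G) (volume.prod P)) {A : ℝ≥0∞}
    (hA : ∀ᵐ z ∂P, eLpNorm (fun x => G x z) p volume ≤ A) :
    eLpNorm (fun x => ∫ z, G x z ∂P) p volume ≤ A := by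
  have hr : 0 < p.toReal := ENNReal.toReal_pos (p_ne_zero p) hp2.out
  rw [← ENNReal.rpow_le_rpow_iff hr, eLpNorm_rpow]
  calc ∫⁻ x, ‖∫ z, G x z ∂P‖ₑ ^ p.toReal ≤ ∫⁻ x, ∫⁻ z, ‖G x z‖ₑ ^ p.toReal ∂P := by
        refine lintegral_mono_ae ?_
        filter_upwards [hG.prodMk_left] with x hx
        rw [← eLpNorm_rpow]
        gcongr
        refine (enorm_integral_le_lintegral_enorm _).trans ?_
        rw [← eLpNorm_one_eq_lintegral_enorm]
        exact eLpNorm_le_eLpNorm_of_exponent_le hp1.out hx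
    _ = ∫⁻ z, ∫⁻ x, ‖G x z‖ₑ ^ p.toReal ∂volume ∂P := by
        apply lintegral_lintegral_swap
        exact hG.enorm.pow_const _
    _ ≤ ∫⁻ z, A ^ p.toReal ∂P := by
        refine lintegral_mono_ae (hA.mono fun z hz => ?_)
        rw [← eLpNorm_rpow]; gcongr
    _ = A ^ p.toReal := by simp

lemma trans_cont {g : Euc d → ℝ} (hg : MemLp g p volume) {ε : ℝ≥0∞} (hε : 0 < ε) :
    ∃ δ > 0, ∀ z : Euc d, ‖z‖ < δ → eLpNorm (fun x => g (x + z) - g x) p volume ≤ ε := by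
  set T : Euc d → C(Euc d, Euc d) := fun z => ⟨fun x => x + z, by fun_prop⟩
  have hT : Continuous T := ContinuousMap.continuous_of_continuous_uncurry _ (by
    show Continuous fun q : Euc d × Euc d => q.2 + q.1
    fun_prop)
  have hm : ∀ z, MeasurePreserving (T z) (volume : Measure (Euc d)) volume := fun z => measurePreserving_add_right _ z
  have := (Continuous.compMeasurePreservingLp (f := fun _ : Euc d => hg.toLp g) continuous_const hT hm hp2.out).tendsto 0
  rw [EMetric.tendsto_nhds] at this
  have := this ε hε
  rw [Metric.eventually_nhds_iff] at this
  obtain ⟨δ, hδ, H⟩ := this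
  refine ⟨δ, hδ, fun z hz => ?_⟩
  have h := (H (y := z) (by simpa using hz)).le
  rw [Lp.edist_def] at h
  refine le_trans (le_of_eq (eLpNorm_congr_ae ?_)) h
  have a1 : ∀ z, Lp.compMeasurePreserving (T z) (hm z) (hg.toLp g) =ᵐ[volume] fun x => g (x + z) := fun z =>
    (Lp.coeFn_compMeasurePreserving _ (hm z)).trans ((hm z).quasiMeasurePreserving.ae_eq_comp hg.coeFn_toLp)
  filter_upwards [a1 z, a1 0] with x h1 h2
  simp only [Pi.sub_apply]
  rw [h1, h2, add_zero]

/-! mollification -/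
noncomputable def bmp (d n : ℕ) : ContDiffBump (0 : Euc d) := ⟨1 / (2 * (n + 1)), 1 / (n + 1), by positivity, by
  have : (0:ℝ) < n + 1 := by positivity
  exact one_div_lt_one_div_of_lt this (by linarith)⟩

noncomputable def rho (d n : ℕ) : Euc d → ℝ := (bmp d n).normed volume

lemma rho_smooth (n : ℕ) : ContDiff ℝ (⊤ : ℕ∞) (rho d n) := (bmp d n).contDiff_normed
lemma rho_cpt (n : ℕ) : HasCompactSupport (rho d n) := (bmp d n).hasCompactSupport_normed
lemma rho_tst (n : ℕ) : Tst (rho d n) := ⟨rho_smooth n, rho_cpt n⟩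
lemma rho_nonneg (n : ℕ) (x : Euc d) : 0 ≤ rho d n x := (bmp d n).nonneg_normed x
lemma rho_supp (n : ℕ) : tsupport (rho d n) = Metric.closedBall 0 (1 / (n + 1)) := (bmp d n).tsupport_normed_eq
lemma rho_int (n : ℕ) : ∫ x, rho d n x = 1 := (bmp d n).integral_normed

noncomputable def mol (n : ℕ) (g : Euc d → ℝ) (x : Euc d) : ℝ := ∫ z, rho d n z * g (x - z)

lemma mol_eq (n : ℕ) (g : Euc d → ℝ) : mol n g = convolution (rho d n) g (ContinuousLinearMap.lsmul ℝ ℝ) volume := rfl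

lemma mol_smooth (n : ℕ) {g : Euc d → ℝ} (hg : LocallyIntegrable g volume) : ContDiff ℝ (⊤ : ℕ∞) (mol n g) :=
  (rho_cpt n).contDiff_convolution_left (ContinuousLinearMap.lsmul ℝ ℝ) (rho_smooth n) hg

lemma mol_cpt (n : ℕ) {g : Euc d → ℝ} (hg : HasCompactSupport g) : HasCompactSupport (mol n g) :=
  HasCompactSupport.convolution (ContinuousLinearMap.lsmul ℝ ℝ) (rho_cpt n) hg

lemma mol_pd0 (n : ℕ) {g : Euc d → ℝ} (hg : LocallyIntegrable g volume) (i : Fin d) (x : Euc d) :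
    pd i (mol n g) x = ∫ z, pd i (rho d n) z * g (x - z) := by
  have h := (rho_cpt n).hasFDerivAt_convolution_left (ContinuousLinearMap.lsmul ℝ ℝ) ((rho_smooth n).of_le (by simp)) hg x
  unfold pd
  rw [mol_eq, h.fderiv, convolution_def, ContinuousLinearMap.integral_apply]
  · rfl
  · exact ((rho_cpt n).fderiv (𝕜 := ℝ)).convolutionExists_left _ ((rho_smooth n).continuous_fderiv (by simp)) hg x

lemma mol_Lp {g : Euc d → ℝ} (hg : MemLp g p volume) :
    Tendsto (fun n => eLpNorm (fun x => mol n g x - g x) p volume) atTop (𝓝 0) := by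
  rw [ENNReal.tendsto_atTop_zero]
  intro ε hε
  obtain ⟨δ, hδ, H⟩ := trans_cont hg hε
  obtain ⟨N, hN⟩ := exists_nat_one_div_lt hδ
  refine ⟨N, fun n hn => ?_⟩
  set P : Measure (Euc d) := volume.withDensity fun z => ENNReal.ofReal (rho d n z)
  have hrm : Measurable fun z => (rho d n z).toNNReal := (rho_smooth n).continuous.measurable.real_toNNReal
  have hP : IsProbabilityMeasure P := by
    constructor
    rw [withDensity_apply _ MeasurableSet.univ, Measure.restrict_univ, ← ofReal_integral_eq_lintegral_ofReal, rho_int, ENNReal.ofReal_one]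
    · exact (rho_tst n).integrable
    · exact Eventually.of_forall (rho_nonneg n)
  have hPi : ∀ f : Euc d → ℝ, ∫ z, f z ∂P = ∫ z, rho d n z * f z := fun f => by
    have := integral_withDensity_eq_integral_smul hrm f (μ := volume)
    refine this.trans (integral_congr_ae (Eventually.of_forall fun z => ?_))
    simp only [NNReal.smul_def, Real.coe_toNNReal _ (rho_nonneg n z), smul_eq_mul]
  have hloc : LocallyIntegrable g volume := hg.locallyIntegrable hp1.out
  have e : (fun x => mol n g x - g x) =ᵐ[volume] fun x => ∫ z, (g (x - z) - g x) ∂P := by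
    refine Eventually.of_forall fun x => ?_
    simp only
    rw [hPi]
    simp only [mul_sub]
    rw [integral_sub, integral_mul_const, rho_int, one_mul]; rfl
    · exact (rho_cpt n).convolutionExists_left (ContinuousLinearMap.lsmul ℝ ℝ) (rho_smooth n).continuous hloc x
    · exact (rho_tst n).integrable.mul_const _
  rw [eLpNorm_congr_ae e]
  have hac : P ≪ volume := withDensity_absolutelyContinuous _ _
  refine avg ?_ ?_
  · have m1 : AEStronglyMeasurable (fun q : Euc d × Euc d => g (q.1 - q.2)) ((volume : Measure (Euc d)).prod volume) :=
      hg.1.comp_quasiMeasurePreserving (quasiMeasurePreserving_sub_of_right_invariant volume volume)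
    have m2 : AEStronglyMeasurable (fun q : Euc d × Euc d => g q.1) ((volume : Measure (Euc d)).prod volume) := hg.1.comp_fst
    exact (m1.sub m2).mono_ac (Measure.AbsolutelyContinuous.rfl.prod hac)
  · have hz : ∀ᵐ z ∂P, rho d n z ≠ 0 := by
      rw [ae_iff]
      have hm : MeasurableSet {a | ¬ rho d n a ≠ 0} := by
        simp only [not_not, ne_eq]
        exact (isClosed_eq (rho_smooth n).continuous continuous_const).measurableSet
      rw [withDensity_apply _ hm, setLIntegral_eq_zero_iff hm (rho_smooth n).continuous.measurable.ennreal_ofReal]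
      refine Eventually.of_forall fun z hz => ?_
      simp only [not_not, Set.mem_setOf_eq, ne_eq] at hz
      simp [hz]
    filter_upwards [hz] with z hz
    have hz2 : z ∈ tsupport (rho d n) := subset_tsupport _ hz
    rw [rho_supp, mem_closedBall_zero_iff] at hz2
    have : (1:ℝ) / (n + 1) ≤ 1 / (N + 1) := by gcongr
    have := H (-z) (by rw [norm_neg]; linarith)
    simpa [sub_eq_add_neg] using this

end Ell

namespace Ell
open Heat
variable {d : ℕ} {p : ℝ≥0∞} [hp1 : Fact (1 ≤ p)] [hp2 : Fact (p ≠ ⊤)]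

def WD (Ω : Set (Euc d)) (i : Fin d) (u v : Euc d → ℝ) : Prop :=
  ∀ φ, IsTestFun Ω φ → ∫ x, u x * pd i φ x = -∫ x, v x * φ x

/-- `C^1` test functions -/
def T1 (Ω : Set (Euc d)) (φ : Euc d → ℝ) : Prop :=
  ContDiff ℝ 1 φ ∧ HasCompactSupport φ ∧ tsupport φ ⊆ Ω

/-- continuous test functions -/
def T0 (Ω : Set (Euc d)) (φ : Euc d → ℝ) : Prop :=
  Continuous φ ∧ HasCompactSupport φ ∧ tsupport φ ⊆ Ω

lemma T1.t0 {Ω : Set (Euc d)} {φ : Euc d → ℝ} (h : T1 Ω φ) : T0 Ω φ := ⟨h.1.continuous, h.2⟩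

lemma pd_cont {φ : Euc d → ℝ} (h : ContDiff ℝ 1 φ) (i : Fin d) : Continuous (pd i φ) :=
  (h.continuous_fderiv (by simp)).clm_apply continuous_const

lemma pd_tsupport (φ : Euc d → ℝ) (i : Fin d) : tsupport (pd i φ) ⊆ tsupport φ := by
  refine closure_minimal ?_ (isClosed_tsupport _)
  intro x hx
  refine support_fderiv_subset ℝ fun h => hx ?_
  unfold pd; rw [h]; rfl

lemma T1.pd {Ω : Set (Euc d)} {φ : Euc d → ℝ} (h : T1 Ω φ) (i : Fin d) : T0 Ω (pd i φ) :=
  ⟨pd_cont h.1 i, h.2.1.mono' ((subset_tsupport _).trans (pd_tsupport φ i)), (pd_tsupport φ i).trans h.2.2⟩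

lemma test_t1 {Ω : Set (Euc d)} {φ : Euc d → ℝ} (h : IsTestFun Ω φ) : T1 Ω φ :=
  ⟨h.1.of_le (by exact WithTop.coe_le_coe.2 (le_top : (1:ℕ∞) ≤ ⊤)), h.2⟩

lemma test_pd {Ω : Set (Euc d)} {φ : Euc d → ℝ} (h : IsTestFun Ω φ) (i : Fin d) : IsTestFun Ω (pd i φ) :=
  ⟨(Tst.pd (h := φ) ⟨h.1, h.2.1⟩ i).1, ((test_t1 h).pd i).2⟩

lemma test_mono {Ω Ω' : Set (Euc d)} (h : Ω ⊆ Ω') {φ : Euc d → ℝ} (H : IsTestFun Ω φ) : IsTestFun Ω' φ :=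
  ⟨H.1, H.2.1, H.2.2.trans h⟩

lemma T0.zero {Ω : Set (Euc d)} {φ : Euc d → ℝ} (h : T0 Ω φ) {x : Euc d} (hx : x ∉ Ω) : φ x = 0 :=
  image_eq_zero_of_notMem_tsupport fun h' => hx (h.2.2 h')

lemma T0.mul_left {Ω : Set (Euc d)} {φ : Euc d → ℝ} (h : T0 Ω φ) {a : Euc d → ℝ} (ha : Continuous a) :
    T0 Ω (fun x => a x * φ x) :=
  ⟨ha.mul h.1, h.2.1.mul_left, (tsupport_mul_subset_right (f := a) (g := φ)).trans h.2.2⟩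

lemma T1.mul_left {Ω : Set (Euc d)} {φ : Euc d → ℝ} (h : T1 Ω φ) {a : Euc d → ℝ} (ha : ContDiff ℝ 1 a) :
    T1 Ω (fun x => a x * φ x) :=
  ⟨ha.mul h.1, h.2.1.mul_left, (tsupport_mul_subset_right (f := a) (g := φ)).trans h.2.2⟩

lemma set_int {S : Set (Euc d)} {φ : Euc d → ℝ} (h : T0 S φ) (u : Euc d → ℝ) :
    ∫ x in S, u x * φ x = ∫ x, u x * φ x :=
  setIntegral_eq_integral_of_forall_compl_eq_zero fun x hx => by rw [h.zero hx, mul_zero]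

lemma int_pair {S : Set (Euc d)} (hS : MeasurableSet S) {φ u : Euc d → ℝ} (h : T0 S φ)
    (hu : MemLp u p (volume.restrict S)) : Integrable (fun x => u x * φ x) := by
  haveI : p.HolderConjugate p.conjExponent := ENNReal.HolderConjugate.conjExponent hp1.out
  have h2 : MemLp φ p.conjExponent (volume.restrict S) := (h.1.memLp_of_hasCompactSupport h.2.1).restrict S
  have h3 : IntegrableOn (u * φ) S := hu.integrable_mul h2
  refine (integrableOn_iff_integrable_of_support_subset ?_).1 h3
  intro x hx
  by_contra hxs
  exact hx (by simp only [Pi.mul_apply]; rw [h.zero hxs, mul_zero])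

lemma pair_lim {S : Set (Euc d)} (hS : MeasurableSet S) {φ u : Euc d → ℝ} {w : ℕ → Euc d → ℝ} (h : T0 S φ)
    (hu : MemLp u p (volume.restrict S)) (hw : ∀ n, MemLp (w n) p (volume.restrict S))
    (hl : Tendsto (fun n => eLpNorm (fun x => w n x - u x) p (volume.restrict S)) atTop (𝓝 0)) :
    Tendsto (fun n => ∫ x, w n x * φ x) atTop (𝓝 (∫ x, u x * φ x)) := by
  haveI : p.HolderConjugate p.conjExponent := ENNReal.HolderConjugate.conjExponent hp1.out
  have h2 : MemLp φ p.conjExponent (volume.restrict S) := (h.1.memLp_of_hasCompactSupport h.2.1).restrict S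
  simp only [← set_int h]
  refine tendsto_integral_of_L1' _ ((int_pair hS h hu).1.mono_measure Measure.restrict_le_self)
    (Eventually.of_forall fun n => (int_pair hS h (hw n)).integrableOn) ?_
  have b : Tendsto (fun n => eLpNorm (fun x => w n x - u x) p (volume.restrict S) *
      eLpNorm φ p.conjExponent (volume.restrict S)) atTop (𝓝 0) := by
    have := ENNReal.Tendsto.mul_const hl (Or.inr h2.2.ne)
    rwa [zero_mul] at this
  refine tendsto_of_tendsto_of_tendsto_of_le_of_le tendsto_const_nhds b (fun _ => zero_le) fun n => ?_
  have := eLpNorm_smul_le_mul_eLpNorm (r := 1) h2.1 ((hw n).sub hu).1 (p := p) (q := p.conjExponent)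
  refine le_trans (le_of_eq ?_) this
  congr 1; funext x; simp [sub_mul]

lemma ind_memLp {Ω : Set (Euc d)} (hΩ : IsOpen Ω) {u : Euc d → ℝ} (hu : MemLp u p (volume.restrict Ω)) :
    MemLp (Ω.indicator u) p volume := (memLp_indicator_iff_restrict hΩ.measurableSet).2 hu

lemma mol_pd {Ω : Set (Euc d)} (hΩ : IsOpen Ω) {u v : Euc d → ℝ} {i : Fin d} (hu : MemLp u p (volume.restrict Ω))
    (hW : WD Ω i u v) {n : ℕ} {x : Euc d} (hx : Metric.closedBall x (1 / (n + 1)) ⊆ Ω) :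
    pd i (mol n (Ω.indicator u)) x = mol n (Ω.indicator v) x := by
  rw [mol_pd0 n ((ind_memLp hΩ hu).locallyIntegrable hp1.out)]
  set φ : Euc d → ℝ := fun y => rho d n (x - y)
  have hsm : ContDiff ℝ (⊤ : ℕ∞) φ := (rho_smooth n).comp (contDiff_const.sub contDiff_id)
  have hz : ∀ y, y ∉ Metric.closedBall x (1 / ((n:ℝ) + 1)) → x - y ∉ tsupport (rho d n) := by
    intro y hy h
    rw [rho_supp, mem_closedBall_zero_iff] at h
    exact hy (by rw [Metric.mem_closedBall, dist_comm, dist_eq_norm]; exact h)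
  have hts : tsupport φ ⊆ Metric.closedBall x (1 / ((n:ℝ) + 1)) := by
    refine closure_minimal ?_ Metric.isClosed_closedBall
    intro y hy
    by_contra hc
    exact hy (image_eq_zero_of_notMem_tsupport (f := rho d n) (hz y hc))
  have hφ : IsTestFun Ω φ := ⟨hsm, HasCompactSupport.of_support_subset_isCompact (isCompact_closedBall x _)
    ((subset_tsupport _).trans hts), hts.trans hx⟩
  have hpd : ∀ y, pd i φ y = - pd i (rho d n) (x - y) := by
    intro y
    have h1 : HasFDerivAt (fun y : Euc d => x - y) (-ContinuousLinearMap.id ℝ (Euc d)) y := (hasFDerivAt_id y).const_sub x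
    have h2 := (((rho_tst n).diff (x - y)).hasFDerivAt.comp y h1).fderiv
    unfold pd
    show fderiv ℝ (rho d n ∘ fun y => x - y) y _ = _
    rw [h2]; simp
  have key := hW φ hφ
  have c1 : ∀ (a b : Euc d → ℝ), (∀ y, y ∉ tsupport (rho d n) → a y = 0) →
      ∫ z, a z * Ω.indicator b (x - z) = ∫ y, b y * a (x - y) := by
    intro a b ha
    rw [← integral_sub_left_eq_self (fun z => a z * Ω.indicator b (x - z)) volume x]
    refine integral_congr_ae (Eventually.of_forall fun y => ?_)
    simp only [sub_sub_cancel]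
    by_cases hy : y ∈ Ω
    · rw [Set.indicator_of_mem hy, mul_comm]
    · rw [ha _ (hz y fun h => hy (hx h))]; simp
  rw [c1 _ _ fun y hy => image_eq_zero_of_notMem_tsupport fun h => hy (pd_tsupport _ _ h)]
  unfold mol
  rw [c1 _ _ fun y hy => image_eq_zero_of_notMem_tsupport hy]
  simp only [hpd, mul_neg, integral_neg, neg_inj] at key
  exact key

/-- interior approximation -/
lemma approx {Ω : Set (Euc d)} (hΩ : IsOpen Ω) {u : Euc d → ℝ} (hu : MemLp u p (volume.restrict Ω))
    {K : Set (Euc d)} (hKm : MeasurableSet K) {δ : ℝ} (hδ : 0 < δ) (hK : ∀ x ∈ K, Metric.ball x δ ⊆ Ω) :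
    (Tendsto (fun n => eLpNorm (fun x => mol n (Ω.indicator u) x - u x) p (volume.restrict K)) atTop (𝓝 0)) ∧
    ∀ i v, MemLp v p (volume.restrict Ω) → WD Ω i u v →
      Tendsto (fun n => eLpNorm (fun x => pd i (mol n (Ω.indicator u)) x - v x) p (volume.restrict K)) atTop (𝓝 0) := by
  have hKΩ : ∀ x ∈ K, x ∈ Ω := fun x hx => hK x hx (Metric.mem_ball_self hδ)
  have gen : ∀ v, MemLp v p (volume.restrict Ω) → ∀ (w : ℕ → Euc d → ℝ), (∀ᶠ n in atTop, ∀ x ∈ K, w n x = mol n (Ω.indicator v) x) →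
      Tendsto (fun n => eLpNorm (fun x => w n x - v x) p (volume.restrict K)) atTop (𝓝 0) := by
    intro v hv w hw
    refine tendsto_of_tendsto_of_tendsto_of_le_of_le' tendsto_const_nhds (mol_Lp (ind_memLp hΩ hv)) (Eventually.of_forall fun _ => zero_le) ?_
    filter_upwards [hw] with n hn
    refine le_trans (le_of_eq (eLpNorm_congr_ae ?_)) (eLpNorm_mono_measure _ Measure.restrict_le_self)
    filter_upwards [ae_restrict_mem hKm] with x hx
    rw [hn x hx, Set.indicator_of_mem (hKΩ x hx)]
  refine ⟨gen u hu _ (Eventually.of_forall fun n x _ => rfl), fun i v hv hW => gen v hv _ ?_⟩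
  obtain ⟨N, hN⟩ := exists_nat_one_div_lt hδ
  filter_upwards [eventually_ge_atTop N] with n hn x hx
  refine mol_pd hΩ hu hW ((Metric.closedBall_subset_ball ?_).trans (hK x hx))
  have : (1:ℝ) / (n + 1) ≤ 1 / (N + 1) := by gcongr
  linarith

lemma exists_delta {Ω K : Set (Euc d)} (hΩ : IsOpen Ω) (hK : IsCompact K) (h : K ⊆ Ω) :
    ∃ δ > 0, ∀ x ∈ K, Metric.ball x δ ⊆ Ω := by
  obtain ⟨δ, hδ, H⟩ := hK.exists_thickening_subset_open hΩ h
  exact ⟨δ, hδ, fun x hx => (Metric.ball_subset_thickening hx δ).trans H⟩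

lemma mol_smooth' {Ω : Set (Euc d)} (hΩ : IsOpen Ω) {u : Euc d → ℝ} (hu : MemLp u p (volume.restrict Ω)) (n : ℕ) :
    ContDiff ℝ (⊤ : ℕ∞) (mol n (Ω.indicator u)) := mol_smooth n ((ind_memLp hΩ hu).locallyIntegrable hp1.out)

lemma c1_ibp {Ω : Set (Euc d)} {w φ : Euc d → ℝ} (hw : ContDiff ℝ 1 w) (hφ : T1 Ω φ) (i : Fin d) :
    ∫ x, w x * pd i φ x = -∫ x, pd i w x * φ x := by
  refine integral_mul_fderiv_eq_neg_fderiv_mul_of_integrable ?_ ?_ ?_ (fun x _ => hw.differentiable (by simp) x)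
    (fun x _ => hφ.1.differentiable (by simp) x)
  · exact ((pd_cont hw i).mul hφ.1.continuous).integrable_of_hasCompactSupport hφ.2.1.mul_left
  · exact (hw.continuous.mul (hφ.pd i).1).integrable_of_hasCompactSupport (hφ.pd i).2.1.mul_left
  · exact (hw.continuous.mul hφ.1.continuous).integrable_of_hasCompactSupport hφ.2.1.mul_left

lemma cont_memLp {K : Set (Euc d)} (hK : IsCompact K) {w : Euc d → ℝ} (hw : Continuous w) :
    MemLp w p (volume.restrict K) := by
  haveI : IsFiniteMeasure (volume.restrict K) := ⟨by rw [Measure.restrict_apply_univ]; exact hK.measure_lt_top⟩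
  obtain ⟨C, hC⟩ := hK.exists_bound_of_continuousOn hw.continuousOn
  refine MemLp.of_bound hw.aestronglyMeasurable C ?_
  filter_upwards [ae_restrict_mem hK.measurableSet] with x hx using hC x hx

lemma WD_of_approx {Ω : Set (Euc d)} {u v : Euc d → ℝ} {i : Fin d} (hu : MemLp u p (volume.restrict Ω))
    (hv : MemLp v p (volume.restrict Ω))
    (H : ∀ K ⊆ Ω, IsCompact K → ∃ w : ℕ → Euc d → ℝ, (∀ n, ContDiff ℝ 1 (w n)) ∧
      Tendsto (fun n => eLpNorm (fun x => w n x - u x) p (volume.restrict K)) atTop (𝓝 0) ∧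
      Tendsto (fun n => eLpNorm (fun x => pd i (w n) x - v x) p (volume.restrict K)) atTop (𝓝 0))
    {φ : Euc d → ℝ} (hφ : T1 Ω φ) : ∫ x, u x * pd i φ x = -∫ x, v x * φ x := by
  set K := tsupport φ
  have hK : IsCompact K := hφ.2.1
  obtain ⟨w, hw, h1, h2⟩ := H K hφ.2.2 hK
  have hφ' : T1 K φ := ⟨hφ.1, hφ.2.1, le_rfl⟩
  have hr : volume.restrict K ≤ volume.restrict Ω := Measure.restrict_mono hφ.2.2 le_rfl
  have l1 := pair_lim hK.measurableSet (hφ'.pd i) (hu.mono_measure hr) (fun n => cont_memLp hK (hw n).continuous) h1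
  have l2 := (pair_lim hK.measurableSet hφ'.t0 (hv.mono_measure hr) (fun n => cont_memLp hK (pd_cont (hw n) i)) h2).neg
  refine tendsto_nhds_unique l1 (l2.congr fun n => ?_)
  rw [c1_ibp (hw n) hφ i]

/-- weak derivatives may be tested against `C^1` functions -/
lemma WD.c1 {Ω : Set (Euc d)} (hΩ : IsOpen Ω) {u v : Euc d → ℝ} {i : Fin d} (hu : MemLp u p (volume.restrict Ω))
    (hv : MemLp v p (volume.restrict Ω)) (hW : WD Ω i u v) {φ : Euc d → ℝ} (hφ : T1 Ω φ) :
    ∫ x, u x * pd i φ x = -∫ x, v x * φ x := by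
  refine WD_of_approx hu hv (fun K hKΩ hK => ?_) hφ
  obtain ⟨δ, hδ, h⟩ := exists_delta hΩ hK hKΩ
  have A := approx hΩ hu hK.measurableSet hδ h
  exact ⟨_, fun n => (mol_smooth' hΩ hu n).of_le (by exact WithTop.coe_le_coe.2 (le_top : (1:ℕ∞) ≤ ⊤)), A.1, A.2 i v hv hW⟩

lemma pd_mul {a b : Euc d → ℝ} (ha : ContDiff ℝ 1 a) (hb : ContDiff ℝ 1 b) (i : Fin d) (x : Euc d) :
    pd i (fun x => a x * b x) x = a x * pd i b x + pd i a x * b x := by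
  unfold pd
  rw [fderiv_fun_mul (ha.differentiable (by simp) x) (hb.differentiable (by simp) x)]
  simp; ring

lemma WD.mul {Ω : Set (Euc d)} (hΩ : IsOpen Ω) {u v : Euc d → ℝ} {i : Fin d} (hu : MemLp u p (volume.restrict Ω))
    (hv : MemLp v p (volume.restrict Ω)) (hW : WD Ω i u v) {a : Euc d → ℝ} (ha : ContDiff ℝ 1 a) :
    WD Ω i (fun x => a x * u x) (fun x => a x * v x + pd i a x * u x) := by
  intro φ hφ
  have h1 := test_t1 hφ
  have key := hW.c1 hΩ hu hv (h1.mul_left ha)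
  have m := hΩ.measurableSet
  have I1 := int_pair m ((h1.pd i).mul_left ha.continuous) hu
  have I2 := int_pair m (h1.t0.mul_left (pd_cont ha i)) hu
  have I3 := int_pair m (h1.t0.mul_left ha.continuous) hv
  have e1 : ∫ x, u x * pd i (fun x => a x * φ x) x = (∫ x, u x * (a x * pd i φ x)) + ∫ x, u x * (pd i a x * φ x) := by
    rw [← integral_add I1 I2]; congr 1; funext x; rw [pd_mul ha h1.1]; ring
  have e2 : ∫ x, (a x * v x + pd i a x * u x) * φ x = (∫ x, v x * (a x * φ x)) + ∫ x, u x * (pd i a x * φ x) := by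
    rw [← integral_add I3 I2]; congr 1; funext x; ring
  have e3 : ∫ x, a x * u x * pd i φ x = ∫ x, u x * (a x * pd i φ x) := by congr 1; funext x; ring
  rw [e3, e2]; linarith

lemma loc_int {Ω : Set (Euc d)} (hΩ : IsOpen Ω) {u : Euc d → ℝ} (hu : MemLp u p (volume.restrict Ω)) :
    LocallyIntegrableOn u Ω volume := by
  rw [locallyIntegrableOn_iff (Or.inr hΩ.isLocallyClosed |>.elim id id)]
  intro K hKΩ hK
  have h1 := hu.mono_measure (Measure.restrict_mono hKΩ le_rfl)
  haveI : IsFiniteMeasure (volume.restrict K) := ⟨by rw [Measure.restrict_apply_univ]; exact hK.measure_lt_top⟩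
  exact h1.integrable hp1.out

lemma ae_eq_of_test {Ω : Set (Euc d)} (hΩ : IsOpen Ω) {u v : Euc d → ℝ} (hu : MemLp u p (volume.restrict Ω))
    (hv : MemLp v p (volume.restrict Ω)) (H : ∀ φ, IsTestFun Ω φ → ∫ x, u x * φ x = ∫ x, v x * φ x) :
    u =ᵐ[volume.restrict Ω] v := by
  have := hΩ.ae_eq_zero_of_integral_contDiff_smul_eq_zero (μ := volume) (f := fun x => u x - v x) ((loc_int hΩ hu).sub (loc_int hΩ hv)) (by
    intro g h1 h2 h3
    have ht : IsTestFun Ω g := ⟨h1, h2, h3⟩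
    have h0 := (test_t1 ht).t0
    have e := H g ht
    have : ∀ x, g x • (u x - v x) = u x * g x - v x * g x := fun x => by simp only [smul_eq_mul]; ring
    simp only [this]
    rw [integral_sub (int_pair hΩ.measurableSet h0 hu) (int_pair hΩ.measurableSet h0 hv), e, sub_self])
  rw [Filter.EventuallyEq, ae_restrict_iff' hΩ.measurableSet]
  filter_upwards [this] with x hx hxΩ
  exact sub_eq_zero.1 (hx hxΩ)

lemma WD.unique {Ω : Set (Euc d)} (hΩ : IsOpen Ω) {u v v' : Euc d → ℝ} {i : Fin d} 
    (hv : MemLp v p (volume.restrict Ω)) (hv' : MemLp v' p (volume.restrict Ω)) (h : WD Ω i u v) (h' : WD Ω i u v') :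
    v =ᵐ[volume.restrict Ω] v' :=
  ae_eq_of_test hΩ hv hv' fun φ hφ => by have := h φ hφ; have := h' φ hφ; linarith

lemma pair_congr {Ω : Set (Euc d)} (hΩ : MeasurableSet Ω) {u u' φ : Euc d → ℝ} (h : u =ᵐ[volume.restrict Ω] u') (hφ : T0 Ω φ) :
    ∫ x, u x * φ x = ∫ x, u' x * φ x := by
  rw [← set_int hφ, ← set_int hφ]
  exact integral_congr_ae (h.mono fun x hx => by simp only [hx])

lemma WD.congr {Ω : Set (Euc d)} (hΩ : MeasurableSet Ω) {u u' v v' : Euc d → ℝ} {i : Fin d} (h : WD Ω i u v)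
    (hu : u =ᵐ[volume.restrict Ω] u') (hv : v =ᵐ[volume.restrict Ω] v') : WD Ω i u' v' := by
  intro φ hφ
  rw [← pair_congr hΩ hu ((test_t1 hφ).pd i), ← pair_congr hΩ hv (test_t1 hφ).t0]
  exact h φ hφ

lemma WD.mono {Ω Ω' : Set (Euc d)} (h : Ω ⊆ Ω') {u v : Euc d → ℝ} {i : Fin d} (H : WD Ω' i u v) : WD Ω i u v :=
  fun φ hφ => H φ (test_mono h hφ)

lemma WD.add {Ω : Set (Euc d)} (hΩ : IsOpen Ω) {u v u' v' : Euc d → ℝ} {i : Fin d} (hu : MemLp u p (volume.restrict Ω))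
    (hv : MemLp v p (volume.restrict Ω)) (hu' : MemLp u' p (volume.restrict Ω))
    (hv' : MemLp v' p (volume.restrict Ω)) (h : WD Ω i u v) (h' : WD Ω i u' v') :
    WD Ω i (fun x => u x + u' x) (fun x => v x + v' x) := by
  intro φ hφ
  have m := hΩ.measurableSet
  have t := test_t1 hφ
  simp only [add_mul]
  rw [integral_add (int_pair m (t.pd i) hu) (int_pair m (t.pd i) hu'), integral_add (int_pair m t.t0 hv) (int_pair m t.t0 hv'),
    h φ hφ, h' φ hφ]; ring

lemma WD.smul {Ω : Set (Euc d)} {u v : Euc d → ℝ} {i : Fin d} (h : WD Ω i u v) (c : ℝ) :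
    WD Ω i (fun x => c * u x) (fun x => c * v x) := by
  intro φ hφ
  simp only [mul_assoc]
  rw [integral_const_mul, integral_const_mul, h φ hφ]; ring

lemma WD.zero {Ω : Set (Euc d)} {i : Fin d} : WD Ω i (fun _ => 0) (fun _ => 0) := fun φ _ => by simp

/-- limits of weak derivatives -/
lemma WD.lim {Ω : Set (Euc d)} (hΩ : IsOpen Ω) {u v : Euc d → ℝ} {i : Fin d} {w z : ℕ → Euc d → ℝ}
    (hu : MemLp u p (volume.restrict Ω)) (hv : MemLp v p (volume.restrict Ω))
    (hw : ∀ n, MemLp (w n) p (volume.restrict Ω)) (hz : ∀ n, MemLp (z n) p (volume.restrict Ω))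
    (hwl : Tendsto (fun n => eLpNorm (fun x => w n x - u x) p (volume.restrict Ω)) atTop (𝓝 0))
    (hzl : Tendsto (fun n => eLpNorm (fun x => z n x - v x) p (volume.restrict Ω)) atTop (𝓝 0))
    (H : ∀ n, WD Ω i (w n) (z n)) : WD Ω i u v := by
  intro φ hφ
  have m := hΩ.measurableSet
  have t := test_t1 hφ
  exact tendsto_nhds_unique (pair_lim m (t.pd i) hu hw hwl) ((pair_lim m t.t0 hv hz hzl).neg.congr fun n => (H n φ hφ).symm)

/-- Schwarz -/
lemma WD.schwarz {Ω : Set (Euc d)} {u ui uj v : Euc d → ℝ} {i j : Fin d}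
    (h1 : WD Ω i u ui) (h2 : WD Ω j u uj) (h3 : WD Ω i uj v) : WD Ω j ui v := by
  intro φ hφ
  have e := pd_comm (Tst.c2 (f := φ) ⟨hφ.1, hφ.2.1⟩) i j
  have a1 := h1 _ (test_pd hφ j)
  have a2 := h2 _ (test_pd hφ i)
  have a3 := h3 φ hφ
  rw [e] at a1
  linarith

end Ell

namespace Ell
open Heat
variable {d : ℕ} {p : ℝ≥0∞} [hp1 : Fact (1 ≤ p)] [hp2 : Fact (p ≠ ⊤)]

/-- bounded in `L^p(Ω)` -/
def Lb (Ω : Set (Euc d)) (p : ℝ≥0∞) (u : Euc d → ℝ) (M : ℝ≥0) : Prop :=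
  MemLp u p (volume.restrict Ω) ∧ eLpNorm u p (volume.restrict Ω) ≤ M

/-- Sobolev bounds -/
def Wb (Ω : Set (Euc d)) (p : ℝ≥0∞) : ℕ → (Euc d → ℝ) → ℝ≥0 → Prop
  | 0, u, M => Lb Ω p u M
  | m + 1, u, M => Lb Ω p u M ∧ ∀ i, ∃ v, WD Ω i u v ∧ Wb Ω p m v M

variable {Ω Ω' : Set (Euc d)}

lemma Wb.lb {m : ℕ} {u : Euc d → ℝ} {M : ℝ≥0} (h : Wb Ω p m u M) : Lb Ω p u M := by
  cases m with
  | zero => exact h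
  | succ m => exact h.1

lemma Lb.mono {u : Euc d → ℝ} {M M' : ℝ≥0} (h : Lb Ω p u M) (hM : M ≤ M') : Lb Ω p u M' :=
  ⟨h.1, h.2.trans (by exact_mod_cast hM)⟩

lemma Wb.mono {m : ℕ} {u : Euc d → ℝ} {M M' : ℝ≥0} (h : Wb Ω p m u M) (hM : M ≤ M') : Wb Ω p m u M' := by
  induction m generalizing u with
  | zero => exact Lb.mono h hM
  | succ m ih =>
    refine ⟨h.1.mono hM, fun i => ?_⟩
    obtain ⟨v, h1, h2⟩ := h.2 i
    exact ⟨v, h1, ih h2⟩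

lemma Wb.pred {m : ℕ} {u : Euc d → ℝ} {M : ℝ≥0} (h : Wb Ω p (m + 1) u M) : Wb Ω p m u M := by
  induction m generalizing u with
  | zero => exact h.lb
  | succ m ih =>
    refine ⟨h.1, fun i => ?_⟩
    obtain ⟨v, h1, h2⟩ := h.2 i
    exact ⟨v, h1, ih h2⟩

lemma Wb.down {m m' : ℕ} (hm : m' ≤ m) {u : Euc d → ℝ} {M : ℝ≥0} (h : Wb Ω p m u M) : Wb Ω p m' u M := by
  induction m, hm using Nat.le_induction with
  | base => exact h
  | succ m _ ih => exact ih h.pred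

lemma Lb.congr {u u' : Euc d → ℝ} {M : ℝ≥0} (h : Lb Ω p u M) (e : u =ᵐ[volume.restrict Ω] u') : Lb Ω p u' M :=
  ⟨(memLp_congr_ae e).1 h.1, (eLpNorm_congr_ae e).symm.le.trans h.2⟩

lemma Wb.congr (hΩ : MeasurableSet Ω) {m : ℕ} {u u' : Euc d → ℝ} {M : ℝ≥0} (h : Wb Ω p m u M) (e : u =ᵐ[volume.restrict Ω] u') : Wb Ω p m u' M := by
  cases m with
  | zero => exact Lb.congr h e
  | succ m =>
    refine ⟨h.1.congr e, fun i => ?_⟩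
    obtain ⟨v, h1, h2⟩ := h.2 i
    exact ⟨v, h1.congr hΩ e .rfl, h2⟩

lemma Wb.deriv (hΩ : IsOpen Ω) {m : ℕ} {u v : Euc d → ℝ} {M : ℝ≥0} {i : Fin d} (h : Wb Ω p (m + 1) u M) (hW : WD Ω i u v)
    (hv : MemLp v p (volume.restrict Ω)) : Wb Ω p m v M := by
  obtain ⟨v', h1, h2⟩ := h.2 i
  exact h2.congr hΩ.measurableSet (h1.unique hΩ h2.lb.1 hv hW)

lemma Lb.add {u u' : Euc d → ℝ} {M M' : ℝ≥0} (h : Lb Ω p u M) (h' : Lb Ω p u' M') : Lb Ω p (fun x => u x + u' x) (M + M') :=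
  ⟨h.1.add h'.1, (eLpNorm_add_le h.1.1 h'.1.1 hp1.out).trans (by push_cast; exact add_le_add h.2 h'.2)⟩

lemma Wb.add (hΩ : IsOpen Ω) {m : ℕ} {u u' : Euc d → ℝ} {M M' : ℝ≥0} (h : Wb Ω p m u M) (h' : Wb Ω p m u' M') :
    Wb Ω p m (fun x => u x + u' x) (M + M') := by
  induction m generalizing u u' with
  | zero => exact Lb.add h h'
  | succ m ih =>
    refine ⟨h.1.add h'.1, fun i => ?_⟩
    obtain ⟨v, h1, h2⟩ := h.2 i
    obtain ⟨v', h1', h2'⟩ := h'.2 i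
    exact ⟨_, h1.add hΩ h.1.1 h2.lb.1 h'.1.1 h2'.lb.1 h1', ih h2 h2'⟩

lemma Lb.zero {M : ℝ≥0} : Lb Ω p (fun _ => 0) M := ⟨MemLp.zero, by simp⟩

lemma Wb.zero {m : ℕ} {M : ℝ≥0} : Wb Ω p m (fun _ => 0) M := by
  induction m with
  | zero => exact Lb.zero
  | succ m ih => exact ⟨Lb.zero, fun i => ⟨_, WD.zero, ih⟩⟩

lemma Wb.sum (hΩ : IsOpen Ω) {ι : Type*} (s : Finset ι) {m : ℕ} {u : ι → Euc d → ℝ} {M : ι → ℝ≥0} (h : ∀ i ∈ s, Wb Ω p m (u i) (M i)) :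
    Wb Ω p m (fun x => ∑ i ∈ s, u i x) (∑ i ∈ s, M i) := by
  classical
  induction s using Finset.induction_on with
  | empty => simpa using Wb.zero
  | insert a s ha ih =>
    have := (h a (Finset.mem_insert_self _ _)).add hΩ (ih fun i hi => h i (Finset.mem_insert_of_mem hi))
    simpa only [Finset.sum_insert ha] using this

lemma Lb.restrict {u : Euc d → ℝ} {M : ℝ≥0} (h : Lb Ω p u M) (hs : Ω' ⊆ Ω) : Lb Ω' p u M :=
  ⟨h.1.mono_measure (Measure.restrict_mono hs le_rfl), (eLpNorm_mono_measure _ (Measure.restrict_mono hs le_rfl)).trans h.2⟩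

lemma Wb.restrict {m : ℕ} {u : Euc d → ℝ} {M : ℝ≥0} (h : Wb Ω p m u M) (hs : Ω' ⊆ Ω) : Wb Ω' p m u M := by
  induction m generalizing u with
  | zero => exact Lb.restrict h hs
  | succ m ih =>
    refine ⟨h.1.restrict hs, fun i => ?_⟩
    obtain ⟨v, h1, h2⟩ := h.2 i
    exact ⟨v, h1.mono hs, ih h2⟩

lemma Lb.mul {u a : Euc d → ℝ} {M C : ℝ≥0} (h : Lb Ω p u M) (ha : Continuous a) (hC : ∀ x, |a x| ≤ C) :
    Lb Ω p (fun x => a x * u x) (C * M) := by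
  have b : ∀ x, ‖a x * u x‖ ≤ C * ‖u x‖ := fun x => by
    rw [norm_mul]; exact mul_le_mul_of_nonneg_right (hC x) (norm_nonneg _)
  have m : AEStronglyMeasurable (fun x => a x * u x) (volume.restrict Ω) := ha.aestronglyMeasurable.mul h.1.1
  refine ⟨h.1.of_le_mul m (Eventually.of_forall b), (eLpNorm_le_mul_eLpNorm_of_ae_le_mul (Eventually.of_forall b) p).trans ?_⟩
  push_cast
  rw [ENNReal.ofReal_coe_nnreal]
  gcongr; exact h.2

lemma _root_.HasCompactSupport.congr_cs {f g : Euc d → ℝ} (h : HasCompactSupport f) (e : ∀ x, g x = f x) : HasCompactSupport g := by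
  rwa [show g = f from funext e]

/-! multipliers -/
def Mult (m : ℕ) (a : Euc d → ℝ) : Prop := ContDiff ℝ m a ∧ ∃ c, HasCompactSupport fun x => a x - c

lemma Mult.bdd {m : ℕ} {a : Euc d → ℝ} (h : Mult m a) : ∃ C : ℝ≥0, ∀ x, |a x| ≤ C := by
  obtain ⟨h1, c, hc⟩ := h
  obtain ⟨C, hC⟩ := (h1.continuous.sub continuous_const).bounded_above_of_compact_support hc
  refine ⟨⟨|C| + |c|, by positivity⟩, fun x => ?_⟩
  have h1 : |a x - c| ≤ C := hC x
  have := abs_add_le (a x - c) c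
  rw [sub_add_cancel] at this
  show _ ≤ |C| + |c|
  linarith [le_abs_self C]

lemma Mult.down {m m' : ℕ} (hm : m' ≤ m) {a : Euc d → ℝ} (h : Mult m a) : Mult m' a :=
  ⟨h.1.of_le (by exact_mod_cast hm), h.2⟩

lemma pd_sub_const (a : Euc d → ℝ) (c : ℝ) (i : Fin d) : pd i (fun x => a x - c) = pd i a := by
  funext x; unfold pd; rw [fderiv_sub_const]

lemma pd_contDiff {m : ℕ} {a : Euc d → ℝ} (h : ContDiff ℝ (m + 1 : ℕ) a) (i : Fin d) : ContDiff ℝ m (pd i a) :=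
  (h.fderiv_right (m := m) (by push_cast; exact le_rfl)).clm_apply contDiff_const

lemma Mult.pd {m : ℕ} {a : Euc d → ℝ} (h : Mult (m + 1) a) (i : Fin d) : Mult m (pd i a) := by
  obtain ⟨h1, c, hc⟩ := h
  refine ⟨pd_contDiff h1 i, 0, ?_⟩
  simp only [sub_zero]
  rw [← pd_sub_const a c]
  exact hc.mono' ((subset_tsupport _).trans (pd_tsupport _ i))

lemma Mult.const {m : ℕ} (c : ℝ) : Mult m (fun _ : Euc d => c) :=
  ⟨contDiff_const, c, by simp only [sub_self]; exact HasCompactSupport.zero⟩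

lemma Mult.of_cpt {m : ℕ} {a : Euc d → ℝ} (h : ContDiff ℝ m a) (h2 : HasCompactSupport a) : Mult m a := ⟨h, 0, by simpa using h2⟩

lemma Mult.add {m : ℕ} {a b : Euc d → ℝ} (ha : Mult m a) (hb : Mult m b) : Mult m (fun x => a x + b x) := by
  obtain ⟨h1, c, hc⟩ := ha
  obtain ⟨h1', c', hc'⟩ := hb
  refine ⟨h1.add h1', c + c', ?_⟩
  have := hc.add hc'
  refine this.congr_cs fun x => ?_
  show _ = (a x - c) + (b x - c'); ring

lemma Mult.mul {m : ℕ} {a b : Euc d → ℝ} (ha : Mult m a) (hb : Mult m b) : Mult m (fun x => a x * b x) := by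
  obtain ⟨h1, c, hc⟩ := ha
  obtain ⟨h1', c', hc'⟩ := hb
  refine ⟨h1.mul h1', c * c', ?_⟩
  have := (hc.mul_right (f' := b)).add (hc'.mul_left (f := fun _ => c))
  refine this.congr_cs fun x => ?_
  show _ = (a x - c) * b x + c * (b x - c'); ring

lemma Mult.sum {ι : Type*} {m : ℕ} (s : Finset ι) {a : ι → Euc d → ℝ} (h : ∀ i ∈ s, Mult m (a i)) : Mult m (fun x => ∑ i ∈ s, a i x) := by
  classical
  induction s using Finset.induction_on with
  | empty => simpa using Mult.const 0
  | insert k s hk ih =>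
    have := (h k (Finset.mem_insert_self _ _)).add (ih fun i hi => h i (Finset.mem_insert_of_mem hi))
    simpa only [Finset.sum_insert hk] using this

lemma Mult.inv {m : ℕ} {a : Euc d → ℝ} (h : Mult m a) (h0 : ∀ x, a x ≠ 0) : Mult m (fun x => (a x)⁻¹) := by
  obtain ⟨h1, c, hc⟩ := h
  refine ⟨h1.inv h0, c⁻¹, hc.mono ?_⟩
  intro x hx h
  apply hx
  simp only at h ⊢
  rw [sub_eq_zero.1 h, sub_self]

lemma Mult.comp {m : ℕ} {a : Euc d → ℝ} (h : Mult m a) (T : Euc d ≃ₜ Euc d) (hT : ContDiff ℝ m T) : Mult m (fun x => a (T x)) := by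
  obtain ⟨h1, c, hc⟩ := h
  exact ⟨h1.comp hT, c, hc.comp_homeomorph T⟩

lemma Wb.mult (hΩ : IsOpen Ω) {m : ℕ} {a : Euc d → ℝ} (ha : Mult m a) :
    ∃ C : ℝ≥0, ∀ u M, Wb Ω p m u M → Wb Ω p m (fun x => a x * u x) (C * M) := by
  induction m generalizing a with
  | zero =>
    obtain ⟨C, hC⟩ := ha.bdd
    exact ⟨C, fun u M h => Lb.mul h ha.1.continuous hC⟩
  | succ m ih =>
    obtain ⟨C, hC⟩ := ha.bdd
    obtain ⟨C1, h1⟩ := ih (ha.down (Nat.le_succ m))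
    choose C2 h2 using fun i => ih (ha.pd i)
    refine ⟨C + C1 + ∑ i, C2 i, fun u M h => ⟨(h.1.mul ha.1.continuous hC).mono (by rw [add_assoc]; gcongr; exact le_self_add), fun i => ?_⟩⟩
    obtain ⟨v, hv, hb⟩ := h.2 i
    refine ⟨_, hv.mul hΩ h.1.1 hb.lb.1 (ha.1.of_le (by exact_mod_cast Nat.le_add_left 1 m)), ?_⟩
    refine ((h1 v M hb).add hΩ (h2 i u M h.pred)).mono ?_
    rw [← add_mul]
    gcongr
    · exact le_add_self
    · exact Finset.single_le_sum (f := C2) (fun _ _ => zero_le) (Finset.mem_univ i)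

/-! localisation and extension by zero -/
lemma Lb.ind (hΩ : MeasurableSet Ω) (hΩ' : MeasurableSet Ω') {u : Euc d → ℝ} {M : ℝ≥0} (h : Lb Ω p u M) : Lb Ω' p (Ω.indicator u) M := by
  have h1 : MemLp (Ω.indicator u) p volume := (memLp_indicator_iff_restrict hΩ).2 h.1
  refine ⟨h1.restrict _, (eLpNorm_mono_measure _ Measure.restrict_le_self).trans ?_⟩
  rw [eLpNorm_indicator_eq_eLpNorm_restrict hΩ]; exact h.2

lemma WD.ext (hΩ : IsOpen Ω) {B : Set (Euc d)} (hB : Ω' ∩ B ⊆ Ω) {u v η : Euc d → ℝ} {i : Fin d}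
    (hu : MemLp u p (volume.restrict Ω)) (hv : MemLp v p (volume.restrict Ω))
    (h : WD Ω i u v) (hη : ContDiff ℝ 1 η) (hs : tsupport η ⊆ B) :
    WD Ω' i (Ω.indicator fun x => η x * u x) (fun x => Ω.indicator (fun x => η x * v x) x + Ω.indicator (fun x => pd i η x * u x) x) := by
  intro φ hφ
  have h1 := test_t1 hφ
  have ts : ∀ ψ : Euc d → ℝ, tsupport ψ ⊆ Ω' → tsupport (fun x => η x * ψ x) ⊆ Ω := fun ψ hψ =>
    Set.Subset.trans (Set.subset_inter ((tsupport_mul_subset_right (f := η) (g := ψ)).trans hψ)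
      ((tsupport_mul_subset_left (f := η) (g := ψ)).trans hs)) hB
  have ts' : tsupport (fun x => pd i η x * φ x) ⊆ Ω :=
    Set.Subset.trans (Set.subset_inter ((tsupport_mul_subset_right (f := pd i η) (g := φ)).trans hφ.2.2)
      ((tsupport_mul_subset_left (f := pd i η) (g := φ)).trans ((pd_tsupport _ _).trans hs))) hB
  have t1 : T1 Ω (fun x => η x * φ x) := ⟨hη.mul h1.1, h1.2.1.mul_left, ts _ hφ.2.2⟩
  have t2 : T0 Ω (fun x => η x * pd i φ x) := ⟨hη.continuous.mul (h1.pd i).1, (h1.pd i).2.1.mul_left, ts _ (h1.pd i).2.2⟩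
  have t3 : T0 Ω (fun x => pd i η x * φ x) := ⟨(pd_cont hη i).mul h1.1.continuous, h1.2.1.mul_left, ts'⟩
  have m := hΩ.measurableSet
  have key := h.c1 hΩ hu hv t1
  have I1 := int_pair m t2 hu
  have I2 := int_pair m t3 hu
  have I3 := int_pair m t1.t0 hv
  have e1 : ∫ x, u x * pd i (fun x => η x * φ x) x = (∫ x, u x * (η x * pd i φ x)) + ∫ x, u x * (pd i η x * φ x) := by
    rw [← integral_add I1 I2]; congr 1; funext x; rw [pd_mul hη h1.1]; ring
  have e2 : ∫ x, (Ω.indicator (fun x => η x * v x) x + Ω.indicator (fun x => pd i η x * u x) x) * φ x =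
      (∫ x, v x * (η x * φ x)) + ∫ x, u x * (pd i η x * φ x) := by
    rw [← integral_add I3 I2]; congr 1; funext x
    by_cases hx : x ∈ Ω
    · simp only [Set.indicator_of_mem hx]; ring
    · have a1 := t1.t0.zero hx
      have a2 := t3.zero hx
      simp only [Set.indicator_of_notMem hx, a1, a2]; ring
  have e3 : ∫ x, Ω.indicator (fun x => η x * u x) x * pd i φ x = ∫ x, u x * (η x * pd i φ x) := by
    congr 1; funext x
    by_cases hx : x ∈ Ω
    · simp only [Set.indicator_of_mem hx]; ring
    · have a1 := t2.zero hx
      simp only [Set.indicator_of_notMem hx, a1]; ring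
  rw [e3, e2]; linarith

lemma Wb.ext (hΩ : IsOpen Ω) (hΩ' : IsOpen Ω') {B : Set (Euc d)} (hB : Ω' ∩ B ⊆ Ω) {m : ℕ} {η : Euc d → ℝ} (hη : ContDiff ℝ m η)
    (hc : HasCompactSupport η) (hs : tsupport η ⊆ B) :
    ∃ C : ℝ≥0, ∀ u M, Wb Ω p m u M → Wb Ω' p m (Ω.indicator fun x => η x * u x) (C * M) := by
  induction m generalizing η with
  | zero =>
    obtain ⟨C, hC⟩ := (Mult.of_cpt hη hc).bdd
    exact ⟨C, fun u M h => Lb.ind hΩ.measurableSet hΩ'.measurableSet (Lb.mul h hη.continuous hC)⟩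
  | succ m ih =>
    obtain ⟨C, hC⟩ := (Mult.of_cpt hη hc).bdd
    obtain ⟨C1, h1⟩ := ih (hη.of_le (by exact_mod_cast Nat.le_succ m)) hc hs
    choose C2 h2 using fun i => ih (pd_contDiff hη i) (hc.mono' ((subset_tsupport _).trans (pd_tsupport η i))) ((pd_tsupport η i).trans hs)
    refine ⟨C + C1 + ∑ i, C2 i, fun u M h => ⟨(Lb.ind hΩ.measurableSet hΩ'.measurableSet (h.1.mul hη.continuous hC)).mono
      (by rw [add_assoc]; gcongr; exact le_self_add), fun i => ?_⟩⟩
    obtain ⟨v, hv, hb⟩ := h.2 i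
    refine ⟨_, hv.ext hΩ hB h.1.1 hb.lb.1 (hη.of_le (by exact_mod_cast Nat.le_add_left 1 m)) hs, ?_⟩
    refine ((h1 v M hb).add hΩ' (h2 i u M h.pred)).mono ?_
    rw [← add_mul]
    gcongr
    · exact le_add_self
    · exact Finset.single_le_sum (f := C2) (fun _ _ => zero_le) (Finset.mem_univ i)

end Ell

namespace Ell
open Heat
variable {d : ℕ} {p : ℝ≥0∞} [hp1 : Fact (1 ≤ p)] [hp2 : Fact (p ≠ ⊤)]
variable {Ω Ω' : Set (Euc d)}

/-- global charts, affine outside a compact set -/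
def IsChart (m : ℕ) (T : Euc d ≃ₜ Euc d) : Prop :=
  ContDiff ℝ m T ∧ ContDiff ℝ m T.symm ∧ ∃ (L : Euc d ≃L[ℝ] Euc d) (c : Euc d), HasCompactSupport fun x => T x - (L x + c)

lemma IsChart.symm {m : ℕ} {T : Euc d ≃ₜ Euc d} (h : IsChart m T) : IsChart m T.symm := by
  obtain ⟨h1, h2, L, c, hc⟩ := h
  refine ⟨h2, by simpa using h1, L.symm, -L.symm c, ?_⟩
  have := hc.comp_homeomorph T.symm
  refine this.mono ?_
  intro x hx h
  apply hx
  simp only [Function.comp, T.apply_symm_apply] at h ⊢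
  have e : x = L (T.symm x) + c := sub_eq_zero.1 h
  have e2 : L.symm x = T.symm x + L.symm c := by
    conv_lhs => rw [e]
    simp
  rw [e2]; abel

lemma IsChart.down {m m' : ℕ} (hm : m' ≤ m) {T : Euc d ≃ₜ Euc d} (h : IsChart m T) : IsChart m' T :=
  ⟨h.1.of_le (by exact_mod_cast hm), h.2.1.of_le (by exact_mod_cast hm), h.2.2⟩

lemma coord_contDiff {m : WithTop ℕ∞} {T : Euc d → Euc d} (h : ContDiff ℝ m T) (i : Fin d) : ContDiff ℝ m (fun x => T x i) :=
  (contDiff_euclidean.1 h) i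

lemma IsChart.pd {m : ℕ} {T : Euc d ≃ₜ Euc d} (h : IsChart (m + 1) T) (i j : Fin d) : Mult m (pd i fun x => T x j) := by
  obtain ⟨h1, h2, L, c, hc⟩ := h
  refine ⟨pd_contDiff (coord_contDiff h1 j) i, L (ee i) j, ?_⟩
  have h3 : HasCompactSupport (fun x => T x j - (L x j + c j)) := by
    refine hc.mono fun x hx h => hx ?_
    simp only at h ⊢
    have := congrArg (fun z : Euc d => z j) h
    simpa using this
  have e2 : ∀ x, _root_.pd i (fun x => T x j) x - L (ee i) j = _root_.pd i (fun x => T x j - (L x j + c j)) x := by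
    intro x
    unfold _root_.pd
    have hL : HasFDerivAt (fun x => L x j + c j) ((EuclideanSpace.proj j : Euc d →L[ℝ] ℝ).comp (L : Euc d →L[ℝ] Euc d)) x :=
      (((EuclideanSpace.proj j : Euc d →L[ℝ] ℝ).comp (L : Euc d →L[ℝ] Euc d)).hasFDerivAt).add_const _
    have hT : DifferentiableAt ℝ (fun x => T x j) x := (coord_contDiff h1 j).differentiable (by simp) x
    rw [(hT.hasFDerivAt.fun_sub hL).fderiv]
    rfl
  refine HasCompactSupport.congr_cs ?_ e2
  exact h3.mono' ((subset_tsupport _).trans (pd_tsupport _ i))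

lemma IsChart.vol {T : Euc d ≃ₜ Euc d} (h : IsChart 1 T) :
    ∃ C : ℝ≥0, ∀ S, MeasurableSet S → (volume.restrict (T ⁻¹' S)).map T ≤ (C : ℝ≥0∞) • volume.restrict S := by
  obtain ⟨h1, h2, L, c, hc⟩ := h.symm
  rw [T.symm_symm] at h2
  have hd : ∀ x, HasFDerivAt T.symm (fderiv ℝ T.symm x) x := fun x => (h1.differentiable (by simp) x).hasFDerivAt
  have hm : Mult 0 (fun x => (fderiv ℝ T.symm x).det) := by
    refine ⟨contDiff_zero.2 (ContinuousLinearMap.continuous_det.comp (h1.continuous_fderiv (by simp))), (L : Euc d →L[ℝ] Euc d).det, ?_⟩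
    refine hc.mono' ?_
    intro x hx
    by_contra hn
    apply hx
    have e : T.symm =ᶠ[𝓝 x] fun x => L x + c := by
      filter_upwards [(isClosed_tsupport _).isOpen_compl.mem_nhds hn] with y hy
      have := image_eq_zero_of_notMem_tsupport hy
      exact sub_eq_zero.1 this
    have : HasFDerivAt (fun x => L x + c) (L : Euc d →L[ℝ] Euc d) x := L.hasFDerivAt.add_const _
    simp only
    rw [e.fderiv_eq, this.fderiv, sub_self]
  obtain ⟨C, hC⟩ := hm.bdd
  refine ⟨C, fun S hS => ?_⟩
  rw [← Measure.restrict_map T.continuous.measurable hS, ← Measure.restrict_smul]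
  refine Measure.restrict_mono le_rfl (Measure.le_iff.2 fun A hA => ?_)
  rw [Measure.map_apply T.continuous.measurable hA]
  have e : T ⁻¹' A = T.symm '' A := (T.symm.image_eq_preimage_symm A).symm
  rw [e]
  refine (addHaar_image_le_lintegral_abs_det_fderiv volume hA fun x _ => (hd x).hasFDerivWithinAt).trans ?_
  have : ∫⁻ x in A, ENNReal.ofReal |(fderiv ℝ T.symm x).det| ≤ ∫⁻ x in A, (C : ℝ≥0∞) := by
    refine lintegral_mono fun x => ?_
    rw [← ENNReal.ofReal_coe_nnreal]
    exact ENNReal.ofReal_le_ofReal (hC x)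
  refine this.trans ?_
  simp

lemma IsChart.norm (p : ℝ≥0∞) [hp1 : Fact (1 ≤ p)] [hp2 : Fact (p ≠ ⊤)] {T : Euc d ≃ₜ Euc d} (h : IsChart 1 T) :
    ∃ C : ℝ≥0, ∀ S, MeasurableSet S → ∀ u : Euc d → ℝ,
      eLpNorm (fun x => u (T x)) p (volume.restrict (T ⁻¹' S)) ≤ C * eLpNorm u p (volume.restrict S) ∧
      (MemLp u p (volume.restrict S) → MemLp (fun x => u (T x)) p (volume.restrict (T ⁻¹' S))) := by
  obtain ⟨C, hC⟩ := h.vol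
  refine ⟨C ^ (1 / p).toReal, fun S hS u => ⟨?_, fun hu => ?_⟩⟩
  · have e : eLpNorm (fun x => u (T x)) p (volume.restrict (T ⁻¹' S)) = eLpNorm u p ((volume.restrict (T ⁻¹' S)).map T) :=
      (T.measurableEmbedding.eLpNorm_map_measure).symm
    rw [e]
    refine (eLpNorm_mono_measure _ (hC S hS)).trans ?_
    rw [eLpNorm_smul_measure_of_ne_top hp2.out, smul_eq_mul, ENNReal.coe_rpow_of_nonneg _ ENNReal.toReal_nonneg]
  · exact (hu.of_measure_le_smul ENNReal.coe_ne_top (hC S hS)).comp_of_map T.continuous.measurable.aemeasurable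

lemma pd_comp {w : Euc d → ℝ} (hw : ContDiff ℝ 1 w) {T : Euc d → Euc d} (hT : ContDiff ℝ 1 T) (i : Fin d) (x : Euc d) :
    pd i (fun x => w (T x)) x = ∑ j, pd i (fun x => T x j) x * pd j w (T x) := by
  unfold pd
  have h1 : HasFDerivAt (fun x => w (T x)) ((fderiv ℝ w (T x)).comp (fderiv ℝ T x)) x :=
    (hw.differentiable (by simp) (T x)).hasFDerivAt.comp x (hT.differentiable (by simp) x).hasFDerivAt
  rw [h1.fderiv, ContinuousLinearMap.comp_apply, fderiv_apply_eq_sum]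
  refine Finset.sum_congr rfl fun j _ => ?_
  have h2 : HasFDerivAt (fun x => T x j) ((EuclideanSpace.proj j : Euc d →L[ℝ] ℝ).comp (fderiv ℝ T x)) x :=
    (EuclideanSpace.proj j : Euc d →L[ℝ] ℝ).hasFDerivAt.comp x (hT.differentiable (by simp) x).hasFDerivAt
  rw [h2.fderiv]; rfl

lemma norm_mul_le {S : Set (Euc d)} {a u : Euc d → ℝ} {C : ℝ≥0} (hC : ∀ x, |a x| ≤ C) :
    eLpNorm (fun x => a x * u x) p (volume.restrict S) ≤ C * eLpNorm u p (volume.restrict S) := by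
  have b : ∀ x, ‖a x * u x‖ ≤ C * ‖u x‖ := fun x => by
    rw [norm_mul]; exact mul_le_mul_of_nonneg_right (hC x) (norm_nonneg _)
  refine (eLpNorm_le_mul_eLpNorm_of_ae_le_mul (Eventually.of_forall b) p).trans ?_
  rw [ENNReal.ofReal_coe_nnreal]

lemma WD.chain (hΩ : IsOpen Ω) {T : Euc d ≃ₜ Euc d} (hT : IsChart 1 T) {u : Euc d → ℝ} {v : Fin d → Euc d → ℝ}
    (hu : MemLp u p (volume.restrict Ω)) (hv : ∀ j, MemLp (v j) p (volume.restrict Ω)) (h : ∀ j, WD Ω j u (v j)) (i : Fin d) :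
    MemLp (fun x => ∑ j, pd i (fun x => T x j) x * v j (T x)) p (volume.restrict (T ⁻¹' Ω)) ∧
    WD (T ⁻¹' Ω) i (fun x => u (T x)) (fun x => ∑ j, pd i (fun x => T x j) x * v j (T x)) := by
  obtain ⟨C, hC⟩ := hT.norm p
  choose B hB using fun j => (hT.pd i j).bdd
  have hc : ∀ j, Continuous (pd i fun x => T x j) := fun j => (hT.pd i j).1.continuous
  have hm : MemLp (fun x => ∑ j, pd i (fun x => T x j) x * v j (T x)) p (volume.restrict (T ⁻¹' Ω)) := by
    refine memLp_finset_sum _ fun j _ => ?_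
    refine ((hC Ω hΩ.measurableSet (v j)).2 (hv j)).of_le_mul (c := B j) ?_ ?_
    · exact (hc j).aestronglyMeasurable.mul ((hC Ω hΩ.measurableSet (v j)).2 (hv j)).1
    · refine Eventually.of_forall fun x => ?_
      rw [norm_mul]; exact mul_le_mul_of_nonneg_right (hB j x) (norm_nonneg _)
  refine ⟨hm, fun φ hφ => ?_⟩
  refine WD_of_approx ((hC Ω hΩ.measurableSet u).2 hu) hm (fun K hKΩ hK => ?_) (test_t1 hφ)
  have hK' : IsCompact (T '' K) := hK.image T.continuous
  have hKS : T '' K ⊆ Ω := by rintro _ ⟨x, hx, rfl⟩; exact hKΩ hx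
  have hKe : T ⁻¹' (T '' K) = K := T.preimage_image K
  obtain ⟨δ, hδ, hd⟩ := exists_delta hΩ hK' hKS
  obtain ⟨A1, A2⟩ := approx hΩ hu hK'.measurableSet hδ hd
  have sm : ∀ n, ContDiff ℝ 1 (mol n (Ω.indicator u)) := fun n =>
    (mol_smooth' hΩ hu n).of_le (by exact WithTop.coe_le_coe.2 (le_top : (1:ℕ∞) ≤ ⊤))
  refine ⟨fun n x => mol n (Ω.indicator u) (T x), fun n => (sm n).comp hT.1, ?_, ?_⟩
  · have := ENNReal.Tendsto.const_mul A1 (Or.inr (ENNReal.coe_ne_top (r := C)))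
    rw [mul_zero] at this
    refine tendsto_of_tendsto_of_tendsto_of_le_of_le tendsto_const_nhds this (fun _ => zero_le) fun n => ?_
    have := (hC _ hK'.measurableSet (fun x => mol n (Ω.indicator u) x - u x)).1
    rwa [hKe] at this
  · have T2 : Tendsto (fun n => ∑ j, (B j : ℝ≥0∞) * (C * eLpNorm (fun x => pd j (mol n (Ω.indicator u)) x - v j x) p (volume.restrict (T '' K)))) atTop (𝓝 0) := by
      rw [show (0 : ℝ≥0∞) = ∑ j : Fin d, (B j : ℝ≥0∞) * (C * 0) by simp]
      exact tendsto_finset_sum _ fun j _ => ENNReal.Tendsto.const_mul (ENNReal.Tendsto.const_mul (A2 j (v j) (hv j) (h j)) (Or.inr ENNReal.coe_ne_top)) (Or.inr ENNReal.coe_ne_top)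
    refine tendsto_of_tendsto_of_tendsto_of_le_of_le tendsto_const_nhds T2 (fun _ => zero_le) fun n => ?_
    have e : (fun x => pd i (fun x => mol n (Ω.indicator u) (T x)) x - ∑ j, pd i (fun x => T x j) x * v j (T x)) =
        ∑ j, fun x => pd i (fun x => T x j) x * (pd j (mol n (Ω.indicator u)) (T x) - v j (T x)) := by
      funext x
      rw [pd_comp (sm n) hT.1, ← Finset.sum_sub_distrib, Finset.sum_apply]
      exact Finset.sum_congr rfl fun j _ => by ring
    rw [e]
    refine (eLpNorm_sum_le (fun j _ => ?_) hp1.out).trans (Finset.sum_le_sum fun j _ => ?_)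
    · have h1 : AEStronglyMeasurable (fun x => v j (T x)) (volume.restrict K) :=
        ((hC Ω hΩ.measurableSet (v j)).2 (hv j)).1.mono_measure (Measure.restrict_mono hKΩ le_rfl)
      exact (hc j).aestronglyMeasurable.mul ((((pd_cont (sm n) j).comp T.continuous).aestronglyMeasurable).sub h1)
    · refine (norm_mul_le (hB j)).trans ?_
      gcongr
      have := (hC _ hK'.measurableSet (fun x => pd j (mol n (Ω.indicator u)) x - v j x)).1
      rwa [hKe] at this

lemma Lb.chain (p : ℝ≥0∞) [hp1 : Fact (1 ≤ p)] [hp2 : Fact (p ≠ ⊤)] {T : Euc d ≃ₜ Euc d} (hT : IsChart 1 T) :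
    ∃ C : ℝ≥0, ∀ Ω, MeasurableSet Ω → ∀ u M, Lb Ω p u M → Lb (T ⁻¹' Ω) p (fun x => u (T x)) (C * M) := by
  obtain ⟨C, hC⟩ := hT.norm p
  refine ⟨C, fun Ω hΩ u M h => ⟨(hC Ω hΩ u).2 h.1, (hC Ω hΩ u).1.trans ?_⟩⟩
  push_cast
  gcongr
  exact h.2

lemma Wb.chain (hΩ : IsOpen Ω) {m : ℕ} {T : Euc d ≃ₜ Euc d} (h1T : IsChart 1 T) (hT : IsChart m T) :
    ∃ C : ℝ≥0, ∀ u M, Wb Ω p m u M → Wb (T ⁻¹' Ω) p m (fun x => u (T x)) (C * M) := by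
  obtain ⟨C, hC⟩ := Lb.chain p h1T
  have hO : IsOpen (T ⁻¹' Ω) := hΩ.preimage T.continuous
  induction m with
  | zero => exact ⟨C, fun u M h => hC Ω hΩ.measurableSet u M h⟩
  | succ m ih =>
    obtain ⟨C1, h1⟩ := ih (hT.down (Nat.le_succ m))
    choose C2 h2 using fun i j => Wb.mult (p := p) hO (hT.pd i j)
    refine ⟨C + ∑ i, ∑ j, C2 i j * C1, fun u M h => ⟨(hC Ω hΩ.measurableSet u M h.1).mono (by gcongr; exact le_self_add), fun i => ?_⟩⟩
    choose v hv using h.2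
    refine ⟨_, (WD.chain hΩ h1T h.1.1 (fun j => (hv j).2.lb.1) (fun j => (hv j).1) i).2, ?_⟩
    refine (Wb.sum hO Finset.univ fun j _ => h2 i j _ _ (h1 _ _ (hv j).2)).mono ?_
    simp only [← mul_assoc]
    rw [← Finset.sum_mul]
    gcongr
    exact (Finset.single_le_sum (f := fun i => ∑ j, C2 i j * C1) (fun _ _ => zero_le) (Finset.mem_univ i)).trans le_add_self

end Ell

namespace Ell
open Heat
variable {d : ℕ} {p : ℝ≥0∞} [hp1 : Fact (1 ≤ p)] [hp2 : Fact (p ≠ ⊤)]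

lemma lim_le {μ : Measure (Euc d)} {u : Euc d → ℝ} {w : ℕ → Euc d → ℝ} (hu : AEStronglyMeasurable u μ) (hw : ∀ n, AEStronglyMeasurable (w n) μ)
    (hl : Tendsto (fun n => eLpNorm (fun x => w n x - u x) p μ) atTop (𝓝 0)) {A : ℕ → ℝ≥0∞} {B : ℝ≥0∞}
    (hA : ∀ n, eLpNorm (w n) p μ ≤ A n) (hB : Tendsto A atTop (𝓝 B)) : eLpNorm u p μ ≤ B := by
  have h : ∀ n, eLpNorm u p μ ≤ A n + eLpNorm (fun x => w n x - u x) p μ := fun n => by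
    have e : u = (w n) - (fun x => w n x - u x) := by funext x; simp
    conv_lhs => rw [e]
    exact (eLpNorm_sub_le (hw n) ((hw n).sub hu) hp1.out).trans (add_le_add (hA n) le_rfl)
  have := hB.add hl
  rw [add_zero] at this
  exact ge_of_tendsto' this h

lemma cz_norm (h1p : 1 < p) : ∃ C : ℝ≥0, ∀ (d : ℕ) (φ : Euc d → ℝ), Tst φ → ∀ i j,
    eLpNorm (pd i (pd j φ)) p volume ≤ C * eLpNorm (lap φ) p volume := by
  have hp : 1 < p.toReal := by
    rw [← ENNReal.toReal_one]; exact (ENNReal.toReal_lt_toReal ENNReal.one_ne_top hp2.out).2 h1p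
  obtain ⟨C, hC, H⟩ := cz0 hp
  have hp0 : (0:ℝ) < p.toReal := by linarith
  refine ⟨(C ^ p.toReal⁻¹).toNNReal, fun d φ hφ i j => ?_⟩
  have m1 : MemLp (pd i (pd j φ)) p volume := ((hφ.pd j).pd i).cont.memLp_of_hasCompactSupport ((hφ.pd j).pd i).2
  have m2 : MemLp (lap φ) p volume := hφ.lap.cont.memLp_of_hasCompactSupport hφ.lap.2
  rw [m1.eLpNorm_eq_integral_rpow_norm (p_ne_zero p) hp2.out, m2.eLpNorm_eq_integral_rpow_norm (p_ne_zero p) hp2.out]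
  have e : (((C ^ p.toReal⁻¹).toNNReal : ℝ≥0) : ℝ≥0∞) = ENNReal.ofReal (C ^ p.toReal⁻¹) := rfl
  rw [e, ← ENNReal.ofReal_mul (by positivity), ← Real.mul_rpow hC.le (by positivity)]
  refine ENNReal.ofReal_le_ofReal (Real.rpow_le_rpow (by positivity) (H d φ hφ i j) (by positivity))

/-- almost everywhere compactly supported -/
def AC (w : Euc d → ℝ) : Prop := ∃ R : ℝ, ∀ᵐ x, R < ‖x‖ → w x = 0

lemma mol_ae {n : ℕ} {g g' : Euc d → ℝ} (h : g =ᵐ[volume] g') : mol n g = mol n g' := by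
  funext x
  unfold mol
  have : (fun z => g (x - z)) =ᵐ[volume] fun z => g' (x - z) :=
    (Measure.measurePreserving_sub_left volume x).quasiMeasurePreserving.ae_eq_comp h
  exact integral_congr_ae (this.mono fun z hz => by simp only at hz ⊢; rw [hz])

lemma AC.mol {w : Euc d → ℝ} (h : AC w) (n : ℕ) : HasCompactSupport (mol n w) := by
  obtain ⟨R, hR⟩ := h
  have e : w =ᵐ[volume] (Metric.closedBall 0 R).indicator w := by
    filter_upwards [hR] with x hx
    by_cases hx' : x ∈ Metric.closedBall (0 : Euc d) R
    · rw [Set.indicator_of_mem hx']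
    · rw [Set.indicator_of_notMem hx']
      exact hx (by simpa using hx')
  rw [mol_ae e]
  refine mol_cpt n (HasCompactSupport.of_support_subset_isCompact (isCompact_closedBall 0 R) ?_)
  exact Set.support_indicator_subset

lemma mol_pd_univ {u v : Euc d → ℝ} {i : Fin d} (hu : MemLp u p volume) (hW : WD Set.univ i u v) (n : ℕ) :
    pd i (mol n u) = mol n v := by
  funext x
  have := mol_pd (p := p) isOpen_univ (hu.restrict _) hW (n := n) (x := x) (Set.subset_univ _)
  simpa using this

lemma mol_memLp {u : Euc d → ℝ} (hu : MemLp u p volume) (n : ℕ) : AEStronglyMeasurable (mol n u) volume :=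
  (mol_smooth n (hu.locallyIntegrable hp1.out)).continuous.aestronglyMeasurable

lemma cz1 (h1p : 1 < p) : ∃ C : ℝ≥0, ∀ (d : ℕ) (w : Euc d → ℝ) (v : Fin d → Euc d → ℝ) (vv : Fin d → Fin d → Euc d → ℝ),
    AC w → MemLp w p volume → (∀ i, MemLp (v i) p volume) → (∀ i j, MemLp (vv i j) p volume) →
    (∀ i, WD Set.univ i w (v i)) → (∀ i j, WD Set.univ j (v i) (vv i j)) →
    ∀ i j, eLpNorm (vv i j) p volume ≤ C * eLpNorm (fun x => ∑ k, vv k k x) p volume := by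
  obtain ⟨C, H⟩ := cz_norm (p := p) h1p
  refine ⟨C, fun d w v vv hc hw hv hvv h1 h2 i j => ?_⟩
  have e : ∀ n i j, pd j (pd i (mol n w)) = mol n (vv i j) := fun n i j => by
    rw [mol_pd_univ hw (h1 i), mol_pd_univ (hv i) (h2 i j)]
  have S : MemLp (fun x => ∑ k, vv k k x) p volume := memLp_finset_sum _ fun k _ => hvv k k
  refine lim_le (hvv i j).1 (fun n => mol_memLp (hvv i j) n) (mol_Lp (hvv i j))
    (A := fun n => C * (eLpNorm (fun x => ∑ k, vv k k x) p volume + ∑ k, eLpNorm (fun x => mol n (vv k k) x - vv k k x) p volume)) (fun n => ?_) ?_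
  · have t : Tst (mol n w) := ⟨mol_smooth n (hw.locallyIntegrable hp1.out), hc.mol n⟩
    have := H d (mol n w) t j i
    rw [e] at this
    refine this.trans ?_
    gcongr
    have e2 : lap (mol n w) = (fun x => ∑ k, vv k k x) + ∑ k, fun x => mol n (vv k k) x - vv k k x := by
      funext x
      simp only [lap, e, Pi.add_apply, Finset.sum_apply, Finset.sum_sub_distrib]
      ring
    have m : ∀ k ∈ Finset.univ, AEStronglyMeasurable (fun x => mol n (vv k k) x - vv k k x) volume := fun k _ => (mol_memLp (hvv k k) n).sub (hvv k k).1
    rw [e2]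
    exact (eLpNorm_add_le S.1 (Finset.aestronglyMeasurable_sum _ m) hp1.out).trans (by gcongr; exact eLpNorm_sum_le m hp1.out)
  · have : Tendsto (fun n => ∑ k, eLpNorm (fun x => mol n (vv k k) x - vv k k x) p volume) atTop (𝓝 0) := by
      rw [show (0:ℝ≥0∞) = ∑ k : Fin d, 0 by simp]
      exact tendsto_finset_sum _ fun k _ => mol_Lp (hvv k k)
    have := ENNReal.Tendsto.const_mul (a := (C : ℝ≥0∞)) ((tendsto_const_nhds (x := eLpNorm (fun x => ∑ k, vv k k x) p volume)).add this) (Or.inr ENNReal.coe_ne_top)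
    rwa [add_zero] at this

/-! difference quotients -/
lemma eLpNorm_shift {g : Euc d → ℝ} (hg : AEStronglyMeasurable g volume) (z : Euc d) :
    eLpNorm (fun x => g (x + z)) p volume = eLpNorm g p volume :=
  eLpNorm_comp_measurePreserving hg (measurePreserving_add_right volume z)

lemma memLp_shift {g : Euc d → ℝ} (hg : MemLp g p volume) (z : Euc d) : MemLp (fun x => g (x + z)) p volume :=
  hg.comp_measurePreserving (measurePreserving_add_right volume z)

noncomputable def dqf (i : Fin d) (h : ℝ) (g : Euc d → ℝ) (x : Euc d) : ℝ := (g (x + h • ee i) - g x) / h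

lemma dqf_memLp {g : Euc d → ℝ} (hg : MemLp g p volume) (i : Fin d) (h : ℝ) : MemLp (dqf i h g) p volume := by
  have := ((memLp_shift hg (h • ee i)).sub hg).const_mul h⁻¹
  refine (memLp_congr_ae (Eventually.of_forall fun x => ?_)).1 this
  simp [dqf]; ring

lemma dqf_norm_le {g : Euc d → ℝ} (hg : MemLp g p volume) (i : Fin d) {h : ℝ} (hh : 0 < h) :
    eLpNorm (dqf i h g) p volume ≤ ENNReal.ofReal (2 / h) * eLpNorm g p volume := by
  have e : dqf i h g = h⁻¹ • ((fun x => g (x + h • ee i)) - g) := by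
    funext x; simp [dqf]; ring
  rw [e, eLpNorm_const_smul]
  refine (mul_le_mul_right (eLpNorm_sub_le (memLp_shift hg _).1 hg.1 hp1.out) _).trans ?_
  rw [eLpNorm_shift hg.1, ← two_mul, ← mul_assoc, Real.enorm_eq_ofReal (by positivity)]
  gcongr
  rw [show (2:ℝ≥0∞) = ENNReal.ofReal 2 by simp, ← ENNReal.ofReal_mul (by positivity)]
  exact ENNReal.ofReal_le_ofReal (by rw [div_eq_inv_mul])

lemma dqf_smooth {g : Euc d → ℝ} (hg : ContDiff ℝ 1 g) (i : Fin d) {h : ℝ} (hh : h ≠ 0) (x : Euc d) :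
    dqf i h g x = ∫ t, pd i g (x + (t * h) • ee i) ∂(volume.restrict (Set.Ioc (0:ℝ) 1)) := by
  rw [← intervalIntegral.integral_of_le zero_le_one]
  have hd : ∀ t ∈ Set.uIcc (0:ℝ) 1, HasDerivAt (fun t => g (x + (t * h) • ee i) / h) (pd i g (x + (t * h) • ee i)) t := by
    intro t _
    have h1 : HasDerivAt (fun t : ℝ => x + (t * h) • ee i) (h • ee i) t :=
      (((hasDerivAt_id t).mul_const h).smul_const (ee i)).const_add x |>.congr_deriv (by simp)
    have h2 := ((hg.differentiable (by simp) (x + (t * h) • ee i)).hasFDerivAt.comp_hasDerivAt t h1).div_const h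
    refine h2.congr_deriv ?_
    rw [map_smul, smul_eq_mul, mul_div_cancel_left₀ _ hh]; rfl
  have c : Continuous fun t : ℝ => pd i g (x + (t * h) • ee i) := (pd_cont hg i).comp (by fun_prop)
  rw [intervalIntegral.integral_eq_sub_of_hasDerivAt hd (c.intervalIntegrable _ _)]
  simp [dqf]; ring

lemma dq {g g' : Euc d → ℝ} {i : Fin d} (hg : MemLp g p volume) (hg' : MemLp g' p volume) (hW : WD Set.univ i g g')
    {h : ℝ} (hh : h ≠ 0) (c : ℝ) {A : ℝ≥0∞}
    (hA : ∀ t ∈ Set.Ioc (0:ℝ) 1, eLpNorm (fun x => g' (x + (t * h) • ee i) - c * g' x) p volume ≤ A) :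
    eLpNorm (fun x => dqf i h g x - c * g' x) p volume ≤ A := by
  haveI : IsProbabilityMeasure (volume.restrict (Set.Ioc (0:ℝ) 1)) := ⟨by simp⟩
  set E : ℕ → ℝ≥0∞ := fun n => eLpNorm (fun x => mol n g' x - g' x) p volume
  have hE : Tendsto E atTop (𝓝 0) := mol_Lp hg'
  have sm : ∀ n, ContDiff ℝ 1 (mol n g) := fun n =>
    (mol_smooth n (hg.locallyIntegrable hp1.out)).of_le (by exact WithTop.coe_le_coe.2 (le_top : (1:ℕ∞) ≤ ⊤))
  have cm : ∀ n, Continuous (mol n g') := fun n => (mol_smooth n (hg'.locallyIntegrable hp1.out)).continuous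
  have em : ∀ n, AEStronglyMeasurable (fun x => mol n g' x - g' x) volume := fun n => (mol_memLp hg' n).sub hg'.1
  have K : ∀ n, eLpNorm (fun x => dqf i h (mol n g) x - c * mol n g' x) p volume ≤ A + (E n + ENNReal.ofReal |c| * E n) := by
    intro n
    have e : (fun x => dqf i h (mol n g) x - c * mol n g' x) =
        fun x => ∫ t, (mol n g' (x + (t * h) • ee i) - c * mol n g' x) ∂(volume.restrict (Set.Ioc (0:ℝ) 1)) := by
      funext x
      rw [integral_sub, dqf_smooth (sm n) i hh, mol_pd_univ hg hW]
      · simp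
      · have : Continuous fun t : ℝ => mol n g' (x + (t * h) • ee i) := (cm n).comp (by fun_prop)
        exact (this.integrableOn_Icc).mono_set Set.Ioc_subset_Icc_self
      · exact integrable_const _
    rw [e]
    refine avg ?_ ?_
    · refine Continuous.aestronglyMeasurable ?_
      have : Continuous fun q : Euc d × ℝ => mol n g' (q.1 + (q.2 * h) • ee i) - c * mol n g' q.1 :=
        ((cm n).comp (by fun_prop)).sub (continuous_const.mul ((cm n).comp continuous_fst))
      exact this
    · filter_upwards [ae_restrict_mem measurableSet_Ioc] with t ht
      have e3 : (fun x => mol n g' (x + (t * h) • ee i) - c * mol n g' x) =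
          (fun x => g' (x + (t * h) • ee i) - c * g' x) +
          ((fun x => (fun y => mol n g' y - g' y) (x + (t * h) • ee i)) - c • (fun x => mol n g' x - g' x)) := by
        funext x; simp; ring
      rw [e3]
      have m1 := (em n).comp_measurePreserving (measurePreserving_add_right volume ((t * h) • ee i))
      refine (eLpNorm_add_le (((memLp_shift hg' _).1).sub (hg'.1.const_mul c)) (m1.sub ((em n).const_smul c)) hp1.out).trans ?_
      refine add_le_add (hA t ht) ((eLpNorm_sub_le m1 ((em n).const_smul c) hp1.out).trans ?_)
      rw [eLpNorm_const_smul, Real.enorm_eq_ofReal_abs]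
      exact add_le_add (eLpNorm_shift (em n) _).le le_rfl
  have L : Tendsto (fun n => A + (E n + ENNReal.ofReal |c| * E n)) atTop (𝓝 A) := by
    have := hE.add (ENNReal.Tendsto.const_mul (a := ENNReal.ofReal |c|) hE (Or.inr ENNReal.ofReal_ne_top))
    have := (tendsto_const_nhds (x := A)).add this
    simpa using this
  refine lim_le (w := fun n x => dqf i h (mol n g) x - c * mol n g' x) ?_ (fun n => ?_) ?_ K L
  · exact (dqf_memLp hg i h).1.sub (hg'.1.const_mul c)
  · refine Continuous.aestronglyMeasurable ?_
    have := (sm n).continuous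
    have h1 : Continuous (dqf i h (mol n g)) := ((this.comp (by fun_prop)).sub this).div_const h
    exact h1.sub (continuous_const.mul (cm n))
  · have G := mol_Lp hg
    have ub : Tendsto (fun n => ENNReal.ofReal |h⁻¹| * (eLpNorm (fun x => mol n g x - g x) p volume + eLpNorm (fun x => mol n g x - g x) p volume) + ENNReal.ofReal |c| * E n) atTop (𝓝 0) := by
      have := (ENNReal.Tendsto.const_mul (a := ENNReal.ofReal |h⁻¹|) (G.add G) (Or.inr ENNReal.ofReal_ne_top)).add (ENNReal.Tendsto.const_mul (a := ENNReal.ofReal |c|) hE (Or.inr ENNReal.ofReal_ne_top))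
      simpa using this
    refine tendsto_of_tendsto_of_tendsto_of_le_of_le tendsto_const_nhds ub (fun _ => zero_le) fun n => ?_
    have mg : AEStronglyMeasurable (fun x => mol n g x - g x) volume := (mol_memLp hg n).sub hg.1
    have m1 := mg.comp_measurePreserving (measurePreserving_add_right volume (h • ee i))
    have e : (fun x => dqf i h (mol n g) x - c * mol n g' x - (dqf i h g x - c * g' x)) =
        h⁻¹ • ((fun x => (fun y => mol n g y - g y) (x + h • ee i)) - fun y => mol n g y - g y) - c • (fun x => mol n g' x - g' x) := by
      funext x; simp [dqf]; ring
    simp only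
    rw [e]
    refine (eLpNorm_sub_le ((m1.sub mg).const_smul _) ((em n).const_smul c) hp1.out).trans ?_
    rw [eLpNorm_const_smul, eLpNorm_const_smul, Real.enorm_eq_ofReal_abs, Real.enorm_eq_ofReal_abs]
    gcongr
    refine (eLpNorm_sub_le m1 mg hp1.out).trans ?_
    exact add_le_add (eLpNorm_shift mg _).le le_rfl

lemma dq_tendsto {g g' : Euc d → ℝ} {i : Fin d} (hg : MemLp g p volume) (hg' : MemLp g' p volume) (hW : WD Set.univ i g g') :
    Tendsto (fun n : ℕ => eLpNorm (fun x => dqf i (1 / ((n:ℝ) + 1)) g x - g' x) p volume) atTop (𝓝 0) := by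
  rw [ENNReal.tendsto_atTop_zero]
  intro ε hε
  obtain ⟨δ, hδ, H⟩ := trans_cont hg' hε
  obtain ⟨N, hN⟩ := exists_nat_one_div_lt hδ
  refine ⟨N, fun n hn => ?_⟩
  have hle : 1 / ((n:ℝ) + 1) ≤ 1 / ((N:ℝ) + 1) := one_div_le_one_div_of_le (by positivity) (by exact_mod_cast Nat.succ_le_succ hn)
  have h0 : 0 < 1 / ((n:ℝ) + 1) := by positivity
  have := dq hg hg' hW (h := 1 / ((n:ℝ) + 1)) (by positivity) 1 (A := ε) (fun t ht => by
    simp only [one_mul]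
    refine H _ ?_
    rw [norm_smul, Real.norm_eq_abs, abs_of_nonneg (by have := ht.1; positivity)]
    have e1 : ‖(ee i : Euc d)‖ = 1 := by simp [ee]
    rw [e1, mul_one]
    nlinarith [ht.2, ht.1])
  simpa only [one_mul] using this

lemma shift_le {g g' : Euc d → ℝ} {i : Fin d} (hg : MemLp g p volume) (hg' : MemLp g' p volume) (hW : WD Set.univ i g g')
    {h : ℝ} (hh : 0 < h) : eLpNorm (fun x => g (x + h • ee i) - g x) p volume ≤ ENNReal.ofReal h * eLpNorm g' p volume := by
  have := dq hg hg' hW hh.ne' 0 (A := eLpNorm g' p volume) (fun t _ => by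
    simp only [zero_mul, sub_zero]; exact (eLpNorm_shift hg'.1 _).le)
  simp only [zero_mul, sub_zero] at this
  have e : (fun x => g (x + h • ee i) - g x) = h • dqf i h g := by
    funext x; simp [dqf]; field_simp
  rw [e, eLpNorm_const_smul, Real.enorm_eq_ofReal hh.le]
  gcongr

lemma interp {g g' g2 : Euc d → ℝ} {i : Fin d} (hg : MemLp g p volume) (hg' : MemLp g' p volume) (hg2 : MemLp g2 p volume)
    (hW : WD Set.univ i g g') (hW2 : WD Set.univ i g' g2) {h : ℝ} (hh : 0 < h) :
    eLpNorm g' p volume ≤ ENNReal.ofReal h * eLpNorm g2 p volume + ENNReal.ofReal (2 / h) * eLpNorm g p volume := by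
  have := dq hg hg' hW hh.ne' 1 (A := ENNReal.ofReal h * eLpNorm g2 p volume) (fun t ht => by
    simp only [one_mul]
    refine (shift_le hg' hg2 hW2 (mul_pos ht.1 hh)).trans ?_
    gcongr
    nlinarith [ht.2])
  simp only [one_mul] at this
  have e : g' = dqf i h g - fun x => dqf i h g x - g' x := by funext x; simp
  conv_lhs => rw [e]
  have m := (dqf_memLp hg i h).1
  refine (eLpNorm_sub_le m (m.sub hg'.1) hp1.out).trans ?_
  rw [add_comm]
  exact add_le_add this (dqf_norm_le hg i hh)

end Ell

namespace Ell
open Heat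
variable {n : ℕ} {p : ℝ≥0∞} [hp1 : Fact (1 ≤ p)] [hp2 : Fact (p ≠ ⊤)]

/-- the half space -/
def HH (n : ℕ) : Set (Euc (n + 1)) := {x | 0 < x 0}

lemma coord_cont {d : ℕ} (i : Fin d) : Continuous fun x : Euc d => x i := (EuclideanSpace.proj (𝕜 := ℝ) i).continuous

lemma HH_open : IsOpen (HH n) := isOpen_lt continuous_const (coord_cont 0)

/-- sign -/
def sg (i : Fin (n + 1)) : ℝ := if i = 0 then -1 else 1

lemma sg_sq (i : Fin (n + 1)) : sg i * sg i = 1 := by unfold sg; split_ifs <;> norm_num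

lemma sg_abs (i : Fin (n + 1)) : |sg i| = 1 := by unfold sg; split_ifs <;> norm_num

/-- reflection in the first coordinate -/
noncomputable def rf (n : ℕ) : Euc (n + 1) ≃ₗᵢ[ℝ] Euc (n + 1) :=
  LinearIsometryEquiv.piLpCongrRight 2 fun i : Fin (n + 1) => if i = 0 then LinearIsometryEquiv.neg ℝ else LinearIsometryEquiv.refl ℝ ℝ

lemma rf_apply (x : Euc (n + 1)) (i : Fin (n + 1)) : rf n x i = sg i * x i := by
  unfold rf sg
  rw [LinearIsometryEquiv.piLpCongrRight_apply]
  simp only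
  split_ifs <;> simp

lemma rf_rf (x : Euc (n + 1)) : rf n (rf n x) = x := by
  ext i; rw [rf_apply, rf_apply, ← mul_assoc, sg_sq, one_mul]

lemma rf_ee (i : Fin (n + 1)) : rf n (ee i) = sg i • ee i := by
  ext j; rw [rf_apply]
  by_cases h : j = i
  · subst h; simp
  · simp [ee, h]

lemma rf_H {x : Euc (n + 1)} (hx : x ∈ HH n) : rf n x ∉ HH n := by
  intro h
  have h1 : 0 < x 0 := hx
  have h2 : 0 < rf n x 0 := h
  rw [rf_apply] at h2; simp [sg] at h2; linarith

lemma rf_pd {φ : Euc (n + 1) → ℝ} (hφ : ContDiff ℝ 1 φ) (i : Fin (n + 1)) (x : Euc (n + 1)) :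
    pd i (fun x => φ (rf n x)) x = sg i * pd i φ (rf n x) := by
  unfold pd
  have h1 : HasFDerivAt (fun x => φ (rf n x)) ((fderiv ℝ φ (rf n x)).comp ((rf n).toContinuousLinearEquiv : Euc (n+1) →L[ℝ] Euc (n+1))) x :=
    (hφ.differentiable (by simp) (rf n x)).hasFDerivAt.comp x ((rf n).toContinuousLinearEquiv.hasFDerivAt)
  rw [h1.fderiv]
  show fderiv ℝ φ (rf n x) (rf n (ee i)) = _
  rw [rf_ee, map_smul]; rfl

lemma int_rf (f : Euc (n + 1) → ℝ) : ∫ x, f (rf n x) = ∫ x, f x :=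
  (rf n).measurePreserving.integral_comp (rf n).toHomeomorph.measurableEmbedding f

lemma memLp_rf {f : Euc (n + 1) → ℝ} (hf : MemLp f p volume) : MemLp (fun x => f (rf n x)) p volume :=
  hf.comp_measurePreserving (rf n).measurePreserving

lemma eLpNorm_rf {f : Euc (n + 1) → ℝ} (hf : MemLp f p volume) : eLpNorm (fun x => f (rf n x)) p volume = eLpNorm f p volume :=
  eLpNorm_comp_measurePreserving hf.1 (rf n).measurePreserving

lemma test_rf {φ : Euc (n + 1) → ℝ} (h : IsTestFun Set.univ φ) : IsTestFun Set.univ (fun x => φ (rf n x)) :=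
  ⟨h.1.comp (rf n).contDiff, h.2.1.comp_homeomorph (rf n).toHomeomorph, Set.subset_univ _⟩

lemma WD.rf {u v : Euc (n + 1) → ℝ} {i : Fin (n + 1)} (h : WD Set.univ i u v) :
    WD Set.univ i (fun x => u (rf n x)) (fun x => sg i * v (rf n x)) := by
  intro φ hφ
  have := h _ (test_rf hφ)
  have e1 : ∫ x, u (Ell.rf n x) * pd i φ x = sg i * ∫ x, u x * pd i (fun x => φ (Ell.rf n x)) x := by
    rw [← int_rf (fun x => u x * pd i (fun x => φ (Ell.rf n x)) x), ← integral_const_mul]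
    congr 1; funext x
    rw [rf_pd (test_t1 hφ).1, rf_rf]
    linear_combination (- u (Ell.rf n x) * pd i φ x) * sg_sq i
  have e2 : ∫ x, sg i * v (Ell.rf n x) * φ x = sg i * ∫ x, v x * φ (Ell.rf n x) := by
    rw [← int_rf (fun x => v x * φ (Ell.rf n x)), ← integral_const_mul]
    congr 1; funext x
    rw [rf_rf]; ring
  rw [e1, e2, this]; ring

/-! cutoff near the boundary -/
noncomputable def st1 (s : ℝ) : ℝ := Real.smoothTransition (s - 1)

lemma st1_smooth : ContDiff ℝ (⊤ : ℕ∞) st1 := Real.smoothTransition.contDiff.comp (contDiff_id.sub contDiff_const)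

lemma st1_zero {s : ℝ} (h : s ≤ 1) : st1 s = 0 := Real.smoothTransition.zero_of_nonpos (by linarith)
lemma st1_one {s : ℝ} (h : 2 ≤ s) : st1 s = 1 := Real.smoothTransition.one_of_one_le (by linarith)

lemma st1_deriv {s : ℝ} (h : 2 < s) : deriv st1 s = 0 := by
  have : st1 =ᶠ[𝓝 s] fun _ => 1 := by
    filter_upwards [lt_mem_nhds h] with t ht using st1_one ht.le
  rw [this.deriv_eq]; simp

lemma st1_deriv' {s : ℝ} (h : s < 1) : deriv st1 s = 0 := by
  have : st1 =ᶠ[𝓝 s] fun _ => 0 := by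
    filter_upwards [gt_mem_nhds h] with t ht using st1_zero ht.le
  rw [this.deriv_eq]; simp

lemma st1_bd : ∃ B : ℝ, ∀ s, |s * deriv st1 s| ≤ B := by
  have c : Continuous fun s => s * deriv st1 s := continuous_id.mul (st1_smooth.continuous_deriv (by simp))
  obtain ⟨B, hB⟩ := c.bounded_above_of_compact_support (HasCompactSupport.of_support_subset_isCompact (isCompact_Icc (a := 1) (b := 2)) (by
    intro s hs
    by_contra hn
    apply hs
    rw [Set.mem_Icc, not_and_or, not_le, not_le] at hn
    rcases hn with h | h
    · simp [st1_deriv' h]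
    · simp [st1_deriv h]))
  exact ⟨B, hB⟩

noncomputable def chi (m : ℕ) (x : Euc (n + 1)) : ℝ := st1 ((m + 1) * x 0)

lemma chi_smooth (m : ℕ) : ContDiff ℝ (⊤ : ℕ∞) (chi (n := n) m) :=
  st1_smooth.comp (contDiff_const.mul (EuclideanSpace.proj (𝕜 := ℝ) (0 : Fin (n + 1))).contDiff)

lemma chi_pd (m : ℕ) (j : Fin (n + 1)) (x : Euc (n + 1)) : pd j (chi m) x = deriv st1 ((m + 1) * x 0) * ((m + 1) * ee j 0) := by
  unfold pd
  have h1 : HasFDerivAt (fun x : Euc (n + 1) => ((m:ℝ) + 1) * x 0) (((m:ℝ) + 1) • (EuclideanSpace.proj (0 : Fin (n + 1)) : Euc (n + 1) →L[ℝ] ℝ)) x :=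
    (EuclideanSpace.proj (0 : Fin (n + 1)) : Euc (n + 1) →L[ℝ] ℝ).hasFDerivAt.const_mul _
  have h2 : HasDerivAt st1 (deriv st1 ((m + 1) * x 0)) ((m + 1) * x 0) := (st1_smooth.differentiable (by simp) _).hasDerivAt
  have h3 := h2.comp_hasFDerivAt x h1
  have e : (chi m : Euc (n + 1) → ℝ) = st1 ∘ fun x : Euc (n + 1) => ((m:ℝ) + 1) * x 0 := rfl
  rw [e, h3.fderiv]
  simp [ee]

lemma half_test {g h ψ : Euc (n + 1) → ℝ} {j : Fin (n + 1)} (hg : MemLp g p volume) (hh : MemLp h p volume)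
    (g0 : ∀ x ∉ HH n, g x = 0) (h0 : ∀ x ∉ HH n, h x = 0) (hW : WD (HH n) j g h) (hψ : IsTestFun Set.univ ψ)
    (hj : j ≠ 0 ∨ ∀ x : Euc (n + 1), x 0 = 0 → ψ x = 0) :
    ∫ x, g x * pd j ψ x = -∫ x, h x * ψ x := by
  have t1 := test_t1 hψ
  set K := tsupport ψ
  have hK : IsCompact K := hψ.2.1
  have ich : ∀ f : Euc (n + 1) → ℝ, MemLp f p volume → ∀ D : ℝ, Integrable (K.indicator fun x => |f x| * D) := by
    intro f hf D
    haveI : IsFiniteMeasure (volume.restrict K) := ⟨by rw [Measure.restrict_apply_univ]; exact hK.measure_lt_top⟩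
    exact IntegrableOn.integrable_indicator ((((hf.restrict K).integrable hp1.out).abs).mul_const D) hK.measurableSet
  obtain ⟨D1, hD1⟩ := (t1.pd j).1.bounded_above_of_compact_support (t1.pd j).2.1
  obtain ⟨D2, hD2⟩ := t1.1.continuous.bounded_above_of_compact_support t1.2.1
  have c1 : ∀ m, ContDiff ℝ 1 (chi (n := n) m) := fun m => (chi_smooth m).of_le (by exact WithTop.coe_le_coe.2 (le_top : (1:ℕ∞) ≤ ⊤))
  have hchi : ∀ m (x : Euc (n + 1)), |chi m x| ≤ 1 := fun m x => by
    unfold chi st1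
    rw [abs_of_nonneg (Real.smoothTransition.nonneg _)]; exact Real.smoothTransition.le_one _
  obtain ⟨D3, hD3⟩ : ∃ D3 : ℝ, ∀ m x, |pd j (chi m) x * ψ x| ≤ D3 := by
    rcases hj with hj | hj
    · refine ⟨0, fun m x => ?_⟩
      have : (ee j : Euc (n + 1)) 0 = 0 := by simp [ee, hj.symm]
      rw [chi_pd, this]; simp
    · obtain ⟨B, hB⟩ := st1_bd
      obtain ⟨L, hL⟩ := ContDiff.lipschitzWith_of_hasCompactSupport t1.2.1 t1.1 (by simp)
      refine ⟨B * L, fun m x => ?_⟩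
      have e0 : |(ee j : Euc (n + 1)) 0| ≤ 1 := by
        by_cases h : (0 : Fin (n + 1)) = j <;> simp [ee, h]
      have hx : |ψ x| ≤ L * |x 0| := by
        have z : ψ (x - x 0 • ee 0) = 0 := hj _ (by simp [ee])
        have := hL.dist_le_mul x (x - x 0 • ee 0)
        rw [z, dist_eq_norm, dist_eq_norm, sub_zero, sub_sub_cancel, norm_smul] at this
        have e1 : ‖(ee (0 : Fin (n + 1)) : Euc (n + 1))‖ = 1 := by simp [ee]
        rwa [e1, mul_one] at this
      rw [chi_pd, abs_mul, abs_mul, abs_mul]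
      have hb := hB ((m + 1) * x 0)
      rw [abs_mul, abs_mul] at hb
      have hB0 := (abs_nonneg _).trans (hB 0)
      set a := |deriv st1 ((m + 1) * x 0)|
      set b := |(m:ℝ) + 1|
      have ha : 0 ≤ a := abs_nonneg _
      have hbb : 0 ≤ b := abs_nonneg _
      calc a * (b * |(ee j : Euc (n + 1)) 0|) * |ψ x| ≤ a * (b * 1) * (L * |x 0|) := by gcongr
        _ = (b * |x 0| * a) * L := by ring
        _ ≤ B * L := by gcongr
  have tf : ∀ m, IsTestFun (HH n) (fun x => chi m x * ψ x) := by
    intro m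
    refine ⟨(chi_smooth m).mul hψ.1, hψ.2.1.mul_left, ?_⟩
    have hcl : IsClosed {x : Euc (n + 1) | 1 ≤ ((m:ℝ) + 1) * x 0} := isClosed_le continuous_const (continuous_const.mul (coord_cont 0))
    have : tsupport (fun x => chi m x * ψ x) ⊆ {x : Euc (n + 1) | 1 ≤ ((m:ℝ) + 1) * x 0} := by
      refine closure_minimal (fun x hx => ?_) hcl
      by_contra hn
      apply hx
      simp only
      rw [chi, st1_zero (not_le.1 hn).le, zero_mul]
    refine this.trans fun x hx => ?_
    have hx' : 1 ≤ ((m:ℝ) + 1) * x 0 := hx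
    by_contra hn
    have : x 0 ≤ 0 := not_lt.1 hn
    nlinarith [(Nat.cast_nonneg m : (0:ℝ) ≤ m)]
  have key : ∀ m, ∫ x, g x * pd j (fun x => chi m x * ψ x) x = -∫ x, h x * (chi m x * ψ x) := fun m => hW _ (tf m)
  have ev : ∀ x ∈ HH n, ∀ᶠ m : ℕ in atTop, 2 < ((m:ℝ) + 1) * x 0 := by
    intro x hx
    have hx' : 0 < x 0 := hx
    have : Tendsto (fun m : ℕ => ((m:ℝ) + 1) * x 0) atTop atTop :=
      (tendsto_atTop_add_const_right _ _ tendsto_natCast_atTop_atTop).atTop_mul_const hx'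
    exact this.eventually_gt_atTop 2
  have L1 : Tendsto (fun m : ℕ => ∫ x, g x * pd j (fun x => chi m x * ψ x) x) atTop (𝓝 (∫ x, g x * pd j ψ x)) := by
    refine tendsto_integral_of_dominated_convergence (K.indicator fun x => |g x| * (D1 + D3)) (fun m => ?_) (ich g hg _) (fun m => ?_) ?_
    · exact hg.1.mul (pd_cont (test_t1 (tf m)).1 j).aestronglyMeasurable
    · refine Eventually.of_forall fun x => ?_
      by_cases hx : x ∈ K
      · rw [Set.indicator_of_mem hx, norm_mul, Real.norm_eq_abs]
        gcongr
        rw [pd_mul (c1 m) t1.1]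
        refine (norm_add_le _ _).trans (add_le_add ?_ (hD3 m x))
        rw [norm_mul]
        have := mul_le_mul (hchi m x) (hD1 x) (norm_nonneg _) zero_le_one
        rwa [one_mul] at this
      · rw [Set.indicator_of_notMem hx]
        have : pd j (fun x => chi m x * ψ x) x = 0 := by
          rw [pd_mul (c1 m) t1.1]
          have h1 : ψ x = 0 := image_eq_zero_of_notMem_tsupport hx
          have h2 : pd j ψ x = 0 := image_eq_zero_of_notMem_tsupport fun h => hx (pd_tsupport _ _ h)
          rw [h1, h2]; ring
        rw [this]; simp
    · refine Eventually.of_forall fun x => ?_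
      by_cases hx : x ∈ HH n
      · refine tendsto_const_nhds.congr' ?_
        filter_upwards [ev x hx] with m hm
        rw [pd_mul (c1 m) t1.1, chi_pd, st1_deriv hm, chi, st1_one hm.le]; ring
      · simp only [g0 x hx, zero_mul]; exact tendsto_const_nhds
  have L2 : Tendsto (fun m : ℕ => ∫ x, h x * (chi m x * ψ x)) atTop (𝓝 (∫ x, h x * ψ x)) := by
    refine tendsto_integral_of_dominated_convergence (K.indicator fun x => |h x| * D2) (fun m => ?_) (ich h hh _) (fun m => ?_) ?_
    · exact hh.1.mul (test_t1 (tf m)).1.continuous.aestronglyMeasurable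
    · refine Eventually.of_forall fun x => ?_
      by_cases hx : x ∈ K
      · rw [Set.indicator_of_mem hx, norm_mul, Real.norm_eq_abs]
        gcongr
        rw [norm_mul]
        have := mul_le_mul (hchi m x) (hD2 x) (norm_nonneg _) zero_le_one
        rwa [one_mul] at this
      · rw [Set.indicator_of_notMem hx]
        have h1 : ψ x = 0 := image_eq_zero_of_notMem_tsupport hx
        rw [h1]; simp
    · refine Eventually.of_forall fun x => ?_
      by_cases hx : x ∈ HH n
      · refine tendsto_const_nhds.congr' ?_
        filter_upwards [ev x hx] with m hm
        rw [chi, st1_one hm.le]; ring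
      · simp only [h0 x hx, zero_mul]; exact tendsto_const_nhds
  exact tendsto_nhds_unique L1 ((L2.neg).congr fun m => (key m).symm)

lemma lemT {g h : Euc (n + 1) → ℝ} {j : Fin (n + 1)} (hg : MemLp g p volume) (hh : MemLp h p volume)
    (g0 : ∀ x ∉ HH n, g x = 0) (h0 : ∀ x ∉ HH n, h x = 0) (hW : WD (HH n) j g h) (hj : j ≠ 0) : WD Set.univ j g h :=
  fun _ hφ => half_test hg hh g0 h0 hW hφ (Or.inl hj)

lemma int_pair_univ {φ u : Euc (n + 1) → ℝ} (h : T0 Set.univ φ) (hu : MemLp u p volume) : Integrable (fun x => u x * φ x) :=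
  int_pair MeasurableSet.univ h (hu.restrict _)

lemma lemN {g h : Euc (n + 1) → ℝ} (hg : MemLp g p volume) (hh : MemLp h p volume)
    (g0 : ∀ x ∉ HH n, g x = 0) (h0 : ∀ x ∉ HH n, h x = 0) (hW : WD (HH n) 0 g h) :
    WD Set.univ 0 (fun x => g x + g (rf n x)) (fun x => h x - h (rf n x)) := by
  intro φ hφ
  have hr := test_rf hφ
  have t := test_t1 hφ
  have tr := test_t1 hr
  have hψ : IsTestFun Set.univ (fun x => φ x - φ (rf n x)) := ⟨hφ.1.sub hr.1, hφ.2.1.sub hr.2.1, Set.subset_univ _⟩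
  have key := half_test hg hh g0 h0 hW hψ (Or.inr fun x hx => by
    have : rf n x = x := by
      ext i; rw [rf_apply]; unfold sg; split_ifs with hi
      · rw [hi, hx]; simp
      · simp
    rw [this, sub_self])
  have s0 : sg (0 : Fin (n + 1)) = -1 := by simp [sg]
  have pdr : ∀ x, pd 0 φ (rf n x) = - pd 0 (fun x => φ (rf n x)) x := fun x => by rw [rf_pd t.1, s0]; ring
  have e1 : ∫ x, g x * pd 0 (fun x => φ x - φ (rf n x)) x = (∫ x, g x * pd 0 φ x) - ∫ x, g x * pd 0 (fun x => φ (rf n x)) x := by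
    rw [← integral_sub (int_pair_univ (t.pd 0) hg) (int_pair_univ (tr.pd 0) hg)]
    congr 1; funext x
    have : pd 0 (fun x => φ x - φ (rf n x)) x = pd 0 φ x - pd 0 (fun x => φ (rf n x)) x := by
      unfold pd
      rw [fderiv_fun_sub (t.1.differentiable (by simp) x) (tr.1.differentiable (by simp) x)]; rfl
    rw [this]; ring
  have e2 : ∫ x, h x * (φ x - φ (rf n x)) = (∫ x, h x * φ x) - ∫ x, h x * φ (rf n x) := by
    rw [← integral_sub (int_pair_univ t.t0 hh) (int_pair_univ tr.t0 hh)]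
    congr 1; funext x; ring
  have e3 : ∫ x, (g x + g (rf n x)) * pd 0 φ x = (∫ x, g x * pd 0 φ x) - ∫ x, g x * pd 0 (fun x => φ (rf n x)) x := by
    have : ∫ x, g x * pd 0 (fun x => φ (rf n x)) x = -∫ x, g (rf n x) * pd 0 φ x := by
      rw [← int_rf (fun x => g x * pd 0 (fun x => φ (rf n x)) x), ← integral_neg]
      congr 1; funext x
      have := pdr (rf n x); rw [rf_rf] at this
      rw [this]; ring
    rw [this, sub_neg_eq_add, ← integral_add (int_pair_univ (t.pd 0) hg) (int_pair_univ (t.pd 0) (memLp_rf hg))]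
    congr 1; funext x; ring
  have e4 : ∫ x, (h x - h (rf n x)) * φ x = (∫ x, h x * φ x) - ∫ x, h x * φ (rf n x) := by
    have : ∫ x, h x * φ (rf n x) = ∫ x, h (rf n x) * φ x := by
      rw [← int_rf (fun x => h x * φ (rf n x))]; simp only [rf_rf]
    rw [this, ← integral_sub (int_pair_univ t.t0 hh) (int_pair_univ t.t0 (memLp_rf hh))]
    congr 1; funext x; ring
  rw [e3, e4, ← e1, key, e2]

/-- zero-trace `W^{2,p}` functions on the half space -/
structure Good (p : ℝ≥0∞) (w : Euc (n + 1) → ℝ) (v : Fin (n + 1) → Euc (n + 1) → ℝ) (vv : Fin (n + 1) → Fin (n + 1) → Euc (n + 1) → ℝ) : Prop where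
  ac : AC w
  w0 : ∀ x ∉ HH n, w x = 0
  v0 : ∀ i, ∀ x ∉ HH n, v i x = 0
  vv0 : ∀ i j, ∀ x ∉ HH n, vv i j x = 0
  mw : MemLp w p volume
  mv : ∀ i, MemLp (v i) p volume
  mvv : ∀ i j, MemLp (vv i j) p volume
  dw : ∀ i, WD Set.univ i w (v i)
  dv : ∀ i j, WD (HH n) j (v i) (vv i j)

/-- signed extension -/
noncomputable def ex (c : ℝ) (f : Euc (n + 1) → ℝ) (x : Euc (n + 1)) : ℝ := f x - c * f (rf n x)

lemma ex_memLp {f : Euc (n + 1) → ℝ} (hf : MemLp f p volume) (c : ℝ) : MemLp (ex c f) p volume := hf.sub ((memLp_rf hf).const_mul c)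

lemma ex_le {f : Euc (n + 1) → ℝ} (hf : MemLp f p volume) {c : ℝ} (hc : |c| = 1) : eLpNorm (ex c f) p volume ≤ 2 * eLpNorm f p volume := by
  have : ex c f = f - c • fun x => f (rf n x) := rfl
  rw [this]
  refine (eLpNorm_sub_le hf.1 ((memLp_rf hf).1.const_smul c) hp1.out).trans ?_
  rw [eLpNorm_const_smul, eLpNorm_rf hf, Real.enorm_eq_ofReal_abs, hc, two_mul]; simp

lemma le_ex {f : Euc (n + 1) → ℝ} (f0 : ∀ x ∉ HH n, f x = 0) (c : ℝ) : eLpNorm f p volume ≤ eLpNorm (ex c f) p volume := by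
  refine eLpNorm_mono fun x => ?_
  by_cases hx : x ∈ HH n
  · rw [ex, f0 _ (rf_H hx)]; simp
  · rw [f0 x hx]; simp

lemma WD.ex {u v : Euc (n + 1) → ℝ} {i : Fin (n + 1)} (mu : MemLp u p volume) (mv : MemLp v p volume) (h : WD Set.univ i u v) (c : ℝ) :
    WD Set.univ i (ex c u) (ex (c * sg i) v) := by
  have h2 := h.rf.smul (-c)
  have := h.add (p := p) isOpen_univ (mu.restrict _) (mv.restrict _) (((memLp_rf mu).const_mul (-c)).restrict _)
    ((((memLp_rf mv).const_mul (sg i)).const_mul (-c)).restrict _) h2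
  convert this using 1
  · funext x; unfold Ell.ex; ring
  · funext x; unfold Ell.ex; ring

section
variable {w : Euc (n + 1) → ℝ} {v : Fin (n + 1) → Euc (n + 1) → ℝ} {vv : Fin (n + 1) → Fin (n + 1) → Euc (n + 1) → ℝ}

lemma Good.tan (h : Good p w v vv) (i : Fin (n + 1)) {j : Fin (n + 1)} (hj : j ≠ 0) : WD Set.univ j (v i) (vv i j) :=
  lemT (h.mv i) (h.mvv i j) (h.v0 i) (h.vv0 i j) (h.dv i j) hj

lemma Good.symm (h : Good p w v vv) (i j : Fin (n + 1)) : vv i j =ᵐ[volume] vv j i := by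
  have h1 : WD (HH n) j (v i) (vv j i) :=
    WD.schwarz ((h.dw i).mono (Set.subset_univ _)) ((h.dw j).mono (Set.subset_univ _)) (h.dv j i)
  have := (h.dv i j).unique HH_open ((h.mvv i j).restrict _) ((h.mvv j i).restrict _) h1
  rw [Filter.EventuallyEq, ae_restrict_iff' HH_open.measurableSet] at this
  filter_upwards [this] with x hx
  by_cases hxH : x ∈ HH n
  · exact hx hxH
  · rw [h.vv0 i j x hxH, h.vv0 j i x hxH]

lemma Good.dW (h : Good p w v vv) (i : Fin (n + 1)) : WD Set.univ i (ex 1 w) (ex (sg i) (v i)) := by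
  have := (h.dw i).ex h.mw (h.mv i) 1
  rwa [one_mul] at this

lemma Good.dV (h : Good p w v vv) (i j : Fin (n + 1)) : WD Set.univ j (ex (sg i) (v i)) (ex (sg i * sg j) (vv i j)) := by
  by_cases hj : j = 0
  · subst hj
    by_cases hi : i = 0
    · subst hi
      have := lemN (h.mv 0) (h.mvv 0 0) (h.v0 0) (h.vv0 0 0) (h.dv 0 0)
      convert this using 1
      · funext x; simp [ex, sg]
      · funext x; simp [ex, sg]
    · have h1 := (h.tan 0 hi).ex (h.mv 0) (h.mvv 0 i) (sg (0 : Fin (n + 1)))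
      have h2 := WD.schwarz (h.dW i) (h.dW 0) h1
      refine h2.congr MeasurableSet.univ .rfl ?_
      rw [Measure.restrict_univ, mul_comm (sg i)]
      have s := h.symm 0 i
      have s2 : (fun x => vv 0 i (rf n x)) =ᵐ[volume] fun x => vv i 0 (rf n x) :=
        (rf n).measurePreserving.quasiMeasurePreserving.ae_eq_comp s
      filter_upwards [s, s2] with x h1 h2
      simp only [ex, h1, h2]
  · exact (h.tan i hj).ex (h.mv i) (h.mvv i j) (sg i)

lemma AC.ex (h : AC w) (c : ℝ) : AC (ex c w) := by
  obtain ⟨R, hR⟩ := h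
  refine ⟨R, ?_⟩
  have := (rf n).measurePreserving.quasiMeasurePreserving.ae hR
  filter_upwards [hR, this] with x h1 h2 hx
  rw [(rf n).norm_map] at h2
  rw [Ell.ex, h1 hx, h2 hx]; ring

end

lemma cz2 (h1p : 1 < p) : ∃ C : ℝ≥0, ∀ (n : ℕ) (w : Euc (n + 1) → ℝ) v vv, Good p w v vv →
    ∀ i j, eLpNorm (vv i j) p volume ≤ C * eLpNorm (fun x => ∑ k, vv k k x) p volume := by
  obtain ⟨C, H⟩ := cz1 (p := p) h1p
  refine ⟨C * 2, fun n w v vv h i j => ?_⟩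
  have := H _ _ _ _ (h.ac.ex 1) (ex_memLp h.mw 1) (fun i => ex_memLp (h.mv i) (sg i)) (fun i j => ex_memLp (h.mvv i j) (sg i * sg j)) h.dW h.dV i j
  refine (le_ex (h.vv0 i j) _).trans (this.trans ?_)
  have e : (fun x => ∑ k, ex (sg k * sg k) (vv k k) x) = ex 1 (fun x => ∑ k, vv k k x) := by
    funext x
    simp only [ex, sg_sq, one_mul, Finset.sum_sub_distrib]
  rw [e]
  push_cast
  rw [mul_assoc]
  gcongr
  exact ex_le (memLp_finset_sum _ fun k _ => h.mvv k k) (by simp)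

lemma interp2 {w : Euc (n + 1) → ℝ} {v vv} (h : Good p w v vv) (i : Fin (n + 1)) {t : ℝ} (ht : 0 < t) :
    eLpNorm (v i) p volume ≤ ENNReal.ofReal t * (2 * eLpNorm (vv i i) p volume) + ENNReal.ofReal (2 / t) * (2 * eLpNorm w p volume) := by
  refine (le_ex (h.v0 i) (sg i)).trans ((interp (ex_memLp h.mw 1) (ex_memLp (h.mv i) (sg i)) (ex_memLp (h.mvv i i) _) (h.dW i) (h.dV i i) ht).trans ?_)
  gcongr
  · exact ex_le (h.mvv i i) (by rw [abs_mul, sg_abs, one_mul])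
  · exact ex_le h.mw (by simp)

end Ell

namespace Ell
open Heat
variable {n : ℕ} {p : ℝ≥0∞} [hp1 : Fact (1 ≤ p)] [hp2 : Fact (p ≠ ⊤)]

lemma absorb {S A : ℝ≥0∞} (hS : S ≠ ⊤) (h : S ≤ A + S / 2) : S ≤ 2 * A := by
  have h2 : S / 2 + S / 2 ≤ A + S / 2 := by rwa [ENNReal.add_halves]
  have h3 : S / 2 ≤ A := (ENNReal.add_le_add_iff_right (ENNReal.div_ne_top hS (by norm_num))).1 h2
  calc S = 2 * (S / 2) := by rw [two_mul, ENNReal.add_halves]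
    _ ≤ _ := by gcongr

/-- coefficient matrix close to the identity -/
def Near {d : ℕ} (ε : ℝ) (a : Fin d → Fin d → Euc d → ℝ) : Prop :=
  ∀ i j x, |a i j x - (if i = j then 1 else 0)| ≤ ε

lemma cz3 (h1p : 1 < p) (n : ℕ) : ∃ ε : ℝ, 0 < ε ∧ ε ≤ 1 / 2 ∧ ∃ C : ℝ≥0, ∀ a : Fin (n + 1) → Fin (n + 1) → Euc (n + 1) → ℝ,
    Near ε a → (∀ i j, Continuous (a i j)) → ∀ w v vv, Good p w v vv →
    ∀ i j, eLpNorm (vv i j) p volume ≤ C * eLpNorm (fun x => ∑ i, ∑ j, a i j x * vv i j x) p volume := by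
  obtain ⟨C0, H⟩ := cz2 (p := p) h1p
  set N : ℝ≥0 := (n + 1) * (n + 1) with hN
  set ε : ℝ≥0 := 1 / (2 * (N * C0 + 1)) with hε
  have hε0 : 0 < ε := by positivity
  have hε1 : N * C0 * ε ≤ 1 / 2 := by
    rw [hε, mul_one_div, div_le_div_iff₀ (by positivity) (by norm_num)]
    nlinarith [zero_le (a := N * C0)]
  refine ⟨ε, by exact_mod_cast hε0, ?_, 2 * (N * C0), fun a ha hac w v vv h i j => ?_⟩
  · have : ε ≤ 1 / 2 := by
      rw [hε]
      apply one_div_le_one_div_of_le (by norm_num)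
      nlinarith [zero_le (a := N * C0)]
    exact_mod_cast this
  set S : ℝ≥0∞ := ∑ i, ∑ j, eLpNorm (vv i j) p volume with hS
  have hSt : S ≠ ⊤ := ENNReal.sum_ne_top.2 fun i _ => ENNReal.sum_ne_top.2 fun j _ => (h.mvv i j).2.ne
  set F := fun x => ∑ i, ∑ j, a i j x * vv i j x with hF
  have mA : ∀ i j, AEStronglyMeasurable (fun x => a i j x * vv i j x) volume := fun i j =>
    (hac i j).aestronglyMeasurable.mul (h.mvv i j).1
  have mF : AEStronglyMeasurable F volume := by
    refine Finset.aestronglyMeasurable_fun_sum _ fun i _ => Finset.aestronglyMeasurable_fun_sum _ fun j _ => mA i j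
  have mE : ∀ i j, AEStronglyMeasurable (fun x => ((if i = j then 1 else 0) - a i j x) * vv i j x) volume := fun i j =>
    (continuous_const.sub (hac i j)).aestronglyMeasurable.mul (h.mvv i j).1
  have k1 : eLpNorm (fun x => ∑ k, vv k k x) p volume ≤ eLpNorm F p volume + ε * S := by
    have e : (fun x => ∑ k, vv k k x) = F + fun x => ∑ i, ∑ j, ((if i = j then 1 else 0) - a i j x) * vv i j x := by
      funext x
      simp only [hF, Pi.add_apply, ← Finset.sum_add_distrib]
      refine Finset.sum_congr rfl fun i _ => ?_
      simp [sub_mul]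
    rw [e]
    refine (eLpNorm_add_le mF (Finset.aestronglyMeasurable_fun_sum _ fun i _ => Finset.aestronglyMeasurable_fun_sum _ fun j _ => mE i j) hp1.out).trans ?_
    gcongr
    have s1 := eLpNorm_sum_le (μ := volume) (p := p) (s := Finset.univ) (f := fun i x => ∑ j, ((if i = j then 1 else 0) - a i j x) * vv i j x)
      (fun i _ => Finset.aestronglyMeasurable_fun_sum _ fun j _ => mE i j) hp1.out
    have e2 : (∑ i, fun x => ∑ j, ((if i = j then 1 else 0) - a i j x) * vv i j x) = fun x => ∑ i, ∑ j, ((if i = j then 1 else 0) - a i j x) * vv i j x := by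
      funext x; simp
    rw [e2] at s1
    refine s1.trans ?_
    rw [hS, Finset.mul_sum]
    refine Finset.sum_le_sum fun i _ => ?_
    have s2 := eLpNorm_sum_le (μ := volume) (p := p) (s := Finset.univ) (f := fun j x => ((if i = j then 1 else 0) - a i j x) * vv i j x)
      (fun j _ => mE i j) hp1.out
    have e3 : (∑ j, fun x => ((if i = j then 1 else 0) - a i j x) * vv i j x) = fun x => ∑ j, ((if i = j then 1 else 0) - a i j x) * vv i j x := by
      funext x; simp
    rw [e3] at s2
    refine s2.trans ?_
    rw [Finset.mul_sum]
    refine Finset.sum_le_sum fun j _ => ?_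
    have := norm_mul_le (p := p) (S := Set.univ) (a := fun x => (if i = j then 1 else 0) - a i j x) (u := vv i j) (C := ε)
      (fun x => by rw [abs_sub_comm]; exact ha i j x)
    simpa using this
  have k2 : ∀ i j, eLpNorm (vv i j) p volume ≤ C0 * eLpNorm F p volume + C0 * ε * S := fun i j => by
    refine (H n w v vv h i j).trans ?_
    rw [mul_assoc, ← mul_add]
    gcongr
  have k3 : S ≤ N * C0 * eLpNorm F p volume + S / 2 := by
    calc S ≤ ∑ i : Fin (n + 1), ∑ j : Fin (n + 1), (C0 * eLpNorm F p volume + C0 * ε * S) :=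
          Finset.sum_le_sum fun i _ => Finset.sum_le_sum fun j _ => k2 i j
      _ = N * C0 * eLpNorm F p volume + ((N * C0 * ε : ℝ≥0) : ℝ≥0∞) * S := by
          simp only [Finset.sum_const, Finset.card_univ, Fintype.card_fin, nsmul_eq_mul, hN]
          push_cast
          ring
      _ ≤ _ := by
          gcongr
          rw [ENNReal.div_eq_inv_mul]
          gcongr
          calc ((N * C0 * ε : ℝ≥0) : ℝ≥0∞) ≤ ((1 / 2 : ℝ≥0) : ℝ≥0∞) := by exact_mod_cast hε1
            _ = 2⁻¹ := by rw [one_div, ENNReal.coe_inv (by norm_num)]; rfl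
  have k4 := absorb hSt k3
  calc eLpNorm (vv i j) p volume ≤ ∑ j, eLpNorm (vv i j) p volume := Finset.single_le_sum (f := fun j => eLpNorm (vv i j) p volume) (fun _ _ => zero_le) (Finset.mem_univ j)
    _ ≤ S := Finset.single_le_sum (f := fun i => ∑ j, eLpNorm (vv i j) p volume) (fun _ _ => zero_le) (Finset.mem_univ i)
    _ ≤ _ := k4
    _ = _ := by push_cast; ring

lemma WD.shift {d : ℕ} {S : Set (Euc d)} {i : Fin d} {u v : Euc d → ℝ} (h : WD S i u v) {z : Euc d} (hz : ∀ x ∈ S, x + z ∈ S) :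
    WD S i (fun x => u (x + z)) (fun x => v (x + z)) := by
  intro φ hφ
  have hψ : IsTestFun S (fun x => φ (x - z)) := by
    refine ⟨hφ.1.comp (contDiff_id.sub contDiff_const), ?_, ?_⟩
    · exact hφ.2.1.comp_homeomorph (Homeomorph.subRight z)
    · intro x hx
      have : tsupport (fun x => φ (x - z)) = (Homeomorph.subRight z) ⁻¹' tsupport φ := by
        exact tsupport_comp_eq_preimage φ (Homeomorph.subRight z)
      rw [this] at hx
      have := hz _ (hφ.2.2 hx)
      simpa using this
  have h1 := h _ hψ
  have e : ∀ x, pd i (fun x => φ (x - z)) x = pd i φ (x - z) := fun x => by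
    simp only [pd]
    rw [fderiv_comp_sub]
  simp only [e] at h1
  rw [← integral_add_right_eq_self (μ := volume) (fun x => u x * pd i φ (x - z)) z, ← integral_add_right_eq_self (μ := volume) (fun x => v x * φ (x - z)) z] at h1
  simpa using h1

section
variable {w w' : Euc (n + 1) → ℝ} {v v' : Fin (n + 1) → Euc (n + 1) → ℝ} {vv vv' : Fin (n + 1) → Fin (n + 1) → Euc (n + 1) → ℝ}

lemma HH_shift {z : Euc (n + 1)} (hz : z 0 = 0) (x : Euc (n + 1)) : x + z ∈ HH n ↔ x ∈ HH n := by
  simp [HH, hz]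

lemma AC.shift {d : ℕ} {w : Euc d → ℝ} (h : AC w) (z : Euc d) : AC (fun x => w (x + z)) := by
  obtain ⟨R, hR⟩ := h
  refine ⟨R + ‖z‖, ?_⟩
  have := (measurePreserving_add_right volume z).quasiMeasurePreserving.ae hR
  filter_upwards [this] with x hx hx2
  apply hx
  have : ‖x‖ ≤ ‖x + z‖ + ‖z‖ := by simpa using norm_sub_le (x + z) z
  linarith

lemma Good.shift (h : Good p w v vv) {z : Euc (n + 1)} (hz : z 0 = 0) :
    Good p (fun x => w (x + z)) (fun i x => v i (x + z)) (fun i j x => vv i j (x + z)) where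
  ac := h.ac.shift z
  w0 x hx := h.w0 _ (by rwa [HH_shift hz])
  v0 i x hx := h.v0 i _ (by rwa [HH_shift hz])
  vv0 i j x hx := h.vv0 i j _ (by rwa [HH_shift hz])
  mw := memLp_shift h.mw z
  mv i := memLp_shift (h.mv i) z
  mvv i j := memLp_shift (h.mvv i j) z
  dw i := (h.dw i).shift (fun _ _ => trivial)
  dv i j := (h.dv i j).shift (fun x hx => (HH_shift hz x).2 hx)

lemma MemLp.hh {f : Euc (n + 1) → ℝ} (h : MemLp f p volume) : MemLp f p (volume.restrict (HH n)) := h.mono_measure Measure.restrict_le_self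

lemma Good.lc (h : Good p w v vv) (h' : Good p w' v' vv') (c c' : ℝ) :
    Good p (fun x => c * w x + c' * w' x) (fun i x => c * v i x + c' * v' i x) (fun i j x => c * vv i j x + c' * vv' i j x) where
  ac := by
    obtain ⟨R, hR⟩ := h.ac
    obtain ⟨R', hR'⟩ := h'.ac
    refine ⟨max R R', ?_⟩
    filter_upwards [hR, hR'] with x h1 h2 hx
    rw [h1 (lt_of_le_of_lt (le_max_left _ _) hx), h2 (lt_of_le_of_lt (le_max_right _ _) hx)]
    ring
  w0 x hx := by simp only [h.w0 x hx, h'.w0 x hx]; ring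
  v0 i x hx := by simp only [h.v0 i x hx, h'.v0 i x hx]; ring
  vv0 i j x hx := by simp only [h.vv0 i j x hx, h'.vv0 i j x hx]; ring
  mw := (h.mw.const_mul c).add (h'.mw.const_mul c')
  mv i := ((h.mv i).const_mul c).add ((h'.mv i).const_mul c')
  mvv i j := ((h.mvv i j).const_mul c).add ((h'.mvv i j).const_mul c')
  dw i := by
    have := WD.add (p := p) isOpen_univ (by simpa using h.mw.const_mul c) (by simpa using (h.mv i).const_mul c) (by simpa using h'.mw.const_mul c')
      (by simpa using (h'.mv i).const_mul c') ((h.dw i).smul c) ((h'.dw i).smul c')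
    exact this
  dv i j := by
    exact WD.add (p := p) HH_open (MemLp.hh ((h.mv i).const_mul c)) (MemLp.hh ((h.mvv i j).const_mul c)) (MemLp.hh ((h'.mv i).const_mul c'))
      (MemLp.hh ((h'.mvv i j).const_mul c')) ((h.dv i j).smul c) ((h'.dv i j).smul c')

lemma ee_zero {τ : Fin (n + 1)} (hτ : τ ≠ 0) (t : ℝ) : (t • (ee τ : Euc (n + 1))) 0 = 0 := by
  simp [ee, hτ.symm]

lemma Good.dqf (h : Good p w v vv) {τ : Fin (n + 1)} (hτ : τ ≠ 0) (t : ℝ) :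
    Good p (dqf τ t w) (fun i => dqf τ t (v i)) (fun i j => dqf τ t (vv i j)) := by
  have := (h.shift (ee_zero hτ t)).lc h (1 / t) (-(1 / t))
  have e : ∀ g : Euc (n + 1) → ℝ, Ell.dqf τ t g = fun x => 1 / t * g (x + t • ee τ) + -(1 / t) * g x := fun g => by
    funext x; simp only [Ell.dqf]; ring
  simp only [e]
  exact this

lemma AC.wd {d : ℕ} {w v : Euc d → ℝ} {i : Fin d} (h : AC w) (mv : MemLp v p volume) (hW : WD Set.univ i w v) : AC v := by
  obtain ⟨R, hR⟩ := h
  refine ⟨R, ?_⟩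
  have ho : IsOpen {x : Euc d | R < ‖x‖} := isOpen_lt continuous_const continuous_norm
  have h1 : WD {x : Euc d | R < ‖x‖} i (fun _ => 0) v := by
    refine (hW.mono (Set.subset_univ _)).congr ho.measurableSet ?_ .rfl
    exact (ae_restrict_iff' ho.measurableSet).2 hR
  have := WD.unique (p := p) ho (mv.mono_measure Measure.restrict_le_self) (MemLp.zero (p := p)) h1 WD.zero
  exact (ae_restrict_iff' ho.measurableSet).1 this
end

end Ell

namespace Ell
open Heat
variable {d n : ℕ} {p : ℝ≥0∞} [hp1 : Fact (1 ≤ p)] [hp2 : Fact (p ≠ ⊤)]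

/-- convergence in `L^p` of the whole space -/
def LT (p : ℝ≥0∞) (f : ℕ → Euc d → ℝ) (g : Euc d → ℝ) : Prop :=
  (∀ m, AEStronglyMeasurable (f m) volume) ∧ AEStronglyMeasurable g volume ∧
  Tendsto (fun m => eLpNorm (fun x => f m x - g x) p volume) atTop (𝓝 0)

lemma LT.add {f f' : ℕ → Euc d → ℝ} {g g' : Euc d → ℝ} (h : LT p f g) (h' : LT p f' g') :
    LT p (fun m x => f m x + f' m x) (fun x => g x + g' x) := by
  refine ⟨fun m => (h.1 m).add (h'.1 m), h.2.1.add h'.2.1, ?_⟩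
  have := h.2.2.add h'.2.2
  rw [add_zero] at this
  refine tendsto_of_tendsto_of_tendsto_of_le_of_le tendsto_const_nhds this (fun _ => zero_le) fun m => ?_
  have e : (fun x => f m x + f' m x - (g x + g' x)) = (fun x => f m x - g x) + fun x => f' m x - g' x := by
    funext x; simp; ring
  simp only [e]
  exact eLpNorm_add_le ((h.1 m).sub h.2.1) ((h'.1 m).sub h'.2.1) hp1.out

lemma LT.sum {ι : Type*} (s : Finset ι) {f : ι → ℕ → Euc d → ℝ} {g : ι → Euc d → ℝ} (h : ∀ i ∈ s, LT p (f i) (g i)) :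
    LT p (fun m x => ∑ i ∈ s, f i m x) (fun x => ∑ i ∈ s, g i x) := by
  classical
  induction s using Finset.induction_on with
  | empty =>
    simp only [Finset.sum_empty]
    exact ⟨fun _ => aestronglyMeasurable_const, aestronglyMeasurable_const, by simp⟩
  | insert i s hi ih =>
    simp only [Finset.sum_insert hi]
    exact (h i (Finset.mem_insert_self _ _)).add (ih fun j hj => h j (Finset.mem_insert_of_mem hj))

lemma LT.mulC {f : ℕ → Euc d → ℝ} {g a : Euc d → ℝ} (h : LT p f g) (ha : Continuous a) {C : ℝ≥0} (hC : ∀ x, |a x| ≤ C) :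
    LT p (fun m x => a x * f m x) (fun x => a x * g x) := by
  refine ⟨fun m => ha.aestronglyMeasurable.mul (h.1 m), ha.aestronglyMeasurable.mul h.2.1, ?_⟩
  have := ENNReal.Tendsto.const_mul (a := (C : ℝ≥0∞)) h.2.2 (Or.inr ENNReal.coe_ne_top)
  rw [mul_zero] at this
  refine tendsto_of_tendsto_of_tendsto_of_le_of_le tendsto_const_nhds this (fun _ => zero_le) fun m => ?_
  have := norm_mul_le (p := p) (S := Set.univ) (u := fun x => f m x - g x) hC
  simpa [mul_sub] using this

lemma LT.neg {f : ℕ → Euc d → ℝ} {g : Euc d → ℝ} (h : LT p f g) : LT p (fun m x => - f m x) (fun x => - g x) := by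
  have := h.mulC (a := fun _ => -1) continuous_const (C := 1) (by simp)
  simpa using this

lemma LT.congr {f f' : ℕ → Euc d → ℝ} {g g' : Euc d → ℝ} (h : LT p f g) (e : ∀ m x, f m x = f' m x) (e' : g =ᵐ[volume] g') : LT p f' g' := by
  have : f = f' := by funext m x; exact e m x
  subst this
  refine ⟨h.1, h.2.1.congr e', ?_⟩
  refine h.2.2.congr fun m => eLpNorm_congr_ae ?_
  filter_upwards [e'] with x hx
  rw [hx]

lemma LT.unique {f : ℕ → Euc d → ℝ} {g g' : Euc d → ℝ} (h : LT p f g) (h' : LT p f g') : g =ᵐ[volume] g' := by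
  have := h.add h'.neg
  have e : eLpNorm (fun x => g x + - g' x) p volume ≤ 0 :=
    lim_le (p := p) (w := fun m x => f m x + - f m x) this.2.1 this.1 this.2.2 (A := fun _ => 0) (fun m => by simp) tendsto_const_nhds
  have := (eLpNorm_eq_zero_iff this.2.1 (p_ne_zero p)).1 (le_antisymm e zero_le)
  filter_upwards [this] with x hx
  simp only [Pi.zero_apply] at hx
  linarith

lemma LT_complete {f : ℕ → Euc d → ℝ} (hf : ∀ m, MemLp (f m) p volume)
    (h : ∀ ε : ℝ≥0∞, 0 < ε → ∃ N, ∀ m ≥ N, ∀ k ≥ N, eLpNorm (fun x => f m x - f k x) p volume < ε) :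
    ∃ g, MemLp g p volume ∧ LT p f g := by
  have hc : CauchySeq fun m => (hf m).toLp (f m) := by
    rw [EMetric.cauchySeq_iff]
    intro ε hε
    obtain ⟨N, hN⟩ := h ε hε
    refine ⟨N, fun m hm k hk => ?_⟩
    rw [Lp.edist_toLp_toLp]
    exact hN m hm k hk
  obtain ⟨g, hg⟩ := cauchySeq_tendsto_of_complete hc
  refine ⟨g, Lp.memLp g, fun m => (hf m).1, (Lp.memLp g).1, ?_⟩
  have h2 := (Lp.tendsto_Lp_iff_tendsto_eLpNorm' _ _).1 hg
  refine h2.congr fun m => eLpNorm_congr_ae ?_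
  filter_upwards [(hf m).coeFn_toLp] with x hx
  simp [hx]

lemma LT_dq {g g' : Euc d → ℝ} {i : Fin d} (hg : MemLp g p volume) (hg' : MemLp g' p volume) (hW : WD Set.univ i g g') :
    LT p (fun m : ℕ => dqf i (1 / ((m:ℝ) + 1)) g) g' :=
  ⟨fun m => (dqf_memLp hg i _).1, hg'.1, dq_tendsto hg hg' hW⟩

lemma LT_shift {g : Euc d → ℝ} {i : Fin d} (hg : MemLp g p volume) :
    LT p (fun (m : ℕ) x => g (x + (1 / ((m:ℝ) + 1)) • ee i)) g := by
  refine ⟨fun m => (memLp_shift hg _).1, hg.1, ?_⟩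
  rw [ENNReal.tendsto_atTop_zero]
  intro ε hε
  obtain ⟨δ, hδ, H⟩ := trans_cont hg hε
  obtain ⟨N, hN⟩ := exists_nat_one_div_lt hδ
  refine ⟨N, fun n hn => H _ ?_⟩
  have hle : 1 / ((n:ℝ) + 1) ≤ 1 / ((N:ℝ) + 1) := one_div_le_one_div_of_le (by positivity) (by exact_mod_cast Nat.succ_le_succ hn)
  have h0 : 0 < 1 / ((n:ℝ) + 1) := by positivity
  rw [norm_smul, Real.norm_eq_abs, abs_of_pos h0]
  have e1 : ‖(ee i : Euc d)‖ = 1 := by simp [ee]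
  rw [e1, mul_one]
  linarith

lemma Mult.dqf_unif {a : Euc d → ℝ} (ha : Mult 1 a) (i : Fin d) {η : ℝ} (hη : 0 < η) :
    ∃ N : ℕ, ∀ m ≥ N, ∀ x, |dqf i (1 / ((m:ℝ) + 1)) a x - _root_.pd i a x| ≤ η := by
  obtain ⟨h1, c, hc⟩ := ha.pd (m := 0) i
  have huc : UniformContinuous (fun x => _root_.pd i a x - c) :=
    hc.uniformContinuous_of_continuous (h1.continuous.sub continuous_const)
  obtain ⟨δ, hδ, H⟩ := Metric.uniformContinuous_iff.1 huc η hη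
  obtain ⟨N, hN⟩ := exists_nat_one_div_lt hδ
  refine ⟨N, fun m hm x => ?_⟩
  have hle : 1 / ((m:ℝ) + 1) ≤ 1 / ((N:ℝ) + 1) := one_div_le_one_div_of_le (by positivity) (by exact_mod_cast Nat.succ_le_succ hm)
  have h0 : 0 < 1 / ((m:ℝ) + 1) := by positivity
  have haC : ContDiff ℝ 1 a := by exact_mod_cast ha.1
  rw [dqf_smooth haC i h0.ne']
  set P := (volume.restrict (Set.Ioc (0:ℝ) 1)) with hP
  haveI : IsProbabilityMeasure P := ⟨by simp [hP]⟩
  have hcont : Continuous fun t : ℝ => _root_.pd i a (x + (t * (1 / ((m:ℝ) + 1))) • ee i) := h1.continuous.comp (by fun_prop)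
  have hInt : Integrable (fun t : ℝ => _root_.pd i a (x + (t * (1 / ((m:ℝ) + 1))) • ee i)) P :=
    (hcont.integrableOn_Icc (a := 0) (b := 1)).mono_set Set.Ioc_subset_Icc_self
  have e : (∫ t, _root_.pd i a (x + (t * (1 / ((m:ℝ) + 1))) • ee i) ∂P) - _root_.pd i a x
      = ∫ t, (_root_.pd i a (x + (t * (1 / ((m:ℝ) + 1))) • ee i) - _root_.pd i a x) ∂P := by
    rw [integral_sub hInt (integrable_const _)]; simp
  rw [e, ← Real.norm_eq_abs]
  have := norm_integral_le_of_norm_le_const (μ := P) (C := η) (f := fun t => _root_.pd i a (x + (t * (1 / ((m:ℝ) + 1))) • ee i) - _root_.pd i a x) ?_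
  · simpa using this
  · refine (ae_restrict_iff' measurableSet_Ioc).2 (Eventually.of_forall fun t ht => ?_)
    have := H (a := x + (t * (1 / ((m:ℝ) + 1))) • ee i) (b := x) ?_
    · rw [Real.dist_eq] at this
      rw [Real.norm_eq_abs]
      have e : _root_.pd i a (x + (t * (1 / ((m:ℝ) + 1))) • ee i) - c - (_root_.pd i a x - c) = _root_.pd i a (x + (t * (1 / ((m:ℝ) + 1))) • ee i) - _root_.pd i a x := by ring
      rw [e] at this
      exact this.le
    · rw [dist_eq_norm, add_sub_cancel_left, norm_smul, Real.norm_eq_abs, abs_of_nonneg (by have := ht.1; positivity)]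
      have e1 : ‖(ee i : Euc d)‖ = 1 := by simp [ee]
      rw [e1, mul_one]
      nlinarith [ht.2, ht.1]

lemma LT_coef {a g : Euc d → ℝ} (ha : Mult 1 a) (hg : MemLp g p volume) (i : Fin d) :
    LT p (fun (m : ℕ) x => dqf i (1 / ((m:ℝ) + 1)) a x * g (x + (1 / ((m:ℝ) + 1)) • ee i)) (fun x => pd i a x * g x) := by
  have hpd := ha.pd (m := 0) i
  obtain ⟨C, hC⟩ := hpd.bdd
  have h2 := (LT_shift (i := i) hg).mulC hpd.1.continuous hC
  have hac : Continuous a := ha.1.continuous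
  have hdc : ∀ m : ℕ, Continuous (dqf i (1 / ((m:ℝ) + 1)) a) := fun m => by
    unfold dqf; fun_prop
  have h1 : LT p (fun (m : ℕ) x => (dqf i (1 / ((m:ℝ) + 1)) a x - pd i a x) * g (x + (1 / ((m:ℝ) + 1)) • ee i)) (fun _ => 0) := by
    refine ⟨fun m => ((hdc m).sub hpd.1.continuous).aestronglyMeasurable.mul (memLp_shift hg _).1, aestronglyMeasurable_const, ?_⟩
    rw [ENNReal.tendsto_atTop_zero]
    intro ε hε
    obtain ⟨η, hη, hη2⟩ := ENNReal.exists_nnreal_pos_mul_lt hg.2.ne hε.ne'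
    obtain ⟨N, hN⟩ := ha.dqf_unif i (η := η) (by exact_mod_cast hη)
    refine ⟨N, fun m hm => ?_⟩
    simp only [sub_zero]
    have := norm_mul_le (p := p) (S := Set.univ) (u := fun x => g (x + (1 / ((m:ℝ) + 1)) • ee i)) (hN m hm)
    rw [Measure.restrict_univ, eLpNorm_shift hg.1] at this
    exact this.trans hη2.le
  refine (h1.add h2).congr (fun m x => by ring) (Eventually.of_forall fun x => by simp)

section
variable {w : Euc (n + 1) → ℝ} {v : Fin (n + 1) → Euc (n + 1) → ℝ} {vv : Fin (n + 1) → Fin (n + 1) → Euc (n + 1) → ℝ}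

lemma dq_good (h1p : 1 < p) {ε : ℝ} {C : ℝ≥0} (hcz : ∀ a : Fin (n + 1) → Fin (n + 1) → Euc (n + 1) → ℝ,
    Near ε a → (∀ i j, Continuous (a i j)) → ∀ w v vv, Good p w v vv →
    ∀ i j, eLpNorm (vv i j) p volume ≤ C * eLpNorm (fun x => ∑ i, ∑ j, a i j x * vv i j x) p volume)
    {a : Fin (n + 1) → Fin (n + 1) → Euc (n + 1) → ℝ} (ha : Near ε a) (hm : ∀ i j, Mult 1 (a i j)) (h : Good p w v vv)
    {τ : Fin (n + 1)} (hτ : τ ≠ 0) {Fτ : Euc (n + 1) → ℝ} (mF : MemLp Fτ p volume) (F0 : ∀ x ∉ HH n, Fτ x = 0)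
    (hF : WD (HH n) τ (fun x => ∑ i, ∑ j, a i j x * vv i j x) Fτ) :
    ∃ z, Good p (v τ) (fun i => vv i τ) z ∧
      (fun x => ∑ i, ∑ j, a i j x * z i j x) =ᵐ[volume] fun x => Fτ x + ∑ i, ∑ j, -(pd τ (a i j) x * vv i j x) := by
  have hac : ∀ i j, Continuous (a i j) := fun i j => (hm i j).1.continuous
  choose B hB using fun i j => (hm i j).bdd
  have mF1 : MemLp (fun x => ∑ i, ∑ j, a i j x * vv i j x) p volume := by
    refine memLp_finset_sum _ fun i _ => memLp_finset_sum _ fun j _ => ?_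
    refine MemLp.of_le_mul (h.mvv i j) ((hac i j).aestronglyMeasurable.mul (h.mvv i j).1) (c := B i j) (Eventually.of_forall fun x => ?_)
    rw [norm_mul]
    exact mul_le_mul_of_nonneg_right (hB i j x) (norm_nonneg _)
  have hF' := lemT mF1 mF (fun x hx => by simp [h.vv0 _ _ x hx]) F0 hF hτ
  have L1 := LT_dq mF1 mF hF'
  -- the right-hand sides converge
  have L2 := LT.sum Finset.univ fun i _ => LT.sum Finset.univ fun j _ => (LT_coef (p := p) (hm i j) (h.mvv i j) τ).neg
  set t : ℕ → ℝ := fun m => 1 / ((m:ℝ) + 1) with ht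
  have L3 : LT p (fun m x => ∑ i, ∑ j, a i j x * dqf τ (t m) (vv i j) x) (fun x => Fτ x + ∑ i, ∑ j, -(pd τ (a i j) x * vv i j x)) := by
    refine (L1.add L2).congr (fun m x => ?_) .rfl
    simp only [dqf]
    rw [← Finset.sum_sub_distrib, Finset.sum_div, ← Finset.sum_add_distrib]
    refine Finset.sum_congr rfl fun i _ => ?_
    rw [← Finset.sum_sub_distrib, Finset.sum_div, ← Finset.sum_add_distrib]
    refine Finset.sum_congr rfl fun j _ => ?_
    ring
  have hz : ∀ i j, ∃ z, MemLp z p volume ∧ LT p (fun m => dqf τ (t m) (vv i j)) z := by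
    intro i j
    refine LT_complete (fun m => dqf_memLp (h.mvv i j) τ _) fun η hη => ?_
    obtain ⟨η', hη', hη2⟩ := ENNReal.exists_nnreal_pos_mul_lt (a := (2 * C : ℝ≥0)) ENNReal.coe_ne_top hη.ne'
    obtain ⟨N, hN⟩ := ENNReal.tendsto_atTop_zero.1 L3.2.2 η' (by exact_mod_cast hη')
    refine ⟨N, fun m hm k hk => ?_⟩
    have G := (h.dqf hτ (t m)).lc (h.dqf hτ (t k)) 1 (-1)
    have e := hcz a ha hac _ _ _ G i j
    have e0 : (fun x => dqf τ (t m) (vv i j) x - dqf τ (t k) (vv i j) x) = fun x => 1 * dqf τ (t m) (vv i j) x + -1 * dqf τ (t k) (vv i j) x := by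
      funext x; ring
    rw [e0]
    refine lt_of_le_of_lt e (lt_of_le_of_lt ?_ hη2)
    set Gl := fun x => Fτ x + ∑ i, ∑ j, -(pd τ (a i j) x * vv i j x)
    have e1 : (fun x => ∑ i, ∑ j, a i j x * (1 * dqf τ (t m) (vv i j) x + -1 * dqf τ (t k) (vv i j) x))
        = (fun x => ∑ i, ∑ j, a i j x * dqf τ (t m) (vv i j) x - Gl x) - (fun x => ∑ i, ∑ j, a i j x * dqf τ (t k) (vv i j) x - Gl x) := by
      funext x
      simp only [Pi.sub_apply, sub_sub_sub_cancel_right, ← Finset.sum_sub_distrib]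
      refine Finset.sum_congr rfl fun i _ => Finset.sum_congr rfl fun j _ => ?_
      ring
    rw [e1]
    calc (C : ℝ≥0∞) * _ ≤ C * (η' + η') := by
          gcongr
          refine (eLpNorm_sub_le ((L3.1 m).sub L3.2.1) ((L3.1 k).sub L3.2.1) hp1.out).trans ?_
          exact add_le_add (hN m hm) (hN k hk)
      _ = _ := by push_cast; ring
  choose z mz Lz using hz
  have mz' : ∀ i j, MemLp ((HH n).indicator (z i j)) p volume := fun i j => (mz i j).indicator HH_open.measurableSet
  have ez : ∀ i j, (HH n).indicator (z i j) =ᵐ[volume] z i j := by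
    intro i j
    have l2 : LT p (fun m => dqf τ (t m) (vv i j)) ((HH n).indicator (z i j)) := by
      refine ⟨(Lz i j).1, (mz' i j).1, ?_⟩
      refine tendsto_of_tendsto_of_tendsto_of_le_of_le tendsto_const_nhds (Lz i j).2.2 (fun _ => zero_le) fun m => ?_
      refine eLpNorm_mono fun x => ?_
      by_cases hx : x ∈ HH n
      · rw [Set.indicator_of_mem hx]
      · have e0 : dqf τ (t m) (vv i j) x = 0 := (h.dqf hτ (t m)).vv0 i j x hx
        rw [Set.indicator_of_notMem hx]
        simp only [e0, sub_zero, norm_zero, norm_nonneg]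
    exact l2.unique (Lz i j)
  refine ⟨fun i j => (HH n).indicator (z i j), ⟨?_, h.v0 τ, fun i => h.vv0 i τ, ?_, h.mv τ, fun i => h.mvv i τ, mz', ?_, ?_⟩, ?_⟩
  · exact h.ac.wd (h.mv τ) (h.dw τ)
  · intro i j x hx; exact Set.indicator_of_notMem hx _
  · intro i
    exact WD.schwarz (h.dw τ) (h.dw i) (h.tan i hτ)
  · intro i j
    have hl := LT_dq (h.mv i) (h.mvv i τ) (h.tan i hτ)
    have := WD.lim (p := p) HH_open (i := j) (MemLp.hh (h.mvv i τ)) (MemLp.hh (mz i j)) (w := fun m => dqf τ (t m) (v i)) (z := fun m => dqf τ (t m) (vv i j))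
      (fun m => MemLp.hh (dqf_memLp (h.mv i) τ _)) (fun m => MemLp.hh (dqf_memLp (h.mvv i j) τ _)) 
      (tendsto_of_tendsto_of_tendsto_of_le_of_le tendsto_const_nhds hl.2.2 (fun _ => zero_le) fun m => eLpNorm_mono_measure _ Measure.restrict_le_self)
      (tendsto_of_tendsto_of_tendsto_of_le_of_le tendsto_const_nhds (Lz i j).2.2 (fun _ => zero_le) fun m => eLpNorm_mono_measure _ Measure.restrict_le_self)
      (fun m => (h.dqf hτ (t m)).dv i j)
    exact this.congr HH_open.measurableSet .rfl (ae_restrict_of_ae (ez i j).symm)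
  · have := LT.sum Finset.univ fun i _ => LT.sum Finset.univ fun j _ => (Lz i j).mulC (hac i j) (hB i j)
    have e := this.unique L3
    have e2 : ∀ᵐ x, ∀ i j, (HH n).indicator (z i j) x = z i j x := by
      rw [ae_all_iff]; intro i; rw [ae_all_iff]; exact ez i
    filter_upwards [e, e2] with x h1 h2
    rw [← h1]
    exact Finset.sum_congr rfl fun i _ => Finset.sum_congr rfl fun j _ => by rw [h2]
end

end Ell

namespace Ell
open Heat
variable {d n : ℕ} {p : ℝ≥0∞} [hp1 : Fact (1 ≤ p)] [hp2 : Fact (p ≠ ⊤)]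

lemma Wb.mults {Ω : Set (Euc d)} (hΩ : IsOpen Ω) {ι : Type*} (s : Finset ι) {m : ℕ} {a : ι → Euc d → ℝ} (ha : ∀ i, Mult m (a i)) :
    ∃ C : ℝ≥0, ∀ (u : ι → Euc d → ℝ) M, (∀ i ∈ s, Wb Ω p m (u i) M) → Wb Ω p m (fun x => ∑ i ∈ s, a i x * u i x) (C * M) := by
  choose C hC using fun i => Wb.mult (p := p) hΩ (ha i)
  refine ⟨∑ i ∈ s, C i, fun u M h => ?_⟩
  rw [Finset.sum_mul]
  exact Wb.sum hΩ s fun i hi => hC i _ _ (h i hi)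

lemma hh_norm {f : Euc (n + 1) → ℝ} (h0 : ∀ x ∉ HH n, f x = 0) : eLpNorm f p (volume.restrict (HH n)) = eLpNorm f p volume := by
  rw [← eLpNorm_indicator_eq_eLpNorm_restrict HH_open.measurableSet]
  congr 1
  funext x
  by_cases hx : x ∈ HH n
  · rw [Set.indicator_of_mem hx]
  · rw [Set.indicator_of_notMem hx, h0 x hx]

lemma hs (h1p : 1 < p) (n : ℕ) : ∃ ε : ℝ, 0 < ε ∧ ε ≤ 1 / 2 ∧ ∀ (k : ℕ) (a : Fin (n + 1) → Fin (n + 1) → Euc (n + 1) → ℝ), Near ε a →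
    (∀ i j, Mult k (a i j)) → ∃ C : ℝ≥0, ∀ w v vv M, Good p w v vv → Wb (HH n) p (k + 1) w M →
    Wb (HH n) p k (fun x => ∑ i, ∑ j, a i j x * vv i j x) M → Wb (HH n) p (k + 2) w (C * M) := by
  obtain ⟨ε, he, he2, C0, hcz⟩ := cz3 (p := p) h1p n
  refine ⟨ε, he, he2, fun k => ?_⟩
  induction k with
  | zero =>
    intro a ha hm
    refine ⟨max 1 C0, fun w v vv M h hw hF => ?_⟩
    have hM : M ≤ max 1 C0 * M := by
      calc M = 1 * M := (one_mul _).symm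
        _ ≤ _ := by gcongr; exact le_max_left _ _
    refine ⟨hw.1.mono hM, fun i => ⟨v i, (h.dw i).mono (Set.subset_univ _), ?_, fun j => ⟨vv i j, h.dv i j, MemLp.hh (h.mvv i j), ?_⟩⟩⟩
    · exact (Wb.lb (m := 0) (hw.deriv HH_open ((h.dw i).mono (Set.subset_univ _)) (MemLp.hh (h.mv i)))).mono hM
    · have e := hcz a ha (fun i j => (hm i j).1.continuous) w v vv h i j
      have e2 := Wb.lb hF
      rw [hh_norm (h.vv0 i j)]
      refine e.trans ?_
      push_cast
      refine mul_le_mul' (by exact_mod_cast le_max_right _ _) ?_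
      have := e2.2
      rwa [hh_norm] at this
      intro x hx
      simp [h.vv0 _ _ x hx]
  | succ k ih =>
    intro a ha hm
    obtain ⟨C1, hC1⟩ := ih a ha fun i j => (hm i j).down (Nat.le_succ k)
    have hpd : ∀ τ, ∃ C2 : ℝ≥0, ∀ (u : Fin (n + 1) × Fin (n + 1) → Euc (n + 1) → ℝ) M, (∀ i ∈ Finset.univ, Wb (HH n) p k (u i) M) →
        Wb (HH n) p k (fun x => ∑ ij, (-1 * pd τ (a ij.1 ij.2) x) * u ij x) (C2 * M) := fun τ =>
      Wb.mults HH_open Finset.univ (fun ij => (Mult.const (-1)).mul ((hm ij.1 ij.2).pd τ))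
    choose C2 hC2 using hpd
    set C3 : ℝ≥0 := 1 + ∑ τ, C2 τ with hC3
    have ha0 : ∀ x, a 0 0 x ≠ 0 := by
      intro x hx
      have := ha 0 0 x
      simp [hx] at this
      linarith
    obtain ⟨C4, hC4⟩ := Wb.mult (p := p) HH_open ((hm 0 0).inv ha0)
    obtain ⟨C5, hC5⟩ := Wb.mults (p := p) (Ω := HH n) HH_open ((Finset.univ : Finset (Fin (n + 1) × Fin (n + 1))).erase (0, 0)) (m := k + 1)
      (a := fun ij x => -1 * a ij.1 ij.2 x) (fun ij => (Mult.const (-1)).mul (hm ij.1 ij.2))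
    set C6 : ℝ≥0 := C1 * C3 with hC6
    set C7 : ℝ≥0 := C4 * (1 + C5 * C6) with hC7
    refine ⟨1 + C6 + C7, fun w v vv M h hw hF => ?_⟩
    have hv : ∀ i, Wb (HH n) p (k + 1) (v i) M := fun i => hw.deriv HH_open ((h.dw i).mono (Set.subset_univ _)) (MemLp.hh (h.mv i))
    have hvv : ∀ i j, Wb (HH n) p k (vv i j) M := fun i j => (hv i).deriv HH_open (h.dv i j) (MemLp.hh (h.mvv i j))
    -- tangential derivatives
    have htan : ∀ τ, τ ≠ 0 → Wb (HH n) p (k + 2) (v τ) (C6 * M) := by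
      intro τ hτ
      obtain ⟨Fτ', hW, hFτ'⟩ := hF.2 τ
      set Fτ := (HH n).indicator Fτ' with hFτd
      have eF : Fτ' =ᵐ[volume.restrict (HH n)] Fτ := (indicator_ae_eq_restrict HH_open.measurableSet).symm
      have hFτ := hFτ'.congr HH_open.measurableSet eF
      obtain ⟨z, hz, hzF⟩ := dq_good h1p hcz ha (fun i j => (hm i j).down (Nat.le_add_left 1 k)) h hτ (Fτ := Fτ)
        (ind_memLp HH_open hFτ'.lb.1) (fun x hx => Set.indicator_of_notMem hx _) (hW.congr HH_open.measurableSet .rfl eF)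
      rw [hC6, mul_assoc]
      refine hC1 _ _ _ _ hz ((hv τ).mono ?_) ?_
      · rw [hC3, add_mul, one_mul]; exact le_self_add
      · have h1 := hFτ.add HH_open (hC2 τ (fun ij => vv ij.1 ij.2) M fun ij _ => hvv ij.1 ij.2)
        refine (h1.mono ?_).congr HH_open.measurableSet ?_
        · rw [hC3, add_mul, one_mul]
          gcongr
          exact Finset.single_le_sum (f := C2) (fun _ _ => zero_le) (Finset.mem_univ τ)
        · refine ae_restrict_of_ae ?_
          filter_upwards [hzF] with x hx
          rw [hx, Fintype.sum_prod_type]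
          congr 1
          exact Finset.sum_congr rfl fun i _ => Finset.sum_congr rfl fun j _ => by ring
    have htt : ∀ i j, (i ≠ 0 ∨ j ≠ 0) → Wb (HH n) p (k + 1) (vv i j) (C6 * M) := by
      intro i j hij
      by_cases hi : i = 0
      · have hj : j ≠ 0 := hij.resolve_left (not_not.2 hi)
        have := (htan j hj).deriv HH_open (h.dv j i) (MemLp.hh (h.mvv j i))
        exact this.congr HH_open.measurableSet (ae_restrict_of_ae (h.symm j i))
      · exact (htan i hi).deriv HH_open (h.dv i j) (MemLp.hh (h.mvv i j))
    have h00 : Wb (HH n) p (k + 1) (vv 0 0) (C7 * M) := by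
      have h1 := hC5 (fun ij => vv ij.1 ij.2) (C6 * M) (fun ij hij => htt ij.1 ij.2 (by
        rw [Finset.mem_erase] at hij
        by_contra hc
        push Not at hc
        exact hij.1 (Prod.ext hc.1 hc.2)))
      have h2 := hC4 _ _ (hF.add HH_open h1)
      refine (h2.mono (le_of_eq ?_)).congr HH_open.measurableSet (Eventually.of_forall fun x => ?_)
      · rw [hC7]; ring
      · have e : ∑ i, ∑ j, a i j x * vv i j x = a 0 0 x * vv 0 0 x + ∑ ij ∈ (Finset.univ : Finset (Fin (n + 1) × Fin (n + 1))).erase (0, 0), a ij.1 ij.2 x * vv ij.1 ij.2 x := by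
          rw [← Fintype.sum_prod_type' (fun i j => a i j x * vv i j x), ← Finset.add_sum_erase _ _ (Finset.mem_univ (0, 0))]
        simp only
        rw [e]
        simp only [neg_mul, one_mul, Finset.sum_neg_distrib]
        rw [add_assoc, add_neg_cancel, add_zero, inv_mul_cancel_left₀ (ha0 x)]
    have hle1 : M ≤ (1 + C6 + C7) * M := by
      calc M = 1 * M := (one_mul _).symm
        _ ≤ _ := by gcongr; rw [add_assoc]; exact le_self_add
    have hle6 : C6 * M ≤ (1 + C6 + C7) * M := by
      gcongr; rw [add_comm 1, add_assoc]; exact le_self_add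
    have hle7 : C7 * M ≤ (1 + C6 + C7) * M := by
      gcongr; exact le_add_self
    refine ⟨hw.1.mono hle1, fun i => ⟨v i, (h.dw i).mono (Set.subset_univ _), (hv i).lb.mono hle1, fun j => ⟨vv i j, h.dv i j, ?_⟩⟩⟩
    by_cases hij : i ≠ 0 ∨ j ≠ 0
    · exact (htt i j hij).mono hle6
    · push Not at hij
      rw [hij.1, hij.2]
      exact h00.mono hle7

end Ell

namespace Ell
open Heat
variable {d n : ℕ}

lemma bumpify {m : ℕ} (hm : 1 ≤ m) {σ : Euc d → ℝ} {U : Set (Euc d)} (hU : IsOpen U) {x0 : Euc d} (hx0 : x0 ∈ U)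
    (hσ : ContDiffOn ℝ m σ U) (h0 : σ x0 = 0) (h1 : fderiv ℝ σ x0 = 0) {ε : ℝ} (hε : 0 < ε) :
    ∃ ψ : Euc d → ℝ, ContDiff ℝ m ψ ∧ HasCompactSupport ψ ∧ (∀ x, ‖fderiv ℝ ψ x‖ ≤ ε) ∧
      ∃ r > 0, ∀ x ∈ Metric.ball x0 r, x ∈ U ∧ ψ x = σ x := by
  have hm0 : (m : WithTop ℕ∞) ≠ 0 := by exact_mod_cast (by omega : m ≠ 0)
  let f : ContDiffBump (0 : Euc d) := ⟨1, 2, one_pos, one_lt_two⟩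
  have hfs : ContDiff ℝ (⊤ : ℕ∞) f := f.contDiff
  obtain ⟨K, hK⟩ := (hfs.lipschitzWith_of_hasCompactSupport f.hasCompactSupport (by simp))
  have hK' : ∀ x, ‖fderiv ℝ f x‖ ≤ K := fun x => norm_fderiv_le_of_lipschitz ℝ hK
  set η : ℝ := ε / (1 + 3 * K) with hη
  have hη0 : 0 < η := by positivity
  have hσd : ∀ x ∈ U, ContDiffAt ℝ m σ x := fun x hx => hσ.contDiffAt (hU.mem_nhds hx)
  have hcont : ContinuousAt (fderiv ℝ σ) x0 := by
    have h1' : ContDiffAt ℝ 1 σ x0 := (hσd x0 hx0).of_le (by exact_mod_cast hm)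
    have : ContDiffAt ℝ 0 (fderiv ℝ σ) x0 := h1'.fderiv_right (m := 0) (by simp)
    exact this.continuousAt
  have hev : ∀ᶠ x in 𝓝 x0, ‖fderiv ℝ σ x‖ < η := by
    have : Tendsto (fun x => ‖fderiv ℝ σ x‖) (𝓝 x0) (𝓝 ‖fderiv ℝ σ x0‖) := hcont.norm
    rw [h1, norm_zero] at this
    exact this.eventually (gt_mem_nhds hη0)
  obtain ⟨s, hs, hsB⟩ := Metric.eventually_nhds_iff_ball.1 (hev.and (hU.mem_nhds hx0))
  have hσle : ∀ x ∈ Metric.ball x0 s, |σ x| ≤ η * ‖x - x0‖ := by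
    intro x hx
    have := (convex_ball x0 s).norm_image_sub_le_of_norm_fderiv_le (𝕜 := ℝ) (f := σ) (C := η) (fun y hy => (hσd y (hsB y hy).2).differentiableAt hm0)
      (fun y hy => (hsB y hy).1.le) (Metric.mem_ball_self hs) hx
    rwa [h0, sub_zero] at this
  set δ : ℝ := s / 3 with hδ
  have hδ0 : 0 < δ := by positivity
  set χ : Euc d → ℝ := fun x => f (δ⁻¹ • (x - x0)) with hχ
  have hχs : ContDiff ℝ (⊤ : ℕ∞) χ := hfs.comp (by fun_prop : ContDiff ℝ (⊤ : ℕ∞) fun x : Euc d => δ⁻¹ • (x - x0))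
  have hχ0 : ∀ x ∉ Metric.ball x0 (2 * δ), χ x = 0 := by
    intro x hx
    refine f.zero_of_le_dist ?_
    rw [dist_zero_right, norm_smul, norm_inv, Real.norm_of_nonneg hδ0.le]
    rw [Metric.mem_ball, not_lt, dist_eq_norm] at hx
    show (2:ℝ) ≤ _
    rw [inv_mul_eq_div, le_div_iff₀ hδ0]
    exact hx
  have hχ1 : ∀ x ∈ Metric.ball x0 δ, χ x = 1 := by
    intro x hx
    refine f.one_of_mem_closedBall ?_
    rw [mem_closedBall_zero_iff, norm_smul, norm_inv, Real.norm_of_nonneg hδ0.le]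
    rw [Metric.mem_ball, dist_eq_norm] at hx
    show _ ≤ (1:ℝ)
    rw [inv_mul_eq_div, div_le_one hδ0]
    exact hx.le
  have hts : tsupport χ ⊆ Metric.closedBall x0 (2 * δ) := by
    refine closure_minimal (fun x hx => ?_) Metric.isClosed_closedBall
    by_contra hc
    exact hx (hχ0 x fun h => hc (Metric.ball_subset_closedBall h))
  have hsub : Metric.closedBall x0 (2 * δ) ⊆ Metric.ball x0 s := Metric.closedBall_subset_ball (by rw [hδ]; linarith)
  have hout : ∀ x ∉ Metric.closedBall x0 (2 * δ), (fun y => χ y * σ y) =ᶠ[𝓝 x] fun _ => 0 := by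
    intro x hx
    filter_upwards [Metric.isClosed_closedBall.isOpen_compl.mem_nhds hx] with y hy
    rw [hχ0 y fun h => hy (Metric.ball_subset_closedBall h), zero_mul]
  have hχb : ∀ x, |χ x| ≤ 1 := fun x => by rw [abs_of_nonneg f.nonneg]; exact f.le_one
  refine ⟨fun x => χ x * σ x, ?_, ?_, ?_, δ, hδ0, fun x hx => ⟨(hsB x (Metric.ball_subset_ball (by rw [hδ]; linarith) hx)).2, by show χ x * σ x = σ x; rw [hχ1 x hx, one_mul]⟩⟩
  · rw [contDiff_iff_contDiffAt]
    intro x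
    by_cases hx : x ∈ Metric.closedBall x0 (2 * δ)
    · exact (hχs.of_le (by exact_mod_cast le_top)).contDiffAt.mul (hσd x (hsB x (hsub hx)).2)
    · exact contDiffAt_const.congr_of_eventuallyEq (hout x hx)
  · refine HasCompactSupport.intro (isCompact_closedBall x0 (2 * δ)) fun x hx => ?_
    rw [hχ0 x fun h => hx (Metric.ball_subset_closedBall h), zero_mul]
  · intro x
    by_cases hx : x ∈ Metric.closedBall x0 (2 * δ)
    · have d1 : DifferentiableAt ℝ χ x := (hχs.differentiable (by simp)).differentiableAt
      have d2 : DifferentiableAt ℝ σ x := (hσd x (hsB x (hsub hx)).2).differentiableAt hm0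
      rw [fderiv_fun_mul d1 d2]
      have e1 : ‖fderiv ℝ χ x‖ ≤ K / δ := by
        have hL : HasFDerivAt (fun x : Euc d => δ⁻¹ • (x - x0)) (δ⁻¹ • ContinuousLinearMap.id ℝ (Euc d)) x := ((hasFDerivAt_id x).sub_const x0).const_smul δ⁻¹
        have hc := ((hfs.differentiable (by simp)).differentiableAt.hasFDerivAt (x := δ⁻¹ • (x - x0))).comp x hL
        have : fderiv ℝ χ x = (fderiv ℝ f (δ⁻¹ • (x - x0))).comp (δ⁻¹ • ContinuousLinearMap.id ℝ (Euc d)) := hc.fderiv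
        rw [this, ContinuousLinearMap.comp_smul, ContinuousLinearMap.comp_id, norm_smul, norm_inv, Real.norm_of_nonneg hδ0.le, inv_mul_eq_div]
        gcongr
        exact hK' _
      have e2 := hσle x (hsub hx)
      rw [Metric.mem_closedBall, dist_eq_norm] at hx
      calc ‖χ x • fderiv ℝ σ x + σ x • fderiv ℝ χ x‖ ≤ |χ x| * ‖fderiv ℝ σ x‖ + |σ x| * ‖fderiv ℝ χ x‖ := by
            refine (norm_add_le _ _).trans ?_
            rw [norm_smul, norm_smul]; rfl
        _ ≤ 1 * η + (η * (2 * δ)) * (K / δ) := by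
            gcongr
            · exact hχb x
            · exact (hsB x (hsub (by rwa [Metric.mem_closedBall, dist_eq_norm]))).1.le
            · exact e2.trans (by gcongr)
        _ = η * (1 + 2 * K) := by field_simp
        _ ≤ η * (1 + 3 * K) := by gcongr; norm_num
        _ = ε := by rw [hη]; field_simp
    · rw [(hout x hx).fderiv_eq]
      simp [hε.le]

lemma mkChart {m : ℕ} (hm : 1 ≤ m) (R : Euc (n + 1) ≃ₗᵢ[ℝ] Euc (n + 1)) (x0 : Euc (n + 1)) {ψ : Euc (n + 1) → ℝ} (hψ : ContDiff ℝ m ψ)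
    (hc : HasCompactSupport ψ) {ε : ℝ} (hε : ε ≤ 1 / 2) (hb : ∀ x, ‖fderiv ℝ ψ x‖ ≤ ε) :
    ∃ T : Euc (n + 1) ≃ₜ Euc (n + 1), (∀ x, T x = R (x - x0) + ψ x • ee 0) ∧ IsChart m T := by
  have hm0 : (m : WithTop ℕ∞) ≠ 0 := by exact_mod_cast (by omega : m ≠ 0)
  have hn : ‖(ee 0 : Euc (n + 1))‖ = 1 := by simp [ee]
  have hd : Differentiable ℝ ψ := hψ.differentiable hm0
  have hlip : ∀ x y, |ψ x - ψ y| ≤ (1/2 : ℝ≥0) * ‖x - y‖ := by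
    intro x y
    have := convex_univ.norm_image_sub_le_of_norm_fderiv_le (𝕜 := ℝ) (f := ψ) (C := (1/2 : ℝ≥0)) (fun y _ => hd.differentiableAt)
      (fun y _ => (hb y).trans (by push_cast; exact hε)) (Set.mem_univ y) (Set.mem_univ x)
    exact this
  set T0 : Euc (n + 1) → Euc (n + 1) := fun x => R (x - x0) + ψ x • ee 0 with hT0
  have hA : ApproximatesLinearOn T0 ((R.toContinuousLinearEquiv : Euc (n + 1) ≃L[ℝ] Euc (n + 1)) : Euc (n + 1) →L[ℝ] Euc (n + 1)) Set.univ (1/2) := by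
    intro x _ y _
    have : T0 x - T0 y - R (x - y) = (ψ x - ψ y) • ee 0 := by
      simp only [hT0, map_sub, sub_smul]; abel
    show ‖T0 x - T0 y - R (x - y)‖ ≤ _
    rw [this, norm_smul, hn, mul_one]
    exact hlip x y
  have hN : (1/2 : ℝ≥0) < ‖((R.toContinuousLinearEquiv : Euc (n + 1) ≃L[ℝ] Euc (n + 1)).symm : Euc (n + 1) →L[ℝ] Euc (n + 1))‖₊⁻¹ := by
    have : ‖((R.toContinuousLinearEquiv : Euc (n + 1) ≃L[ℝ] Euc (n + 1)).symm : Euc (n + 1) →L[ℝ] Euc (n + 1))‖₊ = 1 := by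
      ext
      exact R.symm.toLinearIsometry.norm_toContinuousLinearMap
    rw [this, inv_one, ← NNReal.coe_lt_coe]
    norm_num
  let T := hA.toHomeomorph T0 (Or.inr hN)
  have hT : ∀ x, T x = T0 x := fun x => rfl
  have hTc : ContDiff ℝ m T := by
    have : ContDiff ℝ m T0 := (R.contDiff.comp (contDiff_id.sub contDiff_const)).add (hψ.smul contDiff_const)
    exact this
  refine ⟨T, hT, hTc, ?_, R.toContinuousLinearEquiv, - R x0, ?_⟩
  · let D : Euc (n + 1) → (Euc (n + 1) →L[ℝ] Euc (n + 1)) := fun x => ((R.toContinuousLinearEquiv : Euc (n + 1) ≃L[ℝ] Euc (n + 1)) : Euc (n + 1) →L[ℝ] Euc (n + 1)) + (fderiv ℝ ψ x).smulRight (ee 0)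
    have hder : ∀ x, HasFDerivAt T0 (D x) x := by
      intro x
      have h1 : HasFDerivAt (fun x => R (x - x0)) ((R.toContinuousLinearEquiv : Euc (n + 1) ≃L[ℝ] Euc (n + 1)) : Euc (n + 1) →L[ℝ] Euc (n + 1)) x :=
        (HasFDerivAt.comp x (R.toContinuousLinearEquiv.hasFDerivAt (x := x - x0)) ((hasFDerivAt_id x).sub_const x0)).congr_fderiv (by ext; rfl)
      exact h1.add (hd.differentiableAt.hasFDerivAt.smul_const (ee 0))
    have hinj : ∀ x, Function.Injective (D x : Euc (n + 1) → Euc (n + 1)) := by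
      intro x
      rw [injective_iff_map_eq_zero]
      intro z hz
      have h1 : R z = - (fderiv ℝ ψ x z • ee 0) := eq_neg_of_add_eq_zero_left hz
      have h2 : ‖z‖ ≤ 1 / 2 * ‖z‖ := by
        calc ‖z‖ = ‖R z‖ := (R.norm_map z).symm
          _ = ‖fderiv ℝ ψ x z‖ := by rw [h1, norm_neg, norm_smul, hn, mul_one]
          _ ≤ ‖fderiv ℝ ψ x‖ * ‖z‖ := ContinuousLinearMap.le_opNorm _ _
          _ ≤ _ := by gcongr; exact (hb x).trans hε
      have : ‖z‖ ≤ 0 := by linarith [norm_nonneg z]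
      exact norm_le_zero_iff.1 this
    refine T.contDiff_symm (f₀' := fun x => (LinearEquiv.ofInjectiveEndo ((D x : Euc (n + 1) →L[ℝ] Euc (n + 1)) : Euc (n + 1) →ₗ[ℝ] Euc (n + 1)) (hinj x)).toContinuousLinearEquiv) (fun x => ?_) hTc
    refine (hder x).congr_fderiv ?_
    ext z; rfl
  · refine HasCompactSupport.intro hc.isCompact fun x hx => ?_
    rw [hT]
    have : ψ x = 0 := image_eq_zero_of_notMem_tsupport hx
    simp [hT0, this]
    abel
end Ell

namespace Ell
open Heat
variable {d n : ℕ}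

lemma iso_orth (R : Euc d ≃ₗᵢ[ℝ] Euc d) (i j : Fin d) : ∑ k, (R (ee k)) i * (R (ee k)) j = if i = j then 1 else 0 := by
  have h1 : ∀ k i, (R (ee k)) i = (R.symm (ee i)) k := by
    intro k i
    have h2 : inner ℝ (ee i) (R (ee k)) = inner ℝ (R.symm (ee i)) (ee k) := by
      rw [← R.inner_map_map (R.symm (ee i)) (ee k), R.apply_symm_apply]
    simpa [ee, EuclideanSpace.inner_single_left, EuclideanSpace.inner_single_right] using h2
  have h3 : inner ℝ (R.symm (ee i)) (R.symm (ee j)) = inner ℝ (ee i) (ee j : Euc d) := R.symm.inner_map_map _ _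
  simp_rw [h1]
  rw [PiLp.inner_apply] at h3
  simp only [RCLike.inner_apply, conj_trivial] at h3
  rw [Finset.sum_congr rfl fun k _ => mul_comm _ _, h3]
  by_cases h : i = j <;> simp [ee, EuclideanSpace.inner_single_left, h]

lemma coord_le (x : Euc d) (i : Fin d) : |x i| ≤ ‖x‖ := by
  rw [← Real.norm_eq_abs]; exact PiLp.norm_apply_le x i

lemma chart_near {m : ℕ} (hm : 1 ≤ m) (R : Euc (n + 1) ≃ₗᵢ[ℝ] Euc (n + 1)) (x0 : Euc (n + 1)) {ψ : Euc (n + 1) → ℝ} (hψ : ContDiff ℝ m ψ)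
    {ε : ℝ} (hε : ε ≤ 1) (hb : ∀ x, ‖fderiv ℝ ψ x‖ ≤ ε) {T : Euc (n + 1) ≃ₜ Euc (n + 1)} (hT : ∀ x, T x = R (x - x0) + ψ x • ee 0) :
    Near (3 * (n + 1) * ε) (fun i j y => ∑ k, pd k (fun x => T x i) (T.symm y) * pd k (fun x => T x j) (T.symm y)) := by
  have hm0 : (m : WithTop ℕ∞) ≠ 0 := by exact_mod_cast (by omega : m ≠ 0)
  have hd : Differentiable ℝ ψ := hψ.differentiable hm0
  have hε0 : 0 ≤ ε := (norm_nonneg _).trans (hb 0)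
  have hn : ∀ k, ‖(ee k : Euc (n + 1))‖ = 1 := fun k => by simp [ee]
  have hpd : ∀ k i x, pd k (fun x => T x i) x = (R (ee k)) i + pd k ψ x * (ee 0 : Euc (n+1)) i := by
    intro k i x
    have h1 : HasFDerivAt (fun x => R (x - x0)) ((R.toContinuousLinearEquiv : Euc (n + 1) ≃L[ℝ] Euc (n + 1)) : Euc (n + 1) →L[ℝ] Euc (n + 1)) x :=
        (HasFDerivAt.comp x (R.toContinuousLinearEquiv.hasFDerivAt (x := x - x0)) ((hasFDerivAt_id x).sub_const x0)).congr_fderiv (by ext; rfl)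
    have h2 := h1.add (hd.differentiableAt.hasFDerivAt.smul_const (ee 0) (x := x))
    have h3 := ((EuclideanSpace.proj i : Euc (n + 1) →L[ℝ] ℝ).hasFDerivAt).comp x h2
    have h4 : (fun x => T x i) = (EuclideanSpace.proj i : Euc (n + 1) →L[ℝ] ℝ) ∘ ((fun x => R (x - x0)) + fun y => ψ y • ee 0) := by
      funext x; simp only [hT]; rfl
    unfold pd
    rw [h4, h3.fderiv]
    rfl
  intro i j y
  set x := T.symm y
  have h1 : ∀ k i, |(R (ee k)) i| ≤ 1 := fun k i => (coord_le _ _).trans (by rw [R.norm_map, hn])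
  have h2 : ∀ k, |pd k ψ x| ≤ ε := fun k => by
    rw [← Real.norm_eq_abs]
    refine (ContinuousLinearMap.le_opNorm _ _).trans ?_
    have := hn k
    unfold ee at this
    rw [this, mul_one]; exact hb x
  have h3 : ∀ i, |(ee 0 : Euc (n + 1)) i| ≤ 1 := fun i => (coord_le _ _).trans (by rw [hn])
  simp only [hpd]
  rw [← iso_orth R i j, ← Finset.sum_sub_distrib]
  refine (Finset.abs_sum_le_sum_abs _ _).trans ?_
  have h4 : ∀ k ∈ (Finset.univ : Finset (Fin (n + 1))), |((R (ee k)) i + pd k ψ x * (ee 0 : Euc (n + 1)) i) * ((R (ee k)) j + pd k ψ x * (ee 0 : Euc (n + 1)) j) - (R (ee k)) i * (R (ee k)) j| ≤ 3 * ε := by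
    intro k _
    have hq : ∀ i, |pd k ψ x * (ee 0 : Euc (n + 1)) i| ≤ ε := fun i => by
      rw [abs_mul]; calc _ ≤ ε * 1 := by gcongr; exact h2 k; exact h3 i
        _ = ε := mul_one _
    have e : ∀ a b c d : ℝ, |a| ≤ 1 → |b| ≤ ε → |c| ≤ 1 → |d| ≤ ε → |(a + b) * (c + d) - a * c| ≤ 3 * ε := by
      intro a b c d ha hb' hc hd'
      have e0 : (a + b) * (c + d) - a * c = a * d + b * c + b * d := by ring
      rw [e0]
      refine (abs_add_three _ _ _).trans ?_
      rw [abs_mul a, abs_mul b, abs_mul b]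
      calc _ ≤ 1 * ε + ε * 1 + 1 * ε := by
            gcongr
            exact hb'.trans hε
        _ = 3 * ε := by ring
    exact e _ _ _ _ (h1 k i) (hq i) (h1 k j) (hq j)
  refine (Finset.sum_le_sum h4).trans ?_
  rw [Finset.sum_const, Finset.card_univ, Fintype.card_fin, nsmul_eq_mul]
  push_cast
  exact le_of_eq (by ring)

/-- A chart flattening `Ω` near `x0`. -/
def ChartAt (m : ℕ) (ε : ℝ) (Ω : Set (Euc (n + 1))) (x0 : Euc (n + 1)) (T : Euc (n + 1) ≃ₜ Euc (n + 1)) (r : ℝ) : Prop :=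
  IsChart m T ∧ Near ε (fun i j y => ∑ k, pd k (fun x => T x i) (T.symm y) * pd k (fun x => T x j) (T.symm y)) ∧
    0 < r ∧ ∀ x ∈ Metric.ball x0 r, (x ∈ Ω ↔ T x ∈ HH n)

lemma chart_ex {m : ℕ} (hm : 1 ≤ m) {Ω : Set (Euc (n + 1))} (hΩ : IsOpen Ω) (hB : HasCkBoundary Ω (m : ℕ∞)) {ε : ℝ} (hε : 0 < ε)
    {x0 : Euc (n + 1)} (hx0 : x0 ∈ closure Ω) : ∃ T r, ChartAt m ε Ω x0 T r := by
  set ε' : ℝ := min (1/2) (ε / (3 * (n + 1))) with hε'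
  have hε'0 : 0 < ε' := by positivity
  have hε'1 : ε' ≤ 1/2 := min_le_left _ _
  have hε'2 : 3 * (n + 1) * ε' ≤ ε := by
    calc 3 * ((n:ℝ) + 1) * ε' ≤ 3 * (n + 1) * (ε / (3 * (n + 1))) := by gcongr; exact min_le_right _ _
      _ = ε := by field_simp
  have hm0 : (m : WithTop ℕ∞) ≠ 0 := by exact_mod_cast (by omega : m ≠ 0)
  by_cases hx : x0 ∈ Ω
  · obtain ⟨T, hT, hTc⟩ := mkChart hm (LinearIsometryEquiv.refl ℝ (Euc (n + 1))) (x0 - ee 0) (ψ := fun _ => 0) contDiff_const HasCompactSupport.zero hε'1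
      (fun x => by simp [hε'0.le])
    obtain ⟨r, hr, hrΩ⟩ := Metric.isOpen_iff.1 hΩ x0 hx
    refine ⟨T, min r 1, hTc, ?_, by positivity, ?_⟩
    · have := chart_near hm (LinearIsometryEquiv.refl ℝ (Euc (n + 1))) (x0 - ee 0) (ψ := fun _ => 0) contDiff_const (by linarith : ε' ≤ 1)
        (fun x => by simp [hε'0.le]) hT
      exact fun i j x => (this i j x).trans hε'2
    · intro x hxb
      have h1 : x ∈ Ω := hrΩ (Metric.ball_subset_ball (min_le_left _ _) hxb)
      refine iff_of_true h1 ?_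
      show 0 < T x 0
      have h2 : |(x - x0) 0| < 1 := (coord_le _ _).trans_lt (by
        rw [← dist_eq_norm]; exact (Metric.mem_ball.1 hxb).trans_le (min_le_right _ _))
      have h3 : T x 0 = (x - x0) 0 + 1 := by
        rw [hT]; simp [ee]; ring
      rw [h3]
      linarith [neg_abs_le ((x - x0) 0)]
  · have hfr : x0 ∈ frontier Ω := by rw [hΩ.frontier_eq]; exact ⟨hx0, hx⟩
    obtain ⟨U, ρ, hU, hxU, hρ, hρ', h1, h2⟩ := hB x0 hfr
    have hρ0 : ρ x0 = 0 := by
      have : x0 ∈ frontier Ω ∩ U := ⟨hfr, hxU⟩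
      rw [h2] at this; exact this.2
    have hρc : ContDiffOn ℝ m ρ U := hρ
    have hρd : DifferentiableAt ℝ ρ x0 := (hρc.contDiffAt (hU.mem_nhds hxU)).differentiableAt hm0
    set g : Euc (n + 1) := (InnerProductSpace.toDual ℝ (Euc (n + 1))).symm (fderiv ℝ ρ x0) with hg
    have hgL : ∀ z, inner ℝ g z = fderiv ℝ ρ x0 z := fun z => InnerProductSpace.toDual_symm_apply
    have hg0 : ‖g‖ ≠ 0 := by
      rw [hg, LinearIsometryEquiv.norm_map, norm_ne_zero_iff]; exact hρ' x0 hxU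
    have hgp : 0 < ‖g‖ := lt_of_le_of_ne (norm_nonneg _) hg0.symm
    set e : Euc (n + 1) := (-‖g‖⁻¹) • g with he
    have hen : ‖e‖ = ‖(ee 0 : Euc (n + 1))‖ := by
      rw [he, norm_smul, norm_neg, norm_inv, norm_norm, inv_mul_cancel₀ hg0]; simp [ee]
    set R : Euc (n + 1) ≃ₗᵢ[ℝ] Euc (n + 1) := Submodule.reflection (ℝ ∙ (e - ee 0))ᗮ with hR
    have hRe : R e = ee 0 := Submodule.reflection_sub hen
    have hR0 : ∀ z, (R z) 0 = -‖g‖⁻¹ * fderiv ℝ ρ x0 z := by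
      intro z
      have e1 : inner ℝ (ee 0) (R z) = inner ℝ e z := by rw [← hRe, R.inner_map_map]
      have e2 : (R z) 0 = inner ℝ (ee 0) (R z) := by simp [ee, EuclideanSpace.inner_single_left]
      rw [e2, e1, he, real_inner_smul_left, hgL]
    set σ : Euc (n + 1) → ℝ := fun x => -‖g‖⁻¹ * ρ x - (-‖g‖⁻¹ * fderiv ℝ ρ x0 (x - x0)) with hσ
    have hσc : ContDiffOn ℝ m σ U := (contDiffOn_const.mul hρc).sub (by fun_prop)
    have hσ0 : σ x0 = 0 := by simp [hσ, hρ0]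
    have hσ1 : fderiv ℝ σ x0 = 0 := by
      have a1 : HasFDerivAt (fun x => fderiv ℝ ρ x0 (x - x0)) (fderiv ℝ ρ x0) x0 :=
        (HasFDerivAt.comp x0 (fderiv ℝ ρ x0).hasFDerivAt ((hasFDerivAt_id x0).sub_const x0)).congr_fderiv (by ext; rfl)
      have a2 := (hρd.hasFDerivAt.const_mul (-‖g‖⁻¹)).fun_sub (a1.const_mul (-‖g‖⁻¹))
      rw [a2.fderiv, sub_self]
    obtain ⟨ψ, hψ, hψc, hψb, r, hr, hrψ⟩ := bumpify hm hU hxU hσc hσ0 hσ1 hε'0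
    obtain ⟨T, hT, hTc⟩ := mkChart hm R x0 hψ hψc hε'1 hψb
    refine ⟨T, r, hTc, ?_, hr, ?_⟩
    · exact fun i j x => (chart_near hm R x0 hψ (by linarith : ε' ≤ 1) hψb hT i j x).trans hε'2
    · intro x hxb
      obtain ⟨hxU', hψx⟩ := hrψ x hxb
      have e1 : T x 0 = -‖g‖⁻¹ * ρ x := by
        have : T x 0 = (R (x - x0)) 0 + ψ x := by rw [hT]; simp [ee]
        rw [this, hψx, hR0, hσ]; ring
      have e2 : x ∈ Ω ↔ ρ x < 0 := by
        have : x ∈ Ω ∩ U ↔ x ∈ {y ∈ U | ρ y < 0} := by rw [h1]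
        simpa [hxU'] using this
      rw [e2]
      show ρ x < 0 ↔ 0 < T x 0
      rw [e1, neg_mul, neg_pos]
      constructor
      · intro h; exact mul_neg_of_pos_of_neg (by positivity) h
      · intro h
        by_contra hc
        push Not at hc
        have : 0 ≤ ‖g‖⁻¹ * ρ x := by positivity
        linarith
end Ell

namespace Ell
open Heat
variable {d n : ℕ} {p : ℝ≥0∞} [hp1 : Fact (1 ≤ p)] [hp2 : Fact (p ≠ ⊤)]

structure Gd (Ω : Set (Euc d)) (p : ℝ≥0∞) (w : Euc d → ℝ) (v : Fin d → Euc d → ℝ) (vv : Fin d → Fin d → Euc d → ℝ) : Prop where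
  w0 : ∀ x ∉ Ω, w x = 0
  v0 : ∀ i, ∀ x ∉ Ω, v i x = 0
  vv0 : ∀ i j, ∀ x ∉ Ω, vv i j x = 0
  mw : MemLp w p volume
  mv : ∀ i, MemLp (v i) p volume
  mvv : ∀ i j, MemLp (vv i j) p volume
  dw : ∀ i, WD Set.univ i w (v i)
  dv : ∀ i j, WD Ω j (v i) (vv i j)

lemma MemLp.mlt {m : ℕ} {a u : Euc d → ℝ} {μ : Measure (Euc d)} (ha : Mult m a) (hu : MemLp u p μ) : MemLp (fun x => a x * u x) p μ := by
  obtain ⟨C, hC⟩ := ha.bdd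
  refine hu.of_le_mul (c := C) (ha.1.continuous.aestronglyMeasurable.mul hu.1) (Eventually.of_forall fun x => ?_)
  rw [norm_mul]
  gcongr
  exact hC x

lemma WD.fsum {Ω : Set (Euc d)} (hΩ : IsOpen Ω) {ι : Type*} (s : Finset ι) {u v : ι → Euc d → ℝ} {i : Fin d}
    (hu : ∀ k ∈ s, MemLp (u k) p (volume.restrict Ω)) (hv : ∀ k ∈ s, MemLp (v k) p (volume.restrict Ω)) (h : ∀ k ∈ s, WD Ω i (u k) (v k)) :
    WD Ω i (fun x => ∑ k ∈ s, u k x) (fun x => ∑ k ∈ s, v k x) := by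
  classical
  induction s using Finset.induction_on with
  | empty => simpa using WD.zero
  | insert b s hb ih =>
    simp only [Finset.sum_insert hb]
    exact WD.add (p := p) hΩ (hu b (Finset.mem_insert_self b s)) (hv b (Finset.mem_insert_self b s))
      (memLp_finset_sum s fun k hk => hu k (Finset.mem_insert_of_mem hk)) (memLp_finset_sum s fun k hk => hv k (Finset.mem_insert_of_mem hk))
      (h b (Finset.mem_insert_self b s))
      (ih (fun k hk => hu k (Finset.mem_insert_of_mem hk)) (fun k hk => hv k (Finset.mem_insert_of_mem hk)) (fun k hk => h k (Finset.mem_insert_of_mem hk)))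

/-- transformed first derivatives -/
noncomputable def tv (T : Euc d ≃ₜ Euc d) (v : Fin d → Euc d → ℝ) (i : Fin d) (x : Euc d) : ℝ :=
  ∑ a, pd i (fun x => T x a) x * v a (T x)
/-- transformed second derivatives -/
noncomputable def tvv (T : Euc d ≃ₜ Euc d) (v : Fin d → Euc d → ℝ) (vv : Fin d → Fin d → Euc d → ℝ) (i j : Fin d) (x : Euc d) : ℝ :=
  ∑ a, (pd i (fun x => T x a) x * (∑ b, pd j (fun x => T x b) x * vv a b (T x)) + pd j (pd i (fun x => T x a)) x * v a (T x))

lemma memLp_comp {T : Euc d ≃ₜ Euc d} (hT : IsChart 1 T) {u : Euc d → ℝ} (hu : MemLp u p volume) : MemLp (fun x => u (T x)) p volume := by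
  obtain ⟨C, hC⟩ := hT.norm p
  have := (hC Set.univ MeasurableSet.univ u).2
  simp only [Measure.restrict_univ, Set.preimage_univ] at this
  exact this hu

lemma Gd.chain {Ω : Set (Euc d)} (hΩ : IsOpen Ω) {w : Euc d → ℝ} {v vv} (h : Gd Ω p w v vv) {T : Euc d ≃ₜ Euc d} (hT : IsChart 2 T) :
    Gd (T ⁻¹' Ω) p (fun x => w (T x)) (tv T v) (tvv T v vv) := by
  have h1T : IsChart 1 T := hT.down (by norm_num)
  have hm1 : ∀ i a, Mult 1 (pd i fun x => T x a) := fun i a => IsChart.pd (m := 1) hT i a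
  have hm2 : ∀ i j a, Mult 0 (pd j (pd i fun x => T x a)) := fun i j a => (hm1 i a).pd j
  have mvt : ∀ a, MemLp (fun x => v a (T x)) p volume := fun a => memLp_comp h1T (h.mv a)
  have mvvt : ∀ a b, MemLp (fun x => vv a b (T x)) p volume := fun a b => memLp_comp h1T (h.mvv a b)
  have ms : ∀ j a, MemLp (fun x => ∑ b, pd j (fun x => T x b) x * vv a b (T x)) p volume := fun j a =>
    memLp_finset_sum _ fun b _ => MemLp.mlt (hm1 j b) (mvvt a b)
  have mterm : ∀ i j a, MemLp (fun x => pd i (fun x => T x a) x * (∑ b, pd j (fun x => T x b) x * vv a b (T x)) + pd j (pd i (fun x => T x a)) x * v a (T x)) p volume :=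
    fun i j a => (MemLp.mlt (hm1 i a) (ms j a)).add (MemLp.mlt (hm2 i j a) (mvt a))
  refine ⟨fun x hx => h.w0 _ hx, fun i x hx => ?_, fun i j x hx => ?_, memLp_comp h1T h.mw, fun i => ?_, fun i j => ?_, fun i => ?_, fun i j => ?_⟩
  · exact Finset.sum_eq_zero fun a _ => by rw [h.v0 a _ hx, mul_zero]
  · refine Finset.sum_eq_zero fun a _ => ?_
    rw [h.v0 a _ hx, mul_zero, add_zero, Finset.sum_eq_zero, mul_zero]
    intro b _
    rw [h.vv0 a b _ hx, mul_zero]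
  · exact memLp_finset_sum _ fun a _ => MemLp.mlt (hm1 i a) (mvt a)
  · exact memLp_finset_sum _ fun a _ => mterm i j a
  · have := (WD.chain (p := p) isOpen_univ h1T (by simpa using h.mw) (fun j => by simpa using h.mv j) h.dw i).2
    rw [Set.preimage_univ] at this
    exact this
  · have hΩ' : IsOpen (T ⁻¹' Ω) := hΩ.preimage T.continuous
    refine WD.fsum (p := p) hΩ' _ (fun a _ => (MemLp.mlt (hm1 i a) (mvt a)).restrict _) (fun a _ => (mterm i j a).restrict _) fun a _ => ?_
    have := WD.chain (p := p) hΩ h1T ((h.mv a).restrict _) (fun j => (h.mvv a j).restrict _) (fun j => h.dv a j) j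
    exact WD.mul (p := p) hΩ' ((mvt a).restrict _) this.1 this.2 (hm1 i a).1

/-- localised derivatives -/
noncomputable def lv (ζ u : Euc d → ℝ) (v : Fin d → Euc d → ℝ) (i : Fin d) (x : Euc d) : ℝ := ζ x * v i x + pd i ζ x * u x
noncomputable def lvv (ζ u : Euc d → ℝ) (v : Fin d → Euc d → ℝ) (vv : Fin d → Fin d → Euc d → ℝ) (i j : Fin d) (x : Euc d) : ℝ :=
  (ζ x * vv i j x + pd j ζ x * v i x) + (pd i ζ x * v j x + pd j (pd i ζ) x * u x)

lemma ind_self {Ω : Set (Euc d)} {u : Euc d → ℝ} (h : ∀ x ∉ Ω, u x = 0) : Ω.indicator u = u := by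
  funext x
  by_cases hx : x ∈ Ω
  · exact Set.indicator_of_mem hx _
  · rw [Set.indicator_of_notMem hx, h x hx]

lemma Gd.loc {Ω Ω' B : Set (Euc d)} (hΩ : IsOpen Ω) (hΩ' : IsOpen Ω') (hB : ∀ x ∈ B, (x ∈ Ω ↔ x ∈ Ω')) {u : Euc d → ℝ} {v vv} (h : Gd Ω p u v vv)
    {ζ : Euc d → ℝ} (hζ : ContDiff ℝ 2 ζ) (hc : HasCompactSupport ζ) (hs : tsupport ζ ⊆ B) :
    Gd Ω' p (fun x => ζ x * u x) (lv ζ u v) (lvv ζ u v vv) := by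
  have hm2 : Mult 2 ζ := Mult.of_cpt hζ hc
  have hm1 : ∀ i, Mult 1 (pd i ζ) := fun i => hm2.pd i
  have hm0 : ∀ i j, Mult 0 (pd j (pd i ζ)) := fun i j => (hm1 i).pd j
  have hs1 : ∀ i, tsupport (pd i ζ) ⊆ B := fun i => (pd_tsupport ζ i).trans hs
  have hs2 : ∀ i j, tsupport (pd j (pd i ζ)) ⊆ B := fun i j => (pd_tsupport _ j).trans (hs1 i)
  have hz : ∀ (η g : Euc d → ℝ), tsupport η ⊆ B → (∀ x ∉ Ω, g x = 0) → ∀ x ∉ Ω', η x * g x = 0 := by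
    intro η g hη hg x hx
    by_cases hxB : x ∈ B
    · rw [hg x fun hh => hx ((hB x hxB).1 hh), mul_zero]
    · rw [image_eq_zero_of_notMem_tsupport fun hh => hxB (hη hh), zero_mul]
  have hsub : Ω' ∩ B ⊆ Ω := fun x hx => (hB x hx.2).2 hx.1
  refine ⟨hz _ _ hs h.w0, fun i x hx => ?_, fun i j x hx => ?_, MemLp.mlt hm2 h.mw, fun i => ?_, fun i j => ?_, fun i => ?_, fun i j => ?_⟩
  · rw [lv, hz _ _ hs (h.v0 i) x hx, hz _ _ (hs1 i) h.w0 x hx, add_zero]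
  · rw [lvv, hz _ _ hs (h.vv0 i j) x hx, hz _ _ (hs1 j) (h.v0 i) x hx, hz _ _ (hs1 i) (h.v0 j) x hx, hz _ _ (hs2 i j) h.w0 x hx]; simp
  · exact (MemLp.mlt hm2 (h.mv i)).add (MemLp.mlt (hm1 i) h.mw)
  · exact ((MemLp.mlt hm2 (h.mvv i j)).add (MemLp.mlt (hm1 j) (h.mv i))).add ((MemLp.mlt (hm1 i) (h.mv j)).add (MemLp.mlt (hm0 i j) h.mw))
  · exact WD.mul (p := p) isOpen_univ (by simpa using h.mw) (by simpa using h.mv i) (h.dw i) (hζ.of_le (by norm_num))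
  · have a1 := WD.ext (p := p) hΩ hsub ((h.mv i).restrict _) ((h.mvv i j).restrict _) (h.dv i j) (hζ.of_le (by norm_num)) hs
    have a2 := WD.ext (p := p) hΩ hsub (h.mw.restrict _) ((h.mv j).restrict _) ((h.dw j).mono (Set.subset_univ Ω)) (hm1 i).1 (hs1 i)
    have z : ∀ (η g : Euc d → ℝ), (∀ x ∉ Ω, g x = 0) → Ω.indicator (fun x => η x * g x) = fun x => η x * g x :=
      fun η g hg => ind_self fun x hx => by rw [hg x hx, mul_zero]
    simp only [z _ _ (h.v0 _), z _ _ (h.vv0 _ _), z _ _ h.w0] at a1 a2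
    exact WD.add (p := p) hΩ' ((MemLp.mlt hm2 (h.mv i)).restrict _) (((MemLp.mlt hm2 (h.mvv i j)).add (MemLp.mlt (hm1 j) (h.mv i))).restrict _)
      ((MemLp.mlt (hm1 i) h.mw).restrict _) (((MemLp.mlt (hm1 i) (h.mv j)).add (MemLp.mlt (hm0 i j) h.mw)).restrict _) a1 a2

/-- The transformed Laplacian identity. -/
lemma Gd.trans_eq {Ω : Set (Euc d)} (hΩ : IsOpen Ω) {T : Euc d ≃ₜ Euc d} (hT : IsChart 2 T) {z : Euc d → ℝ} {v vv} {w : Euc d → ℝ} {v' vv'}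
    (h : Gd (T ⁻¹' Ω) p z v vv) (h' : Gd Ω p w v' vv') (hzw : ∀ x, z x = w (T x)) :
    (fun y => ∑ a, ∑ b, (∑ k, pd k (fun x => T x a) (T.symm y) * pd k (fun x => T x b) (T.symm y)) * vv' a b y) =ᵐ[volume.restrict Ω]
    fun y => (∑ k, vv k k (T.symm y)) + ∑ a, (∑ k, -1 * pd k (pd k fun x => T x a) (T.symm y)) * v' a y := by
  have hΩ' : IsOpen (T ⁻¹' Ω) := hΩ.preimage T.continuous
  have h1T : IsChart 1 T := hT.down (by norm_num)
  have h2 := h'.chain hΩ hT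
  have hz : z = fun x => w (T x) := funext hzw
  have e1 : ∀ k, v k =ᵐ[volume] tv T v' k := fun k => by
    have := WD.unique (p := p) isOpen_univ (by simpa using h.mv k) (by simpa using h2.mv k) (hz ▸ h.dw k) (h2.dw k)
    simpa using this
  have e2 : ∀ k, vv k k =ᵐ[volume.restrict (T ⁻¹' Ω)] tvv T v' vv' k k := fun k => by
    refine WD.unique (p := p) hΩ' ((h.mvv k k).restrict _) ((h2.mvv k k).restrict _) (h.dv k k) ?_
    exact (h2.dv k k).congr hΩ'.measurableSet (ae_restrict_of_ae (e1 k).symm) (EventuallyEq.refl _ _)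
  have e3 : ∀ᵐ x ∂(volume.restrict (T ⁻¹' Ω)), ∀ k, vv k k x = tvv T v' vv' k k x := ae_all_iff.2 e2
  obtain ⟨C, hC⟩ := h1T.symm.vol
  have hpre : T.symm ⁻¹' (T ⁻¹' Ω) = Ω := by ext x; simp
  have hC' := hC _ hΩ'.measurableSet
  rw [hpre] at hC'
  have hac : (volume.restrict Ω).map T.symm ≪ volume.restrict (T ⁻¹' Ω) :=
    (Measure.absolutelyContinuous_of_le hC').trans (Measure.smul_absolutelyContinuous)
  have e4 : ∀ᵐ y ∂(volume.restrict Ω), ∀ k, vv k k (T.symm y) = tvv T v' vv' k k (T.symm y) :=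
    ae_of_ae_map T.symm.continuous.measurable.aemeasurable (hac.ae_le e3)
  filter_upwards [e4] with y hy
  simp only [hy, tvv, T.apply_symm_apply, Finset.mul_sum, Finset.sum_mul, Finset.sum_add_distrib]
  have E1 : ∑ k, ∑ a, ∑ b, pd k (fun x => T x a) (T.symm y) * (pd k (fun x => T x b) (T.symm y) * vv' a b y) =
      ∑ a, ∑ b, ∑ k, pd k (fun x => T x a) (T.symm y) * pd k (fun x => T x b) (T.symm y) * vv' a b y := by
    rw [Finset.sum_comm]
    refine Finset.sum_congr rfl fun a _ => ?_
    rw [Finset.sum_comm]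
    exact Finset.sum_congr rfl fun b _ => Finset.sum_congr rfl fun k _ => by ring
  have E2 : ∑ a, ∑ k, -1 * pd k (pd k fun x => T x a) (T.symm y) * v' a y = - ∑ k, ∑ a, pd k (pd k fun x => T x a) (T.symm y) * v' a y := by
    rw [Finset.sum_comm, ← Finset.sum_neg_distrib]
    refine Finset.sum_congr rfl fun a _ => ?_
    rw [← Finset.sum_neg_distrib]
    exact Finset.sum_congr rfl fun b _ => by ring
  rw [E1, E2]; ring
end Ell

namespace Ell
open Heat
variable {n : ℕ} {p : ℝ≥0∞} [hp1 : Fact (1 ≤ p)] [hp2 : Fact (p ≠ ⊤)]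

lemma pre_symm {d : ℕ} (T : Euc d ≃ₜ Euc d) (S : Set (Euc d)) : T.symm ⁻¹' (T ⁻¹' S) = S := by ext x; simp

lemma Gd.flat {Ω : Set (Euc (n + 1))} {T : Euc (n + 1) ≃ₜ Euc (n + 1)} (hT : IsChart 2 T) {ζ u : Euc (n + 1) → ℝ} {v vv}
    (hc : HasCompactSupport ζ) (h : Gd (T ⁻¹' HH n) p (fun x => ζ x * u x) (lv ζ u v) (lvv ζ u v vv)) :
    Good p (fun y => ζ (T.symm y) * u (T.symm y)) (tv T.symm (lv ζ u v)) (tvv T.symm (lv ζ u v) (lvv ζ u v vv)) := by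
  have hΩ' : IsOpen (T ⁻¹' HH n) := HH_open.preimage T.continuous
  have g := h.chain hΩ' hT.symm
  rw [pre_symm] at g
  refine ⟨?_, g.w0, g.v0, g.vv0, g.mw, g.mv, g.mvv, g.dw, g.dv⟩
  have hK : IsCompact (T '' tsupport ζ) := hc.isCompact.image T.continuous
  obtain ⟨R, hR⟩ := hK.isBounded.exists_norm_le
  refine ⟨R, Eventually.of_forall fun y hy => ?_⟩
  have : T.symm y ∉ tsupport ζ := fun hh => absurd (hR y ⟨_, hh, T.apply_symm_apply y⟩) (not_le.2 hy)
  show ζ (T.symm y) * u (T.symm y) = 0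
  rw [image_eq_zero_of_notMem_tsupport this, zero_mul]

lemma Wb.ext0 {d : ℕ} {Ω Ω' : Set (Euc d)} (hΩ : IsOpen Ω) (hΩ' : IsOpen Ω') {B : Set (Euc d)} (hB : Ω' ∩ B ⊆ Ω) {m : ℕ} {η : Euc d → ℝ} (hη : ContDiff ℝ m η)
    (hc : HasCompactSupport η) (hs : tsupport η ⊆ B) :
    ∃ C : ℝ≥0, ∀ u M, (∀ x ∉ Ω, u x = 0) → Wb Ω p m u M → Wb Ω' p m (fun x => η x * u x) (C * M) := by
  obtain ⟨C, hC⟩ := Wb.ext (p := p) hΩ hΩ' hB hη hc hs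
  refine ⟨C, fun u M h0 h => ?_⟩
  have := hC u M h
  rwa [ind_self fun x hx => by rw [h0 x hx, mul_zero]] at this

lemma loc_reg (h1p : 1 < p) (n : ℕ) : ∃ ε : ℝ, 0 < ε ∧ ∀ (k : ℕ) (Ω : Set (Euc (n + 1))) (x0 : Euc (n + 1)) (T) (r : ℝ), IsOpen Ω → ChartAt (k + 2) ε Ω x0 T r →
    ∀ ζ : Euc (n + 1) → ℝ, ContDiff ℝ (⊤ : ℕ∞) ζ → HasCompactSupport ζ → tsupport ζ ⊆ Metric.ball x0 r →
    ∃ C : ℝ≥0, ∀ u v vv M, Gd Ω p u v vv → Wb Ω p (k + 1) u M → Wb Ω p k (fun x => ∑ i, vv i i x) M →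
      Wb (T ⁻¹' HH n) p (k + 2) (fun x => ζ x * u x) (C * M) := by
  obtain ⟨ε, hε, -, H⟩ := hs (p := p) h1p n
  refine ⟨ε, hε, fun k Ω x0 T r hΩ hch ζ hζ hc hsup => ?_⟩
  obtain ⟨hT, hnear, hr, hB⟩ := hch
  have hζm : ∀ m : ℕ, ContDiff ℝ m ζ := fun m => hζ.of_le (by exact_mod_cast le_top)
  have hTm : ∀ m ≤ k + 2, IsChart m T := fun m hm => hT.down hm
  have h1T := hTm 1 (by omega)
  have h2T := hTm 2 (by omega)
  have hΩ' : IsOpen (T ⁻¹' HH n) := HH_open.preimage T.continuous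
  have hsub : T ⁻¹' HH n ∩ Metric.ball x0 r ⊆ Ω := fun x hx => (hB x hx.2).2 hx.1
  have hmp : ∀ i a, Mult (k + 1) (pd i fun x => T x a) := fun i a => IsChart.pd (m := k + 1) hT i a
  have hSc : ContDiff ℝ k T.symm := (hTm k (by omega)).2.1
  obtain ⟨C0, hC0⟩ := H k _ hnear (fun i j => Mult.comp (Mult.sum Finset.univ fun l _ => ((hmp l i).down (by omega)).mul ((hmp l j).down (by omega))) T.symm hSc)
  have hp1s : ∀ i, ContDiff ℝ k (pd i ζ) := fun i => pd_contDiff (hζm (k + 1)) i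
  have hp2s : ∀ i, ContDiff ℝ k (pd i (pd i ζ)) := fun i => pd_contDiff (pd_contDiff (m := k + 1) (hζm (k + 1 + 1)) i) i
  have ts1 : ∀ i, tsupport (pd i ζ) ⊆ tsupport ζ := fun i => pd_tsupport ζ i
  have ts2 : ∀ i, tsupport (pd i (pd i ζ)) ⊆ tsupport ζ := fun i => (pd_tsupport _ i).trans (ts1 i)
  have hc1 : ∀ i, HasCompactSupport (pd i ζ) := fun i => hc.of_isClosed_subset (isClosed_tsupport _) (ts1 i)
  have hc2 : ∀ i, HasCompactSupport (pd i (pd i ζ)) := fun i => hc.of_isClosed_subset (isClosed_tsupport _) (ts2 i)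
  obtain ⟨C1, hC1⟩ := Wb.ext0 (p := p) hΩ hΩ' hsub (hζm k) hc hsup
  choose C2 hC2 using fun i => Wb.ext0 (p := p) hΩ hΩ' hsub (hp1s i) (hc1 i) ((ts1 i).trans hsup)
  choose C3 hC3 using fun i => Wb.ext0 (p := p) hΩ hΩ' hsub (hp2s i) (hc2 i) ((ts2 i).trans hsup)
  obtain ⟨C4, hC4⟩ := Wb.chain (p := p) hΩ' h1T.symm (hTm k (by omega)).symm
  obtain ⟨C5, hC5⟩ := Wb.ext0 (p := p) hΩ hΩ' hsub (hζm (k + 1)) hc hsup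
  obtain ⟨C6, hC6⟩ := Wb.chain (p := p) hΩ' h1T.symm (hTm (k + 1) (by omega)).symm
  rw [pre_symm] at hC4 hC6
  obtain ⟨C7, hC7⟩ := Wb.mults (p := p) (HH_open (n := n)) (Finset.univ : Finset (Fin (n + 1))) (m := k)
    (a := fun a y => ∑ l, -1 * pd l (pd l fun x => T x a) (T.symm y))
    (fun a => Mult.comp (Mult.sum Finset.univ fun l _ => (Mult.const (-1)).mul ((hmp l a).pd l)) T.symm hSc)
  obtain ⟨C9, hC9⟩ := Wb.chain (p := p) (HH_open (n := n)) h1T hT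
  set CG := C1 + ∑ i, (C2 i + C2 i + C3 i) with hCG
  refine ⟨C9 * (C0 * (C6 * C5 + (C4 * CG + C7 * (C6 * C5)))), fun u v vv M hu hW hf => ?_⟩
  have g1 := hu.loc hΩ hΩ' (B := Metric.ball x0 r) hB (hζm 2) hc hsup
  have g2 := Gd.flat (Ω := Ω) h2T hc g1
  have hvk : ∀ i, Wb Ω p k (v i) M := fun i => hW.deriv hΩ ((hu.dw i).mono (Set.subset_univ Ω)) ((hu.mv i).restrict _)
  have hG : Wb (T ⁻¹' HH n) p k (fun x => ∑ i, lvv ζ u v vv i i x) (CG * M) := by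
    have a1 := hC1 _ M (fun x hx => Finset.sum_eq_zero fun i _ => hu.vv0 i i x hx) hf
    have a2 := Wb.sum (p := p) hΩ' (Finset.univ : Finset (Fin (n + 1))) (fun i _ =>
      ((hC2 i _ M (hu.v0 i) (hvk i)).add hΩ' (hC2 i _ M (hu.v0 i) (hvk i))).add hΩ' (hC3 i _ M hu.w0 hW.pred))
    have a3 := a1.add hΩ' a2
    have e1 : C1 * M + ∑ i, (C2 i * M + C2 i * M + C3 i * M) = CG * M := by
      rw [hCG, add_mul, Finset.sum_mul]; simp only [add_mul]
    rw [e1] at a3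
    convert a3 using 2 with x
    rw [Finset.mul_sum, ← Finset.sum_add_distrib]
    exact Finset.sum_congr rfl fun i _ => by simp only [lvv]; ring
  have hw : Wb (HH n) p (k + 1) (fun y => ζ (T.symm y) * u (T.symm y)) (C6 * (C5 * M)) := hC6 _ _ (hC5 _ M hu.w0 hW)
  have hwa : ∀ a, Wb (HH n) p k (tv T.symm (lv ζ u v) a) (C6 * (C5 * M)) := fun a =>
    hw.deriv HH_open ((g2.dw a).mono (Set.subset_univ _)) ((g2.mv a).restrict _)
  have hF := (hC4 _ _ hG).add HH_open (hC7 _ _ fun a _ => hwa a)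
  have g3 : Gd (HH n) p (fun y => ζ (T.symm y) * u (T.symm y)) (tv T.symm (lv ζ u v)) (tvv T.symm (lv ζ u v) (lvv ζ u v vv)) :=
    ⟨g2.w0, g2.v0, g2.vv0, g2.mw, g2.mv, g2.mvv, g2.dw, g2.dv⟩
  have hid := g1.trans_eq HH_open h2T g3 (fun x => by simp)
  have hF' := hF.congr HH_open.measurableSet hid.symm
  have hfin := hC0 _ _ _ (C6 * (C5 * M) + (C4 * (CG * M) + C7 * (C6 * (C5 * M)))) g2 (hw.mono le_self_add) (hF'.mono le_add_self)
  have := hC9 _ _ hfin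
  simp only [Homeomorph.symm_apply_apply] at this
  refine this.mono (le_of_eq ?_)
  ring

lemma loc_int2 {Ω : Set (Euc (n + 1))} (hΩ : IsOpen Ω) {x0 : Euc (n + 1)} {T} {r : ℝ} {ε : ℝ} (hch : ChartAt 2 ε Ω x0 T r)
    {ζ : Euc (n + 1) → ℝ} (hζ : ContDiff ℝ (⊤ : ℕ∞) ζ) (hc : HasCompactSupport ζ) (hsup : tsupport ζ ⊆ Metric.ball x0 r) :
    ∃ C : ℝ≥0, ∀ u v vv M N, ∀ t : ℝ≥0, 0 < t → Gd Ω p u v vv → Wb Ω p 2 u M → Lb Ω p u N → ∀ i,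
      Lb Ω p (lv ζ u v i) (C * (t * M + t⁻¹ * N)) := by
  obtain ⟨hT, hnear, hr, hB⟩ := hch
  have hζm : ∀ m : ℕ, ContDiff ℝ m ζ := fun m => hζ.of_le (by exact_mod_cast le_top)
  have h1T : IsChart 1 T := hT.down (by omega)
  have h0T : IsChart 0 T := hT.down (by omega)
  have hΩ' : IsOpen (T ⁻¹' HH n) := HH_open.preimage T.continuous
  have hsub : T ⁻¹' HH n ∩ Metric.ball x0 r ⊆ Ω := fun x hx => (hB x hx.2).2 hx.1
  obtain ⟨C1, hC1⟩ := Wb.ext0 (p := p) hΩ hΩ' hsub (hζm 2) hc hsup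
  obtain ⟨C2, hC2⟩ := Wb.chain (p := p) hΩ' h1T.symm hT.symm
  obtain ⟨C3, hC3⟩ := Wb.ext0 (p := p) hΩ hΩ' hsub (hζm 0) hc hsup
  obtain ⟨C4, hC4⟩ := Wb.chain (p := p) hΩ' h1T.symm h0T.symm
  rw [pre_symm] at hC2 hC4
  obtain ⟨C5, hC5⟩ := Wb.chain (p := p) (HH_open (n := n)) h1T h0T
  choose C6 hC6 using fun i : Fin (n + 1) => Wb.mults (p := p) hΩ' (Finset.univ : Finset (Fin (n + 1))) (m := 0)
    (a := fun a => pd i fun x => T x a) (fun a => (IsChart.pd (m := 1) hT i a).down (by omega))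
  refine ⟨∑ i, C6 i * (C5 * (2 * (C2 * C1) + 4 * (C4 * C3))), fun u v vv M N t ht hu hW hN i => ?_⟩
  have g1 := hu.loc hΩ hΩ' (B := Metric.ball x0 r) hB (hζm 2) hc hsup
  have g2 := Gd.flat (Ω := Ω) hT hc g1
  have g3 : Gd (HH n) p (fun y => ζ (T.symm y) * u (T.symm y)) (tv T.symm (lv ζ u v)) (tvv T.symm (lv ζ u v) (lvv ζ u v vv)) :=
    ⟨g2.w0, g2.v0, g2.vv0, g2.mw, g2.mv, g2.mvv, g2.dw, g2.dv⟩
  have hw : Wb (HH n) p 2 (fun y => ζ (T.symm y) * u (T.symm y)) (C2 * (C1 * M)) := hC2 _ _ (hC1 _ M hu.w0 hW)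
  have hw0 : Wb (HH n) p 0 (fun y => ζ (T.symm y) * u (T.symm y)) (C4 * (C3 * N)) := hC4 _ _ (hC3 _ N hu.w0 hN)
  have hwii : ∀ a, Wb (HH n) p 0 (tvv T.symm (lv ζ u v) (lvv ζ u v vv) a a) (C2 * (C1 * M)) := fun a =>
    (hw.deriv HH_open ((g2.dw a).mono (Set.subset_univ _)) ((g2.mv a).restrict _)).deriv HH_open (g2.dv a a) ((g2.mvv a a).restrict _)
  have hwa : ∀ a, Wb (HH n) p 0 (tv T.symm (lv ζ u v) a) ((2 * (C2 * C1) + 4 * (C4 * C3)) * (t * M + t⁻¹ * N)) := by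
    intro a
    refine ⟨(g2.mv a).restrict _, ?_⟩
    have i1 := interp2 g2 a (t := t) (by exact_mod_cast ht)
    have b1 := (hwii a).2
    have b2 := hw0.2
    rw [hh_norm (g2.vv0 a a)] at b1
    rw [hh_norm g2.w0] at b2
    rw [hh_norm (g2.v0 a)]
    refine i1.trans ?_
    have e1 : ENNReal.ofReal (2 / (t:ℝ)) = ((2 * t⁻¹ : ℝ≥0) : ℝ≥0∞) := by
      rw [← ENNReal.ofReal_coe_nnreal]; congr 1
    rw [e1, ENNReal.ofReal_coe_nnreal]
    calc (t:ℝ≥0∞) * (2 * eLpNorm (tvv T.symm (lv ζ u v) (lvv ζ u v vv) a a) p volume) + ((2 * t⁻¹ : ℝ≥0) : ℝ≥0∞) * (2 * eLpNorm (fun y => ζ (T.symm y) * u (T.symm y)) p volume)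
        ≤ (t:ℝ≥0∞) * (2 * ((C2 * (C1 * M) : ℝ≥0) : ℝ≥0∞)) + ((2 * t⁻¹ : ℝ≥0) : ℝ≥0∞) * (2 * ((C4 * (C3 * N) : ℝ≥0) : ℝ≥0∞)) := by
          gcongr
      _ = ((t * (2 * (C2 * (C1 * M))) + 2 * t⁻¹ * (2 * (C4 * (C3 * N))) : ℝ≥0) : ℝ≥0∞) := by push_cast; ring
      _ ≤ _ := by
          rw [ENNReal.coe_le_coe]
          calc t * (2 * (C2 * (C1 * M))) + 2 * t⁻¹ * (2 * (C4 * (C3 * N))) = 2 * (C2 * C1) * (t * M) + 4 * (C4 * C3) * (t⁻¹ * N) := by ring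
            _ ≤ (2 * (C2 * C1) + 4 * (C4 * C3)) * (t * M + t⁻¹ * N) := by
                rw [add_mul]
                exact add_le_add (mul_le_mul_right le_self_add _) (mul_le_mul_right le_add_self _)
  have hb := hC6 i _ _ fun a _ => hC5 _ _ (hwa a)
  have g4 := g3.chain HH_open hT
  have hae : tv T (tv T.symm (lv ζ u v)) i =ᵐ[volume] lv ζ u v i := by
    have := WD.unique (p := p) isOpen_univ (by simpa using g4.mv i) (by simpa using g1.mv i) (g4.dw i) (by simpa using g1.dw i)
    simpa using this
  have hl : Lb (T ⁻¹' HH n) p (lv ζ u v i) _ := Lb.congr hb (ae_restrict_of_ae hae)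
  have hl2 := Lb.ind (Ω' := Ω) hΩ'.measurableSet hΩ.measurableSet hl
  rw [ind_self (g1.v0 i)] at hl2
  refine hl2.mono ?_
  calc C6 i * (C5 * ((2 * (C2 * C1) + 4 * (C4 * C3)) * (t * M + t⁻¹ * N))) = (C6 i * (C5 * (2 * (C2 * C1) + 4 * (C4 * C3)))) * (t * M + t⁻¹ * N) := by ring
    _ ≤ _ := by
      gcongr
      exact Finset.single_le_sum (f := fun i => C6 i * (C5 * (2 * (C2 * C1) + 4 * (C4 * C3)))) (fun _ _ => zero_le) (Finset.mem_univ i)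
end Ell

namespace Ell
open Heat
variable {n : ℕ} {p : ℝ≥0∞} [hp1 : Fact (1 ≤ p)] [hp2 : Fact (p ≠ ⊤)]

lemma bdry_mono {d : ℕ} {Ω : Set (Euc d)} {m m' : ℕ} (hm : m' ≤ m) (h : HasCkBoundary Ω (m : ℕ∞)) : HasCkBoundary Ω (m' : ℕ∞) := by
  intro x hx
  obtain ⟨U, ρ, h1, h2, h3, h4⟩ := h x hx
  exact ⟨U, ρ, h1, h2, h3.of_le (by exact_mod_cast hm), h4⟩

/-- two nested bumps -/
lemma bumps {d : ℕ} (x0 : Euc d) {r : ℝ} (hr : 0 < r) : ∃ ζ θ : Euc d → ℝ, ContDiff ℝ (⊤ : ℕ∞) ζ ∧ HasCompactSupport ζ ∧ tsupport ζ ⊆ Metric.ball x0 r ∧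
    ContDiff ℝ (⊤ : ℕ∞) θ ∧ HasCompactSupport θ ∧ tsupport θ ⊆ Metric.ball x0 r ∧ (∀ x, θ x * ζ x = θ x) ∧ ∃ s > 0, ∀ x ∈ Metric.ball x0 s, θ x = 1 := by
  let f : ContDiffBump x0 := ⟨r / 2, 2 * r / 3, by positivity, by linarith⟩
  let g : ContDiffBump x0 := ⟨r / 4, r / 3, by positivity, by linarith⟩
  refine ⟨f, g, f.contDiff, f.hasCompactSupport, ?_, g.contDiff, g.hasCompactSupport, ?_, fun x => ?_, r / 4, by positivity, fun x hx => ?_⟩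
  · rw [f.tsupport_eq]; exact Metric.closedBall_subset_ball (by show 2 * r / 3 < r; linarith)
  · rw [g.tsupport_eq]; exact Metric.closedBall_subset_ball (by show r / 3 < r; linarith)
  · by_cases hx : x ∈ Metric.ball x0 (r / 3)
    · rw [f.one_of_mem_closedBall, mul_one]
      exact Metric.ball_subset_closedBall (Metric.ball_subset_ball (by show r / 3 ≤ r / 2; linarith) hx)
    · rw [g.zero_of_le_dist, zero_mul]
      exact not_lt.1 hx
  · exact g.one_of_mem_closedBall (Metric.ball_subset_closedBall hx)

lemma glob_reg (h1p : 1 < p) {Ω : Set (Euc (n + 1))} (hΩ : IsOpen Ω) (hbd : Bornology.IsBounded Ω) (k : ℕ) (hB : HasCkBoundary Ω ((k + 2 : ℕ) : ℕ∞)) :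
    ∃ C : ℝ≥0, ∀ u v vv M, Gd Ω p u v vv → Wb Ω p (k + 1) u M → Wb Ω p k (fun x => ∑ i, vv i i x) M → Wb Ω p (k + 2) u (C * M) := by
  obtain ⟨ε, hε, H⟩ := loc_reg (p := p) h1p n
  have hK : IsCompact (closure Ω) := hbd.isCompact_closure
  have main : ∃ χ : Euc (n + 1) → ℝ, Mult (k + 2) χ ∧ (∀ x ∈ closure Ω, χ x = 1) ∧
      ∃ C : ℝ≥0, ∀ u v vv M, Gd Ω p u v vv → Wb Ω p (k + 1) u M → Wb Ω p k (fun x => ∑ i, vv i i x) M → Wb Ω p (k + 2) (fun x => χ x * u x) (C * M) := by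
    refine hK.induction_on (p := fun K => ∃ χ : Euc (n + 1) → ℝ, Mult (k + 2) χ ∧ (∀ x ∈ K, χ x = 1) ∧
      ∃ C : ℝ≥0, ∀ u v vv M, Gd Ω p u v vv → Wb Ω p (k + 1) u M → Wb Ω p k (fun x => ∑ i, vv i i x) M → Wb Ω p (k + 2) (fun x => χ x * u x) (C * M)) ?_ ?_ ?_ ?_
    · refine ⟨fun _ => 0, Mult.const 0, fun x hx => absurd hx (Set.notMem_empty x), 0, fun u v vv M _ _ _ => ?_⟩
      simp only [zero_mul]
      exact Wb.zero
    · rintro s t hst ⟨χ, h1, h2, h3⟩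
      exact ⟨χ, h1, fun x hx => h2 x (hst hx), h3⟩
    · rintro s t ⟨χ, h1, h2, C, h3⟩ ⟨χ', h1', h2', C', h3'⟩
      have hm : Mult (k + 2) (fun x => -1 * χ x) := (Mult.const (-1)).mul h1
      obtain ⟨C2, hC2⟩ := Wb.mult (p := p) hΩ hm
      refine ⟨fun x => χ x + χ' x + (-1 * χ x) * χ' x, (h1.add h1').add (hm.mul h1'), ?_, C + C' + C2 * C', fun u v vv M hu hW hf => ?_⟩
      · rintro x (hx | hx)
        · show χ x + χ' x + (-1 * χ x) * χ' x = 1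
          rw [h2 x hx]; ring
        · show χ x + χ' x + (-1 * χ x) * χ' x = 1
          rw [h2' x hx]; ring
      · have a1 := h3 u v vv M hu hW hf
        have a2 := h3' u v vv M hu hW hf
        have a3 := (a1.add hΩ a2).add hΩ (hC2 _ _ a2)
        convert a3 using 1
        · funext x; ring
        · ring
    · intro x0 hx0
      obtain ⟨T, r, hch⟩ := chart_ex (m := k + 2) (by omega) hΩ hB hε hx0
      obtain ⟨ζ, θ, z1, z2, z3, t1, t2, t3, hzt, s, hs0, hs1⟩ := bumps x0 hch.2.2.1
      obtain ⟨C, hC⟩ := H k Ω x0 T r hΩ hch ζ z1 z2 z3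
      have hΩ' : IsOpen (T ⁻¹' HH n) := HH_open.preimage T.continuous
      have zm : ∀ m : ℕ, ContDiff ℝ m ζ := fun m => z1.of_le (by exact_mod_cast le_top)
      have tm : ∀ m : ℕ, ContDiff ℝ m θ := fun m => t1.of_le (by exact_mod_cast le_top)
      have htm : ContDiff ℝ ((k + 2 : ℕ)) θ := tm (k + 2)
      obtain ⟨C', hC'⟩ := Wb.ext0 (p := p) hΩ' hΩ (B := Metric.ball x0 r) (fun x hx => (hch.2.2.2 x hx.2).1 hx.1) htm t2 t3
      refine ⟨Metric.ball x0 s, mem_nhdsWithin_of_mem_nhds (Metric.ball_mem_nhds x0 hs0), θ, Mult.of_cpt htm t2, hs1, C' * C, fun u v vv M hu hW hf => ?_⟩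
      have g1 := hu.loc hΩ hΩ' (B := Metric.ball x0 r) hch.2.2.2 (zm 2) z2 z3
      have := hC' _ _ g1.w0 (hC u v vv M hu hW hf)
      simp only [← mul_assoc, hzt] at this
      exact this
  obtain ⟨χ, -, h1, C, hC⟩ := main
  refine ⟨C, fun u v vv M hu hW hf => (hC u v vv M hu hW hf).congr hΩ.measurableSet ?_⟩
  filter_upwards [ae_restrict_mem hΩ.measurableSet] with x hx
  rw [h1 x (subset_closure hx), one_mul]

lemma glob_int {Ω : Set (Euc (n + 1))} (hΩ : IsOpen Ω) (hbd : Bornology.IsBounded Ω) (hB : HasCkBoundary Ω ((2 : ℕ) : ℕ∞)) :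
    ∃ C : ℝ≥0, ∀ u v vv M N, ∀ t : ℝ≥0, 0 < t → t ≤ 1 → Gd Ω p u v vv → Wb Ω p 2 u M → Lb Ω p u N → ∀ i, Lb Ω p (v i) (C * (t * M + t⁻¹ * N)) := by
  have hK : IsCompact (closure Ω) := hbd.isCompact_closure
  have main : ∃ χ : Euc (n + 1) → ℝ, Mult 0 χ ∧ (∀ x ∈ closure Ω, χ x = 1) ∧
      ∃ C : ℝ≥0, ∀ u v vv M N, ∀ t : ℝ≥0, 0 < t → t ≤ 1 → Gd Ω p u v vv → Wb Ω p 2 u M → Lb Ω p u N → ∀ i, Wb Ω p 0 (fun x => χ x * v i x) (C * (t * M + t⁻¹ * N)) := by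
    refine hK.induction_on (p := fun K => ∃ χ : Euc (n + 1) → ℝ, Mult 0 χ ∧ (∀ x ∈ K, χ x = 1) ∧
      ∃ C : ℝ≥0, ∀ u v vv M N, ∀ t : ℝ≥0, 0 < t → t ≤ 1 → Gd Ω p u v vv → Wb Ω p 2 u M → Lb Ω p u N → ∀ i, Wb Ω p 0 (fun x => χ x * v i x) (C * (t * M + t⁻¹ * N))) ?_ ?_ ?_ ?_
    · refine ⟨fun _ => 0, Mult.const 0, fun x hx => absurd hx (Set.notMem_empty x), 0, fun u v vv M N t _ _ _ _ _ i => ?_⟩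
      simp only [zero_mul]
      exact Wb.zero
    · rintro s t hst ⟨χ, h1, h2, h3⟩
      exact ⟨χ, h1, fun x hx => h2 x (hst hx), h3⟩
    · rintro s t ⟨χ, h1, h2, C, h3⟩ ⟨χ', h1', h2', C', h3'⟩
      have hm : Mult 0 (fun x => -1 * χ x) := (Mult.const (-1)).mul h1
      obtain ⟨C2, hC2⟩ := Wb.mult (p := p) hΩ hm
      refine ⟨fun x => χ x + χ' x + (-1 * χ x) * χ' x, (h1.add h1').add (hm.mul h1'), ?_, C + C' + C2 * C', fun u v vv M N t ht ht' hu hW hf i => ?_⟩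
      · rintro x (hx | hx)
        · show χ x + χ' x + (-1 * χ x) * χ' x = 1
          rw [h2 x hx]; ring
        · show χ x + χ' x + (-1 * χ x) * χ' x = 1
          rw [h2' x hx]; ring
      · have a1 := h3 u v vv M N t ht ht' hu hW hf i
        have a2 := h3' u v vv M N t ht ht' hu hW hf i
        have a3 := (a1.add hΩ a2).add hΩ (hC2 _ _ a2)
        convert a3 using 1
        · funext x; ring
        · ring
    · intro x0 hx0
      obtain ⟨T, r, hch⟩ := chart_ex (m := 2) (by omega) hΩ hB one_pos hx0
      obtain ⟨-, θ, -, -, -, t1, t2, t3, -, s, hs0, hs1⟩ := bumps x0 hch.2.2.1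
      obtain ⟨C, hC⟩ := loc_int2 (p := p) hΩ hch t1 t2 t3
      have tm : ∀ m : ℕ, ContDiff ℝ m θ := fun m => t1.of_le (by exact_mod_cast le_top)
      have htm : ContDiff ℝ ((1 : ℕ)) θ := tm 1
      have hM1 : Mult 1 θ := Mult.of_cpt htm t2
      choose C' hC' using fun i : Fin (n + 1) => Wb.mult (p := p) hΩ ((Mult.const (-1)).mul (hM1.pd i))
      refine ⟨Metric.ball x0 s, mem_nhdsWithin_of_mem_nhds (Metric.ball_mem_nhds x0 hs0), θ, hM1.down (by omega), hs1, C + ∑ i, C' i, fun u v vv M N t ht ht' hu hW hf i => ?_⟩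
      have a1 := hC u v vv M N t ht hu hW hf i
      have a2 := a1.add (hC' i u N hf)
      have a3 : Lb Ω p (fun x => θ x * v i x) (C * (t * M + t⁻¹ * N) + C' i * N) := by
        convert a2 using 1
        funext x
        simp only [lv]; ring
      refine a3.mono ?_
      rw [add_mul]
      have hN : N ≤ t * M + t⁻¹ * N := by
        refine le_trans ?_ le_add_self
        calc N = 1 * N := (one_mul N).symm
          _ ≤ t⁻¹ * N := by gcongr; exact (one_le_inv₀ ht).2 ht'
      gcongr
      exact Finset.single_le_sum (f := C') (fun _ _ => zero_le) (Finset.mem_univ i)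
  obtain ⟨χ, -, h1, C, hC⟩ := main
  refine ⟨C, fun u v vv M N t ht ht' hu hW hf i => Lb.congr (hC u v vv M N t ht ht' hu hW hf i) ?_⟩
  filter_upwards [ae_restrict_mem hΩ.measurableSet] with x hx
  rw [h1 x (subset_closure hx), one_mul]

lemma glob_base (h1p : 1 < p) {Ω : Set (Euc (n + 1))} (hΩ : IsOpen Ω) (hbd : Bornology.IsBounded Ω) (hB : HasCkBoundary Ω ((2 : ℕ) : ℕ∞)) :
    ∃ C : ℝ≥0, ∀ u v vv M, Gd Ω p u v vv → Lb Ω p u M → Lb Ω p (fun x => ∑ i, vv i i x) M → Wb Ω p 2 u (C * M) := by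
  obtain ⟨C0, hC0⟩ := glob_reg h1p hΩ hbd 0 hB
  obtain ⟨C1, hC1⟩ := glob_int (p := p) hΩ hbd hB
  set t : ℝ≥0 := (2 * (C1 * C0) + 1)⁻¹ with ht
  have ht0 : 0 < t := by positivity
  have ht1 : t ≤ 1 := inv_le_one_of_one_le₀ le_add_self
  have htC : C1 * C0 * t ≤ 1 / 2 := by
    rw [ht, ← div_eq_mul_inv, div_le_iff₀ (by positivity)]
    rw [← NNReal.coe_le_coe]; push_cast
    nlinarith [(C1 * C0).2]
  refine ⟨C0 * (2 * (1 + C1 * t⁻¹)), fun u v vv M hu hM hf => ?_⟩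
  set B : ℝ≥0 := Finset.univ.sup fun i => (eLpNorm (v i) p (volume.restrict Ω)).toNNReal with hBdef
  have hvB : ∀ i, Lb Ω p (v i) B := by
    intro i
    refine ⟨(hu.mv i).restrict _, ?_⟩
    rw [← ENNReal.coe_toNNReal (((hu.mv i).restrict Ω).2).ne, ENNReal.coe_le_coe]
    exact Finset.le_sup (f := fun i => (eLpNorm (v i) p (volume.restrict Ω)).toNNReal) (Finset.mem_univ i)
  have hW1 : Wb Ω p 1 u (M + B) := ⟨hM.mono le_self_add, fun i => ⟨v i, (hu.dw i).mono (Set.subset_univ _), (hvB i).mono le_add_self⟩⟩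
  have hW2 := hC0 u v vv (M + B) hu hW1 (hf.mono le_self_add)
  have hv := hC1 u v vv _ M t ht0 ht1 hu hW2 hM
  have hB1 : B ≤ C1 * (t * (C0 * (M + B)) + t⁻¹ * M) := by
    refine Finset.sup_le fun i _ => ?_
    have := (hv i).2
    have := ENNReal.toNNReal_mono ENNReal.coe_ne_top this
    rwa [ENNReal.toNNReal_coe] at this
  have hB2 : M + B ≤ 2 * (1 + C1 * t⁻¹) * M := by
    have h1 : C1 * (t * (C0 * (M + B)) + t⁻¹ * M) ≤ 1 / 2 * (M + B) + C1 * t⁻¹ * M := by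
      calc _ = (C1 * C0 * t) * (M + B) + C1 * t⁻¹ * M := by ring
        _ ≤ _ := by gcongr
    have h2 := hB1.trans h1
    rw [← NNReal.coe_le_coe] at h2 ⊢
    push_cast at h2 ⊢
    linarith
  refine hW2.mono ?_
  calc C0 * (M + B) ≤ C0 * (2 * (1 + C1 * t⁻¹) * M) := by gcongr
    _ = _ := by ring

lemma glob_main (h1p : 1 < p) {Ω : Set (Euc (n + 1))} (hΩ : IsOpen Ω) (hbd : Bornology.IsBounded Ω) (k : ℕ) (hB : HasCkBoundary Ω ((k + 2 : ℕ) : ℕ∞)) :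
    ∃ C : ℝ≥0, ∀ u v vv M, Gd Ω p u v vv → Lb Ω p u M → Wb Ω p k (fun x => ∑ i, vv i i x) M → Wb Ω p (k + 2) u (C * M) := by
  induction k with
  | zero => exact glob_base h1p hΩ hbd hB
  | succ k ih =>
    obtain ⟨C, hC⟩ := ih (bdry_mono (by omega) hB)
    obtain ⟨C', hC'⟩ := glob_reg h1p hΩ hbd (k + 1) hB
    refine ⟨C' * (C + 1), fun u v vv M hu hM hf => ?_⟩
    have h1 := hC u v vv M hu hM hf.pred
    have := hC' u v vv ((C + 1) * M) hu (h1.mono (by gcongr; exact le_self_add)) (hf.mono (by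
      calc M = 1 * M := (one_mul M).symm
        _ ≤ _ := by gcongr; exact le_add_self))
    rwa [← mul_assoc] at this
end Ell

namespace Ell
open Heat
variable {d : ℕ} {p : ℝ≥0∞} [hp1 : Fact (1 ≤ p)] [hp2 : Fact (p ≠ ⊤)]

/-- a function with the same distributional pairing as an `L^p` function either equals it, or pairs to zero with everything -/
lemma dich {Ω : Set (Euc d)} (hΩ : IsOpen Ω) {g w : Euc d → ℝ} (hw : MemLp w p (volume.restrict Ω))
    (H : ∀ φ, IsTestFun Ω φ → ∫ x, g x * φ x = ∫ x, w x * φ x) :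
    (g =ᵐ[volume.restrict Ω] w) ∨ (∀ φ, IsTestFun Ω φ → ∫ x, g x * φ x = 0) := by
  by_cases hI : ∀ φ, IsTestFun Ω φ → Integrable (fun x => g x * φ x)
  · left
    have hg : LocallyIntegrableOn g Ω volume := by
      intro x hx
      obtain ⟨r, hr, hrΩ⟩ := Metric.isOpen_iff.1 hΩ x hx
      obtain ⟨ζ, θ, z1, z2, z3, t1, t2, t3, -, s, hs0, hs1⟩ := bumps x hr
      refine ⟨Metric.ball x s, mem_nhdsWithin_of_mem_nhds (Metric.ball_mem_nhds x hs0), ?_⟩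
      have h1 := (hI θ ⟨t1, t2, t3.trans hrΩ⟩).integrableOn (s := Metric.ball x s)
      refine h1.congr_fun (fun y hy => ?_) measurableSet_ball
      simp only [hs1 y hy, mul_one]
    have := hΩ.ae_eq_zero_of_integral_contDiff_smul_eq_zero (μ := volume) (f := fun x => g x - w x) (hg.sub (loc_int hΩ hw)) (by
      intro φ h1 h2 h3
      have ht : IsTestFun Ω φ := ⟨h1, h2, h3⟩
      have h0 := (test_t1 ht).t0
      have e := H φ ht
      have : ∀ x, φ x • (g x - w x) = g x * φ x - w x * φ x := fun x => by rw [smul_eq_mul]; ring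
      simp only [this]
      rw [integral_sub (hI φ ht) (int_pair hΩ.measurableSet h0 hw), e, sub_self])
    exact (ae_restrict_iff' hΩ.measurableSet).2 (this.mono fun x hx hxΩ => sub_eq_zero.1 (hx hxΩ))
  · right
    push Not at hI
    obtain ⟨χ, hχ, hn⟩ := hI
    intro ψ hψ
    by_cases hi : Integrable (fun x => g x * ψ x)
    · have ht : IsTestFun Ω (fun x => ψ x + χ x) := by
        refine ⟨hψ.1.add hχ.1, hψ.2.1.add hχ.2.1, ?_⟩
        exact (tsupport_add ψ χ).trans (Set.union_subset hψ.2.2 hχ.2.2)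
      have h1 : ¬ Integrable (fun x => g x * (ψ x + χ x)) := by
        intro h
        refine hn ((h.sub hi).congr (Eventually.of_forall fun x => ?_))
        simp only [Pi.sub_apply]; ring
      have e1 := H _ ht
      rw [integral_undef h1] at e1
      have e2 := H χ hχ
      rw [integral_undef hn] at e2
      simp only [mul_add] at e1
      rw [integral_add (int_pair hΩ.measurableSet (test_t1 hψ).t0 hw) (int_pair hΩ.measurableSet (test_t1 hχ).t0 hw), ← e2, add_zero, ← H ψ hψ] at e1
      exact e1.symm
    · exact integral_undef hi

lemma dich_le {Ω : Set (Euc d)} (hΩ : IsOpen Ω) {g w : Euc d → ℝ} (hw : MemLp w p (volume.restrict Ω))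
    (H : ∀ φ, IsTestFun Ω φ → ∫ x, g x * φ x = ∫ x, w x * φ x) : eLpNorm w p (volume.restrict Ω) ≤ eLpNorm g p (volume.restrict Ω) := by
  rcases dich hΩ hw H with h | h
  · exact (eLpNorm_congr_ae h).symm.le
  · have : w =ᵐ[volume.restrict Ω] fun _ => 0 := ae_eq_of_test (p := p) hΩ hw MemLp.zero' fun φ hφ => by
      rw [← H φ hφ, h φ hφ]; simp
    rw [eLpNorm_congr_ae this]
    simp

lemma iter_test {Ω : Set (Euc d)} {m : ℕ} (a : Fin m → Fin d) {φ : Euc d → ℝ} (h : IsTestFun Ω φ) : IsTestFun Ω (iterPD a φ) := by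
  induction m generalizing φ with
  | zero => exact h
  | succ m ih => exact ih _ (test_pd h _)

lemma iter_comm {Ω : Set (Euc d)} {m : ℕ} (a : Fin m → Fin d) (i : Fin d) {φ : Euc d → ℝ} (h : IsTestFun Ω φ) :
    iterPD a (pd i φ) = pd i (iterPD a φ) := by
  induction m generalizing φ with
  | zero => rfl
  | succ m ih =>
    show iterPD _ (pd (a 0) (pd i φ)) = pd i (iterPD _ (pd (a 0) φ))
    rw [pd_comm (Tst.c2 (f := φ) ⟨h.1, h.2.1⟩) (a 0) i, ih _ (test_pd h _)]

/-- single weak derivative of multi-index `a` (whole-space integrals) -/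
def IW (Ω : Set (Euc d)) {m : ℕ} (a : Fin m → Fin d) (u w : Euc d → ℝ) : Prop :=
  ∀ φ, IsTestFun Ω φ → ∫ x, u x * iterPD a φ x = (-1 : ℝ) ^ m * ∫ x, w x * φ x

lemma hwd_iff {Ω : Set (Euc d)} {m : ℕ} {u : Euc d → ℝ} {v : (Fin m → Fin d) → Euc d → ℝ} :
    HasWeakDerivs Ω m u v ↔ ∀ a, IW Ω a u (v a) := by
  refine forall_congr' fun a => forall_congr' fun φ => forall_congr' fun hφ => ?_
  rw [set_int (test_t1 (iter_test a hφ)).t0, set_int (test_t1 hφ).t0]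

lemma IW.unique {Ω : Set (Euc d)} (hΩ : IsOpen Ω) {m : ℕ} {a : Fin m → Fin d} {u w w' : Euc d → ℝ} (h : IW Ω a u w) (h' : IW Ω a u w')
    {φ : Euc d → ℝ} (hφ : IsTestFun Ω φ) : ∫ x, w x * φ x = ∫ x, w' x * φ x := by
  have e := (h φ hφ).symm.trans (h' φ hφ)
  exact mul_left_cancel₀ (pow_ne_zero _ (by norm_num)) e

lemma Wb.of_iw {Ω : Set (Euc d)} {k : ℕ} {F : Euc d → ℝ} {M : ℝ≥0} (h0 : Lb Ω p F M)
    (h : ∀ m ≤ k, ∀ a : Fin m → Fin d, ∃ w, Lb Ω p w M ∧ IW Ω a F w) : Wb Ω p k F M := by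
  induction k generalizing F with
  | zero => exact h0
  | succ k ih =>
    refine ⟨h0, fun i => ?_⟩
    obtain ⟨v, hv, hw⟩ := h 1 (by omega) (fun _ => i)
    have hW : WD Ω i F v := fun φ hφ => by
      have := hw φ hφ
      simpa [iterPD] using this
    refine ⟨v, hW, ih hv fun m hm a => ?_⟩
    obtain ⟨w, h1, h2⟩ := h (m + 1) (by omega) (Fin.cons i a)
    refine ⟨w, h1, fun φ hφ => ?_⟩
    have e1 := h2 φ hφ
    have e2 := hW _ (iter_test a hφ)
    have e3 : iterPD (Fin.cons i a : Fin (m + 1) → Fin d) φ = iterPD a (pd i φ) := rfl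
    rw [e3, iter_comm a i hφ, e2, pow_succ] at e1
    linarith

lemma Wb.to_iw {Ω : Set (Euc d)} {m : ℕ} {u : Euc d → ℝ} {M : ℝ≥0} (h : Wb Ω p m u M) (a : Fin m → Fin d) :
    ∃ w, Lb Ω p w M ∧ IW Ω a u w := by
  induction m generalizing u with
  | zero => exact ⟨u, h, fun φ hφ => by simp [iterPD]⟩
  | succ m ih =>
    obtain ⟨v, h1, h2⟩ := h.2 (a 0)
    obtain ⟨w, h3, h4⟩ := ih h2 (fun i => a i.succ)
    refine ⟨w, h3, fun φ hφ => ?_⟩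
    show ∫ x, u x * iterPD (fun i => a i.succ) (pd (a 0) φ) x = _
    rw [iter_comm _ _ hφ, h1 _ (iter_test _ hφ), h4 φ hφ, pow_succ]
    ring

lemma w10 {Ω : Set (Euc d)} (hΩ : IsOpen Ω) {u : Euc d → ℝ} (hu : MemLp u p (volume.restrict Ω)) {v : Fin d → Euc d → ℝ}
    (hv : ∀ i, MemLp (v i) p (volume.restrict Ω)) {φ : ℕ → Euc d → ℝ} (hφ : ∀ n, IsTestFun Ω (φ n))
    (hl : Tendsto (fun n =>
        eLpNorm (fun x => u x - φ n x) p (volume.restrict Ω) +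
        ∑ i : Fin d, eLpNorm (fun x => v i x - pd i (φ n) x) p (volume.restrict Ω)) atTop (𝓝 0)) (i : Fin d) :
    WD Set.univ i (Ω.indicator u) (Ω.indicator (v i)) := by
  have key : ∀ (g ψ : Euc d → ℝ), (∀ x ∉ Ω, ψ x = 0) → eLpNorm (fun x => ψ x - Ω.indicator g x) p (volume.restrict Set.univ) =
      eLpNorm (fun x => g x - ψ x) p (volume.restrict Ω) := by
    intro g ψ h0
    rw [Measure.restrict_univ, ← eLpNorm_indicator_eq_eLpNorm_restrict hΩ.measurableSet, ← eLpNorm_neg]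
    congr 1
    funext x
    by_cases hx : x ∈ Ω
    · simp [hx]
    · simp [hx, h0 x hx]
  have mt : ∀ ψ, T0 Ω ψ → MemLp ψ p (volume.restrict Set.univ) := fun ψ h => (h.1.memLp_of_hasCompactSupport h.2.1).restrict _
  have t0 := fun n => (test_t1 (hφ n)).t0
  have t1 := fun n => (test_t1 (hφ n)).pd i
  refine WD.lim (p := p) isOpen_univ ((ind_memLp hΩ hu).restrict _) ((ind_memLp hΩ (hv i)).restrict _) (fun n => mt _ (t0 n)) (fun n => mt _ (t1 n)) ?_ ?_ ?_
  · simp only [fun n => key u (φ n) fun x hx => (t0 n).zero hx]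
    exact tendsto_of_tendsto_of_tendsto_of_le_of_le tendsto_const_nhds hl (fun _ => zero_le) fun n => le_self_add
  · simp only [fun n => key (v i) (pd i (φ n)) fun x hx => (t1 n).zero hx]
    refine tendsto_of_tendsto_of_tendsto_of_le_of_le tendsto_const_nhds hl (fun _ => zero_le) fun n => ?_
    refine le_trans ?_ le_add_self
    exact Finset.single_le_sum (f := fun i => eLpNorm (fun x => v i x - pd i (φ n) x) p (volume.restrict Ω)) (fun _ _ => zero_le) (Finset.mem_univ i)
  · intro n ψ hψ
    exact c1_ibp (test_t1 (hφ n)).1 (test_t1 hψ) i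

end Ell

namespace Ell
open Heat
variable {n : ℕ} {p : ℝ≥0∞} [hp1 : Fact (1 ≤ p)] [hp2 : Fact (p ≠ ⊤)]

lemma dk_zero {d m : ℕ} {Ω : Set (Euc d)} {q : ℝ≥0∞} : DkNorm Ω q (fun (_ : Fin m → Fin d) (_ : Euc d) => (0 : ℝ)) = 0 := by
  have e : Dmag (fun (_ : Fin m → Fin d) (_ : Euc d) => (0 : ℝ)) = fun _ => 0 := by
    funext x; simp [Dmag]
  rw [DkNorm, e]; simp

lemma lb_self {d : ℕ} {Ω : Set (Euc d)} {u : Euc d → ℝ} (h : MemLp u p (volume.restrict Ω)) :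
    Lb Ω p u (eLpNorm u p (volume.restrict Ω)).toNNReal := ⟨h, by rw [ENNReal.coe_toNNReal h.2.ne]⟩

lemma final (h1p : 1 < p) (k : ℕ) {Ω : Set (Euc (n + 1))} (hΩ : IsOpen Ω) (hbd : Bornology.IsBounded Ω) (hB : HasCkBoundary Ω ((k + 2 : ℕ) : ℕ∞)) :
    ∃ C : ℝ, 0 < C ∧
      ∀ u f : Euc (n + 1) → ℝ, MemW Ω p 2 u → MemW Ω p k f →
        IsWeakLap Ω u f → MemW10 Ω p u →
        MemW Ω p (k + 2) u ∧
        ∃ v, HasWeakDerivs Ω (k + 2) u v ∧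
          ∀ g : (m : ℕ) → (Fin m → Fin (n + 1)) → Euc (n + 1) → ℝ,
            (∀ m, m ≤ k → HasWeakDerivs Ω m f (g m)) →
            DkNorm Ω p v ≤ ENNReal.ofReal C *
              (eLpNorm u p (volume.restrict Ω) +
                ∑ m ∈ Finset.range (k + 1), DkNorm Ω p (g m)) := by
  have hm := hΩ.measurableSet
  obtain ⟨C, hC⟩ := glob_main h1p hΩ hbd k hB
  set N : ℕ := Fintype.card (Fin (k + 2) → Fin (n + 1)) with hN
  refine ⟨((N * C + 1 : ℝ≥0) : ℝ), by positivity, fun u f hu hf hlap h10 => ?_⟩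
  obtain ⟨u0, hu0, hu0L⟩ := hu 0 (by omega)
  rw [hwd_iff] at hu0
  have hu0' : ∀ φ, IsTestFun Ω φ → ∫ x, u x * φ x = ∫ x, u0 Fin.elim0 x * φ x := fun φ hφ => by
    simpa [iterPD] using hu0 Fin.elim0 φ hφ
  rcases dich hΩ (hu0L Fin.elim0) hu0' with hue | hbad
  swap
  · -- degenerate case
    have hz : ∀ m : ℕ, HasWeakDerivs Ω m u (fun _ _ => 0) := fun m => hwd_iff.2 fun a φ hφ => by
      rw [hbad _ (iter_test a hφ)]; simp
    refine ⟨fun m _ => ⟨_, hz m, fun a => MemLp.zero'⟩, _, hz _, fun g _ => ?_⟩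
    rw [dk_zero]
    exact zero_le
  have huL : MemLp u p (volume.restrict Ω) := (memLp_congr_ae hue).2 (hu0L _)
  obtain ⟨v, hv, hvL, φs, hφs, hlim⟩ := h10
  rw [hwd_iff] at hv
  have hvW : ∀ i, WD Ω i u (v i) := fun i φ hφ => by
    simpa [iterPD] using hv (fun _ => i) φ hφ
  obtain ⟨V, hV, hVL⟩ := hu 2 le_rfl
  rw [hwd_iff] at hV
  have hV' : ∀ i j φ, IsTestFun Ω φ → ∫ x, u x * pd i (pd j φ) x = ∫ x, V ![j, i] x * φ x := fun i j φ hφ => by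
    simpa [iterPD] using hV ![j, i] φ hφ
  -- the good representative
  have indE : ∀ g : Euc (n + 1) → ℝ, Ω.indicator g =ᵐ[volume.restrict Ω] g := fun g => indicator_ae_eq_restrict hm
  have G : Gd Ω p (Ω.indicator u) (fun i => Ω.indicator (v i)) (fun i j => Ω.indicator (V ![j, i])) :=
    { w0 := fun x hx => Set.indicator_of_notMem hx _
      v0 := fun i x hx => Set.indicator_of_notMem hx _
      vv0 := fun i j x hx => Set.indicator_of_notMem hx _
      mw := ind_memLp hΩ huL
      mv := fun i => ind_memLp hΩ (hvL i)
      mvv := fun i j => ind_memLp hΩ (hVL _)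
      dw := fun i => w10 hΩ huL hvL hφs hlim i
      dv := fun i j => by
        refine WD.congr hm (u := v i) (v := V ![j, i]) (fun φ hφ => ?_) (indE _).symm (indE _).symm
        rw [← hV' i j φ hφ, hvW i _ (test_pd hφ j), neg_neg] }
  -- right-hand side
  choose W hW hWL using hf
  obtain ⟨F, hFL, hF⟩ : ∃ F, MemLp F p (volume.restrict Ω) ∧ ∀ φ, IsTestFun Ω φ → ∫ x, f x * φ x = ∫ x, F x * φ x := by
    refine ⟨W 0 (by omega) Fin.elim0, hWL _ _ _, fun φ hφ => ?_⟩
    simpa [iterPD] using hwd_iff.1 (hW 0 (by omega)) Fin.elim0 φ hφ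
  have hFW : ∀ m (hm : m ≤ k) a, IW Ω a F (W m hm a) := fun m hm a φ hφ => by
    rw [← hF _ (iter_test a hφ)]
    exact hwd_iff.1 (hW m hm) a φ hφ
  have hFe : F =ᵐ[volume.restrict Ω] fun x => ∑ i, Ω.indicator (V ![i, i]) x := by
    have hs : MemLp (fun x => ∑ i, V ![i, i] x) p (volume.restrict Ω) := memLp_finsetSum _ fun i _ => hVL _
    have h1 : F =ᵐ[volume.restrict Ω] fun x => ∑ i, V ![i, i] x := by
      refine ae_eq_of_test (p := p) hΩ hFL hs fun φ hφ => ?_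
      have e := hlap φ hφ
      rw [set_int (test_t1 hφ).t0, hF φ hφ] at e
      have t2 := fun i => (test_t1 (test_pd (test_pd hφ i) i)).t0
      rw [← e]
      simp only [lap, Finset.mul_sum, Finset.sum_mul]
      rw [integral_finsetSum _ fun i _ => (int_pair hm (t2 i) huL).integrableOn, integral_finsetSum _ fun i _ => int_pair hm (test_t1 hφ).t0 (hVL _)]
      refine Finset.sum_congr rfl fun i _ => ?_
      rw [← hV' i i φ hφ, set_int (t2 i)]
    refine h1.trans ?_
    filter_upwards [ae_restrict_mem hm] with x hx
    refine Finset.sum_congr rfl fun i _ => ?_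
    rw [Set.indicator_of_mem hx]
  -- main estimate
  have main : ∀ M : ℝ≥0, Lb Ω p u M → Lb Ω p F M → (∀ m (hm : m ≤ k) a, Lb Ω p (W m hm a) M) → Wb Ω p (k + 2) u (C * M) := by
    intro M h1 h2 h3
    have hFM : Wb Ω p k F M := Wb.of_iw h2 fun m hm a => ⟨W m hm a, h3 m hm a, hFW m hm a⟩
    have := hC _ _ _ M G (h1.congr (indE u).symm) (hFM.congr hm hFe)
    exact this.congr hm (indE u)
  have hex : ∃ M, Wb Ω p (k + 2) u M := by
    set nn : (Euc (n + 1) → ℝ) → ℝ≥0 := fun g => (eLpNorm g p (volume.restrict Ω)).toNNReal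
    set S : ℝ≥0 := ∑ m : Fin (k + 1), ∑ a, nn (W m (by omega) a) with hS
    refine ⟨_, main (nn u + nn F + S) ((lb_self huL).mono ?_) ((lb_self hFL).mono ?_) fun m hm a => (lb_self (hWL m hm a)).mono ?_⟩
    · rw [add_assoc]; exact le_self_add
    · rw [add_assoc, add_left_comm]; exact le_self_add
    · refine le_trans ?_ le_add_self
      refine le_trans ?_ (Finset.single_le_sum (f := fun m : Fin (k + 1) => ∑ a, nn (W m (by omega) a)) (fun _ _ => zero_le) (Finset.mem_univ ⟨m, by omega⟩))
      exact Finset.single_le_sum (f := fun a => nn (W m hm a)) (fun _ _ => zero_le) (Finset.mem_univ a)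
  obtain ⟨M0, hM0⟩ := hex
  have hMW : MemW Ω p (k + 2) u := by
    intro m hmk
    choose w h1 h2 using fun a => (hM0.down hmk).to_iw a
    exact ⟨w, hwd_iff.2 h2, fun a => (h1 a).1⟩
  refine ⟨hMW, ?_⟩
  obtain ⟨z, hz, hzL⟩ := hMW (k + 2) le_rfl
  refine ⟨z, hz, fun g hg => ?_⟩
  set Q := eLpNorm u p (volume.restrict Ω) + ∑ m ∈ Finset.range (k + 1), DkNorm Ω p (g m) with hQ
  by_cases hQt : Q = ⊤
  · rw [hQt, ENNReal.mul_top (by rw [Ne, ENNReal.ofReal_eq_zero, not_le]; positivity)]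
    exact le_top
  have hQc : ((Q.toNNReal : ℝ≥0) : ℝ≥0∞) = Q := ENNReal.coe_toNNReal hQt
  have hgle : ∀ m (_ : m ≤ k) a, eLpNorm (g m a) p (volume.restrict Ω) ≤ Q := by
    intro m hm a
    have h1 : eLpNorm (g m a) p (volume.restrict Ω) ≤ DkNorm Ω p (g m) := by
      refine eLpNorm_mono fun x => ?_
      rw [Real.norm_eq_abs]
      refine le_trans ?_ (le_abs_self _)
      exact Finset.single_le_sum (f := fun a => |g m a x|) (fun _ _ => abs_nonneg _) (Finset.mem_univ a)
    refine h1.trans (le_trans ?_ le_add_self)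
    exact Finset.single_le_sum (f := fun m => DkNorm Ω p (g m)) (fun _ _ => zero_le) (Finset.mem_range.2 (by omega))
  have hWb := main Q.toNNReal ⟨huL, by rw [hQc]; exact le_self_add⟩ ⟨hFL, by
      rw [hQc]
      refine le_trans (dich_le (g := g 0 Fin.elim0) hΩ hFL fun φ hφ => ?_) (hgle 0 (by omega) _)
      have := hwd_iff.1 (hg 0 (by omega)) Fin.elim0 φ hφ
      rw [← hF φ hφ]
      simpa [iterPD] using this.symm⟩ fun m hm a => ⟨hWL m hm a, by
      rw [hQc]
      refine le_trans (dich_le (g := g m a) hΩ (hWL m hm a) fun φ hφ => ?_) (hgle m hm a)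
      exact IW.unique hΩ (hwd_iff.1 (hg m hm) a) (hwd_iff.1 (hW m hm) a) hφ⟩
  have hza : ∀ a, eLpNorm (z a) p (volume.restrict Ω) ≤ C * Q := by
    intro a
    obtain ⟨w, h1, h2⟩ := hWb.to_iw a
    have e : z a =ᵐ[volume.restrict Ω] w := ae_eq_of_test (p := p) hΩ (hzL a) h1.1 fun φ hφ => IW.unique hΩ (hwd_iff.1 hz a) h2 hφ
    rw [eLpNorm_congr_ae e]
    refine h1.2.trans ?_
    rw [ENNReal.coe_mul, hQc]
  have hsum : DkNorm Ω p z ≤ ∑ a, eLpNorm (z a) p (volume.restrict Ω) := by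
    have := eLpNorm_sum_le (f := fun a x => |z a x|) (s := Finset.univ) (p := p) (μ := volume.restrict Ω) (fun a _ => (hzL a).1.norm) hp1.out
    have e : Dmag z = ∑ a, fun x => |z a x| := by
      funext x
      rw [Finset.sum_apply]; rfl
    rw [DkNorm, e]
    refine this.trans (Finset.sum_le_sum fun a _ => ?_)
    exact (eLpNorm_norm (z a)).le
  calc DkNorm Ω p z ≤ ∑ a, eLpNorm (z a) p (volume.restrict Ω) := hsum
    _ ≤ ∑ a : Fin (k + 2) → Fin (n + 1), C * Q := Finset.sum_le_sum fun a _ => hza a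
    _ = N * (C * Q) := by rw [Finset.sum_const, Finset.card_univ, nsmul_eq_mul]
    _ ≤ ENNReal.ofReal ((N * C + 1 : ℝ≥0) : ℝ) * Q := by
      rw [ENNReal.ofReal_coe_nnreal, ← mul_assoc]
      gcongr
      push_cast
      exact le_self_add
end Ell

/-- Global higher elliptic regularity: on a bounded domain with
`C^{k+2}` boundary, if `u ∈ W^{2,p}(Ω)` solves `Δu = f` with `f ∈ W^{k,p}(Ω)` and
`u = 0` on `∂Ω`, then `u ∈ W^{k+2,p}(Ω)` and
`‖D^{k+2}u‖_{L^p(Ω)} ≤ C(‖u‖_{L^p(Ω)} + ‖f‖_{W^{k,p}(Ω)})`. -/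
theorem elliptic_global_higher_regularity
    (d k : ℕ) (Ω : Set (Euc d)) (hΩ : IsBoundedDomain Ω)
    (hΩk : HasCkBoundary Ω (k + 2 : ℕ)) (p : ℝ≥0∞) (hp1 : 1 < p) (hp2 : p ≠ ⊤) :
    ∃ C : ℝ, 0 < C ∧
      ∀ u f : Euc d → ℝ, MemW Ω p 2 u → MemW Ω p k f →
        IsWeakLap Ω u f → MemW10 Ω p u →
        MemW Ω p (k + 2) u ∧
        ∃ v, HasWeakDerivs Ω (k + 2) u v ∧
          ∀ g : (m : ℕ) → (Fin m → Fin d) → Euc d → ℝ,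
            (∀ m, m ≤ k → HasWeakDerivs Ω m f (g m)) →
            DkNorm Ω p v ≤ ENNReal.ofReal C *
              (eLpNorm u p (volume.restrict Ω) +
                ∑ m ∈ Finset.range (k + 1), DkNorm Ω p (g m)) := by
  cases d with
  | zero =>
    refine ⟨1, one_pos, fun u f hu _ _ _ => ?_⟩
    have hz : ∀ m : ℕ, HasWeakDerivs Ω (m + 1) u (fun _ _ => 0) := fun m a => (a 0).elim0
    refine ⟨fun m _ => ?_, _, hz (k + 1), fun g _ => ?_⟩
    · cases m with
      | zero => exact hu 0 (by omega)
      | succ m => exact ⟨_, hz m, fun a => MemLp.zero'⟩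
    · refine Ell.dk_zero.le.trans ?_
      exact zero_le
  | succ n =>
    haveI : Fact (1 ≤ p) := ⟨hp1.le⟩
    haveI : Fact (p ≠ ⊤) := ⟨hp2⟩
    exact Ell.final hp1 k hΩ.1 hΩ.2.2 hΩk
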